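/- Pentagon identity for the tetrahedral weights: for all real numbers α, β, γ, δ, one has ∫_{[0,1]} g_{a₄,c₄}(γ−σ, α+δ−σ) · g_{a₂,c₂}(σ, β+δ) · g_{a₀,c₀}(α−σ, β+γ−σ) dσ = e^{−iπ P_e/(12ħ)} · g_{a₁,c₁}(α, β) · g_{a₃,c₃}(γ, δ). -/

import Mathlib

open Real MeasureTheory

noncomputable section

/-- `c_𝖻 = i(𝖻 + 𝖻⁻¹)/2`. -/
def cB (bb : ℝ) : ℂ := Complex.I * (bb + bb⁻¹) / 2

/-- The integrand in the definition of Faddeev's quantum dilogarithm. -/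
def phiKer (bb : ℝ) (z w : ℂ) : ℂ :=
  Complex.exp (-2 * Complex.I * z * w) /
    (4 * Complex.sinh (w * bb) * Complex.sinh (w / bb) * w)

/-- Faddeev's quantum dilogarithm on the strip `|Im z| < Im c_𝖻`, defined by the
contour integral over `ℝ + iε` with `ε = π·min(𝖻,𝖻⁻¹)/2`. -/
def PhiS (bb : ℝ) (z : ℂ) : ℂ :=
  Complex.exp (∫ t : ℝ, phiKer bb z (t + Complex.I * (π * min bb bb⁻¹ / 2)))

/-- The factor appearing in the functional equation:
`Φ_𝖻(z) = Efac 𝖻 z · Φ_𝖻(z + i𝖻)`. -/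
def Efac (bb : ℝ) (z : ℂ) : ℂ := 1 + Complex.exp (2 * π * bb * (z + Complex.I * bb / 2))

/-- Number of upward shifts by `i𝖻` needed to bring `z` into the strip. -/
def nUp (bb : ℝ) (z : ℂ) : ℕ := ⌊(-((bb + bb⁻¹) / 2) - z.im) / bb⌋₊ + 1

/-- Number of downward shifts by `i𝖻` needed to bring `z` into the strip. -/
def nDn (bb : ℝ) (z : ℂ) : ℕ := ⌊(z.im - (bb + bb⁻¹) / 2) / bb⌋₊ + 1

/-- Faddeev's quantum dilogarithm `Φ_𝖻`, extended from the strip `|Im z| < Im c_𝖻`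
to all of `ℂ` as a meromorphic function by the functional equation
`Φ_𝖻(z - i𝖻/2) = (1 + e^{2π𝖻z}) Φ_𝖻(z + i𝖻/2)`. -/
def Phi (bb : ℝ) (z : ℂ) : ℂ :=
  if z.im ≤ -((bb + bb⁻¹) / 2) then
    (∏ k ∈ Finset.range (nUp bb z), Efac bb (z + Complex.I * k * bb)) *
      PhiS bb (z + Complex.I * (nUp bb z) * bb)
  else if (bb + bb⁻¹) / 2 ≤ z.im then
    PhiS bb (z - Complex.I * (nDn bb z) * bb) /
      ∏ k ∈ Finset.range (nDn bb z), Efac bb (z - Complex.I * (k + 1) * bb)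
  else PhiS bb z

/-- `ψ_{a,c}(t) = Φ_𝖻(t - 2c_𝖻(a+c))⁻¹ e^{-4πi c_𝖻 a (t - c_𝖻(a+c))} e^{-πi c_𝖻²(4(a-c)+1)/6}`. -/
def psiF (bb a c : ℝ) (t : ℂ) : ℂ :=
  (Phi bb (t - 2 * cB bb * (a + c)))⁻¹ *
    Complex.exp (-4 * π * Complex.I * cB bb * a * (t - cB bb * (a + c))) *
    Complex.exp (-π * Complex.I * (cB bb) ^ 2 * (4 * (a - c) + 1) / 6)

/-- `ψ̄_{a,c}(t) = Φ_𝖻(t + 2c_𝖻(a+c)) e^{-4πi c_𝖻 a (t + c_𝖻(a+c))} e^{πi c_𝖻²(4(a-c)+1)/6}`. -/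
def psiBar (bb a c : ℝ) (t : ℂ) : ℂ :=
  Phi bb (t + 2 * cB bb * (a + c)) *
    Complex.exp (-4 * π * Complex.I * cB bb * a * (t + cB bb * (a + c))) *
    Complex.exp (π * Complex.I * (cB bb) ^ 2 * (4 * (a - c) + 1) / 6)

/-- `ψ̃_{a,c}(s) = ∫_ℝ ψ_{a,c}(t) e^{-2πi s t} dt`. -/
def psiT (bb a c : ℝ) (s : ℝ) : ℂ :=
  ∫ t : ℝ, psiF bb a c t * Complex.exp (-2 * π * Complex.I * s * t)

/-- `ψ̃′_{a,c}(s) = e^{-πi s²} ψ̃_{a,c}(s)`. -/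
def psiT' (bb a c : ℝ) (s : ℝ) : ℂ :=
  Complex.exp (-π * Complex.I * s ^ 2) * psiT bb a c s

/-- `g_{a,c}(s,t) = Σ_{m∈ℤ} ψ̃′_{a,c}(s+m) e^{iπ t (s+2m)}`. -/
def gW (bb a c : ℝ) (s t : ℝ) : ℂ :=
  ∑' m : ℤ, psiT' bb a c (s + m) * Complex.exp (Complex.I * π * t * (s + 2 * m))

section Analysis

open Complex (I)
open Set Filter Topology

lemma integrable_exp_neg_mul_abs {c : ℝ} (hc : 0 < c) :
    Integrable fun x : ℝ => Real.exp (-(c * |x|)) := by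
  rw [← integrableOn_univ, ← Iic_union_Ioi (a := (0 : ℝ))]
  refine IntegrableOn.union ?_ ?_
  · refine (integrableOn_exp_mul_Iic hc 0).congr_fun (fun x hx => ?_) measurableSet_Iic
    simp [abs_of_nonpos (show x ≤ 0 from hx)]
  · refine (integrableOn_exp_mul_Ioi (neg_lt_zero.2 hc) 0).congr_fun (fun x hx => ?_)
      measurableSet_Ioi
    simp [abs_of_pos (show 0 < x from hx)]

lemma integrable_of_norm_le_exp {f : ℝ → ℂ} (hf : Continuous f) {C c : ℝ} (hc : 0 < c)
    (h : ∀ x, ‖f x‖ ≤ C * Real.exp (-(c * |x|))) : Integrable f :=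
  ((integrable_exp_neg_mul_abs hc).const_mul C).mono' hf.aestronglyMeasurable
    (Eventually.of_forall h)

/-- Horizontal contours may be shifted across a strip on which the integrand is holomorphic and
decays exponentially. -/
lemma integral_line_eq {F : ℂ → ℂ} {y₁ y₂ C c : ℝ} (h12 : y₁ ≤ y₂) (hc : 0 < c)
    (hF : ∀ z : ℂ, y₁ ≤ z.im → z.im ≤ y₂ → DifferentiableAt ℂ F z)
    (hb : ∀ z : ℂ, y₁ ≤ z.im → z.im ≤ y₂ → ‖F z‖ ≤ C * Real.exp (-(c * |z.re|))) :
    ∫ x : ℝ, F (x + y₁ * I) = ∫ x : ℝ, F (x + y₂ * I) := by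
  have hInt : ∀ y, y₁ ≤ y → y ≤ y₂ → Integrable fun x : ℝ => F (x + y * I) := by
    intro y h1 h2
    refine integrable_of_norm_le_exp (C := C) (c := c) ?_ hc ?_
    · rw [continuous_iff_continuousAt]
      intro x
      have := (hF (x + y * I) (by simpa using h1) (by simpa using h2)).continuousAt
      exact ContinuousAt.comp (f := fun x : ℝ => (x + y * I : ℂ)) this (by fun_prop)
    · intro x
      simpa using hb (x + y * I) (by simpa using h1) (by simpa using h2)
  have lim : ∀ y, y₁ ≤ y → y ≤ y₂ → Tendsto (fun R : ℝ => ∫ x in (-R)..R, F (x + y * I)) atTop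
      (𝓝 (∫ x : ℝ, F (x + y * I))) := fun y h1 h2 =>
    intervalIntegral_tendsto_integral (hInt y h1 h2) tendsto_neg_atTop_atBot tendsto_id
  have rect : ∀ R : ℝ, (∫ x in (-R)..R, F (x + y₁ * I)) - (∫ x in (-R)..R, F (x + y₂ * I)) +
      I • (∫ y in y₁..y₂, F (R + y * I)) - I • (∫ y in y₁..y₂, F ((-R : ℝ) + y * I)) = 0 := by
    intro R
    have := Complex.integral_boundary_rect_eq_zero_of_differentiableOn F
      (⟨-R, y₁⟩ : ℂ) (⟨R, y₂⟩ : ℂ) (by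
        intro z hz
        have := hz.2
        simp only [mem_preimage, uIcc_of_le h12, mem_Icc] at this
        exact (hF z this.1 this.2).differentiableWithinAt)
    simpa using this
  have side : ∀ s : ℝ, |s| = 1 →
      Tendsto (fun R : ℝ => ∫ y in y₁..y₂, F ((s * R : ℝ) + y * I)) atTop (𝓝 0) := by
    intro s hs
    have hb' : ∀ R : ℝ, ‖∫ y in y₁..y₂, F ((s * R : ℝ) + y * I)‖
        ≤ C * Real.exp (-(c * |R|)) * |y₂ - y₁| := by
      intro R
      apply intervalIntegral.norm_integral_le_of_norm_le_const
      intro y hy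
      rw [uIoc_of_le h12] at hy
      simpa [abs_mul, hs] using hb ((s * R : ℝ) + y * I) (by simpa using hy.1.le)
        (by simpa using hy.2)
    refine squeeze_zero_norm hb' ?_
    have h1 : Tendsto (fun R : ℝ => Real.exp (-(c * |R|))) atTop (𝓝 0) :=
      Real.tendsto_exp_neg_atTop_nhds_zero.comp
        (tendsto_abs_atTop_atTop.const_mul_atTop hc)
    simpa using (h1.const_mul C).mul_const |y₂ - y₁|
  have s1 := side 1 (by simp)
  have s2 := side (-1) (by simp)
  have tot := (((lim y₁ le_rfl h12).sub (lim y₂ h12 le_rfl)).add (s1.const_smul I)).sub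
    (s2.const_smul I)
  have : Tendsto (fun _ : ℝ => (0 : ℂ)) atTop (𝓝 ((∫ x : ℝ, F (x + y₁ * I)) -
      (∫ x : ℝ, F (x + y₂ * I)) + I • (0 : ℂ) - I • (0 : ℂ))) := by
    refine tot.congr fun R => ?_
    simpa using rect R
  have := tendsto_nhds_unique this tendsto_const_nhds
  simpa [sub_eq_zero] using this

/-- A continuous function decaying exponentially for `1 ≤ |Re z|` in a closed strip decays
exponentially in the whole strip. -/
lemma exists_norm_le_exp_of_one_le {F : ℂ → ℂ} {y₁ y₂ C c : ℝ}
    (hF : ∀ z : ℂ, y₁ ≤ z.im → z.im ≤ y₂ → ContinuousAt F z)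
    (hb : ∀ z : ℂ, y₁ ≤ z.im → z.im ≤ y₂ → 1 ≤ |z.re| → ‖F z‖ ≤ C * Real.exp (-(c * |z.re|))) :
    ∃ C' : ℝ, ∀ z : ℂ, y₁ ≤ z.im → z.im ≤ y₂ → ‖F z‖ ≤ C' * Real.exp (-(c * |z.re|)) := by
  have hK : IsCompact (Icc (-1 : ℝ) 1 ×ℂ Icc y₁ y₂) := isCompact_Icc.reProdIm isCompact_Icc
  obtain ⟨D, hD⟩ := hK.exists_bound_of_continuousOn (f := F) fun z hz =>
    (hF z hz.2.1 hz.2.2).continuousWithinAt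
  refine ⟨max C (D * Real.exp |c|), fun z h1 h2 => ?_⟩
  rcases le_or_gt 1 |z.re| with h | h
  · exact (hb z h1 h2 h).trans (by gcongr; exact le_max_left _ _)
  · have hd := hD z ⟨by simpa [abs_le] using h.le, h1, h2⟩
    have hD0 : 0 ≤ D := (norm_nonneg _).trans hd
    have : 1 ≤ Real.exp |c| * Real.exp (-(c * |z.re|)) := by
      rw [← Real.exp_add]
      apply Real.one_le_exp
      nlinarith [abs_nonneg c, le_abs_self c, abs_nonneg z.re]
    calc ‖F z‖ ≤ D * 1 := by simpa using hd
      _ ≤ D * (Real.exp |c| * Real.exp (-(c * |z.re|))) := by gcongr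
      _ = (D * Real.exp |c|) * Real.exp (-(c * |z.re|)) := by ring
      _ ≤ _ := by gcongr; exact le_max_right _ _

lemma exp_mul_le_add_exp {p q σ x : ℝ} (h1 : p ≤ σ) (h2 : σ ≤ q) :
    Real.exp (σ * x) ≤ Real.exp (p * x) + Real.exp (q * x) := by
  rcases le_total 0 x with hx | hx
  · exact (Real.exp_le_exp.2 (by nlinarith)).trans (le_add_of_nonneg_left (Real.exp_nonneg _))
  · exact (Real.exp_le_exp.2 (by nlinarith)).trans (le_add_of_nonneg_right (Real.exp_nonneg _))

lemma abs_mul_exp_le {p q σ η x : ℝ} (hη : 0 < η) (h1 : p ≤ σ - η) (h2 : σ + η ≤ q) :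
    |x| * Real.exp (σ * x) ≤ η⁻¹ * (Real.exp (p * x) + Real.exp (q * x)) := by
  have h3 : η * |x| ≤ Real.exp (η * |x|) := by linarith [Real.add_one_le_exp (η * |x|)]
  have h4 : Real.exp (η * |x|) * Real.exp (σ * x) ≤ Real.exp (p * x) + Real.exp (q * x) := by
    rw [← Real.exp_add]
    rcases le_total 0 x with hx | hx
    · rw [abs_of_nonneg hx]
      exact (Real.exp_le_exp.2 (by nlinarith)).trans
        (le_add_of_nonneg_left (Real.exp_nonneg (p * x)))
    · rw [abs_of_nonpos hx]
      exact (Real.exp_le_exp.2 (by nlinarith)).trans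
        (le_add_of_nonneg_right (Real.exp_nonneg (q * x)))
  rw [inv_mul_eq_div, le_div_iff₀ hη]
  nlinarith [Real.exp_pos (σ * x)]

lemma norm_exp_mul_ofReal (s : ℂ) (x : ℝ) : ‖Complex.exp (s * x)‖ = Real.exp (s.re * x) := by
  simp [Complex.norm_exp]

lemma integrable_laplace {ρ : ℝ → ℂ} {p q : ℝ} (hρ : AEStronglyMeasurable ρ)
    (hp : Integrable fun x => Real.exp (p * x) * ‖ρ x‖)
    (hq : Integrable fun x => Real.exp (q * x) * ‖ρ x‖) {s : ℂ} (h1 : p ≤ s.re) (h2 : s.re ≤ q) :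
    Integrable fun x : ℝ => Complex.exp (s * x) * ρ x := by
  refine (hp.add hq).mono' ?_ (Eventually.of_forall fun x => ?_)
  · exact (Continuous.aestronglyMeasurable (by fun_prop)).mul hρ
  · rw [norm_mul, norm_exp_mul_ofReal]
    simp only [Pi.add_apply, ← add_mul]
    gcongr
    exact exp_mul_le_add_exp h1 h2

/-- Bilateral Laplace transforms are holomorphic in their open strip of convergence. -/
lemma hasDerivAt_laplace {ρ : ℝ → ℂ} {p q : ℝ} (hρ : AEStronglyMeasurable ρ)
    (hp : Integrable fun x => Real.exp (p * x) * ‖ρ x‖)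
    (hq : Integrable fun x => Real.exp (q * x) * ‖ρ x‖) {s : ℂ} (h1 : p < s.re) (h2 : s.re < q) :
    HasDerivAt (fun s : ℂ => ∫ x : ℝ, Complex.exp (s * x) * ρ x)
      (∫ x : ℝ, x * Complex.exp (s * x) * ρ x) s := by
  obtain ⟨η, hη, h3, h4⟩ : ∃ η > 0, p ≤ s.re - 2 * η ∧ s.re + 2 * η ≤ q := by
    refine ⟨min (s.re - p) (q - s.re) / 2, ?_, ?_, ?_⟩
    · have := lt_min (sub_pos.2 h1) (sub_pos.2 h2); positivity
    · linarith [min_le_left (s.re - p) (q - s.re)]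
    · linarith [min_le_right (s.re - p) (q - s.re)]
  refine (hasDerivAt_integral_of_dominated_loc_of_deriv_le (Metric.ball_mem_nhds s hη)
    (F' := fun s x => x * Complex.exp (s * x) * ρ x)
    (bound := fun x => η⁻¹ * (Real.exp (p * x) + Real.exp (q * x)) * ‖ρ x‖)
    (Eventually.of_forall fun s' => (Continuous.aestronglyMeasurable (by fun_prop)).mul hρ)
    (integrable_laplace hρ hp hq h1.le h2.le)
    ((Continuous.aestronglyMeasurable (by fun_prop)).mul hρ) ?_ ?_ ?_).2
  · refine Eventually.of_forall fun x s' hs' => ?_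
    rw [norm_mul, norm_mul, norm_exp_mul_ofReal, Complex.norm_real, Real.norm_eq_abs]
    have : |s'.re - s.re| < η := by
      have := Complex.abs_re_le_norm (s' - s)
      rw [Metric.mem_ball, dist_eq_norm] at hs'
      simpa using this.trans_lt hs'
    rw [abs_lt] at this
    exact mul_le_mul_of_nonneg_right (abs_mul_exp_le hη (by linarith) (by linarith))
      (norm_nonneg _)
  · have := (hp.add hq).const_mul η⁻¹
    refine this.congr (Eventually.of_forall fun x => ?_)
    simp only [Pi.add_apply]; ring
  · refine Eventually.of_forall fun x s' _ => ?_
    have : HasDerivAt (fun s : ℂ => s * x) (x : ℂ) s' := by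
      simpa using (hasDerivAt_id s').mul_const (x : ℂ)
    have h := this.cexp.mul_const (ρ x)
    rwa [mul_comm (Complex.exp _)] at h

lemma norm_sinh_sq (z : ℂ) : ‖Complex.sinh z‖ ^ 2 = Real.sinh z.re ^ 2 + Real.sin z.im ^ 2 := by
  have hz : Complex.sinh z = (Real.sinh z.re * Real.cos z.im : ℝ) +
      (Real.cosh z.re * Real.sin z.im : ℝ) * I := by
    conv_lhs => rw [← Complex.re_add_im z]
    rw [Complex.sinh_add, Complex.cosh_mul_I, Complex.sinh_mul_I]
    push_cast
    ring
  rw [hz, ← Complex.normSq_eq_norm_sq, Complex.normSq_add_mul_I]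
  have := Real.cosh_sq z.re
  have := Real.sin_sq_add_cos_sq z.im
  nlinarith

lemma norm_sinh_ge (z : ℂ) : Real.sin z.im * Real.cosh z.re ≤ ‖Complex.sinh z‖ := by
  refine abs_le_of_sq_le_sq' ?_ (norm_nonneg _) |>.2
  rw [norm_sinh_sq, mul_pow]
  have := Real.cosh_sq z.re
  have := Real.sin_sq_add_cos_sq z.im
  nlinarith [sq_nonneg (Real.sinh z.re * Real.cos z.im)]

lemma sinh_ne_zero_of_abs_im_le {z : ℂ} (h : |z.im| ≤ π / 2) (hz : z ≠ 0) :
    Complex.sinh z ≠ 0 := by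
  intro h0
  have h1 := norm_sinh_sq z
  rw [h0, norm_zero] at h1
  have h2 : Real.sinh z.re = 0 := by
    nlinarith [sq_nonneg (Real.sinh z.re), sq_nonneg (Real.sin z.im)]
  have h3 : Real.sin z.im = 0 := by
    nlinarith [sq_nonneg (Real.sinh z.re), sq_nonneg (Real.sin z.im)]
  rw [abs_le] at h
  have h4 := (Real.sin_eq_zero_iff_of_lt_of_lt (by linarith [Real.pi_pos])
    (by linarith [Real.pi_pos])).1 h3
  exact hz (Complex.ext (by simpa using h2) (by simpa using h4))

/-- Away from the imaginary axis, `sinh` grows exponentially. -/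
lemma exists_le_norm_sinh {r : ℝ} (hr : 0 < r) :
    ∃ k > 0, ∀ z : ℂ, r ≤ |z.re| → k * Real.exp |z.re| ≤ ‖Complex.sinh z‖ := by
  refine ⟨(1 - Real.exp (-(2 * r))) / 2, ?_, fun z hz => ?_⟩
  · have : Real.exp (-(2 * r)) < 1 := by rw [Real.exp_lt_one_iff]; linarith
    linarith
  · have h1 : Real.sinh |z.re| ≤ ‖Complex.sinh z‖ := by
      refine abs_le_of_sq_le_sq' ?_ (norm_nonneg _) |>.2
      rw [norm_sinh_sq, ← Real.abs_sinh, sq_abs]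
      nlinarith [sq_nonneg (Real.sin z.im)]
    refine le_trans ?_ h1
    rw [Real.sinh_eq]
    have : Real.exp (-|z.re|) ≤ Real.exp (-(2 * r)) * Real.exp |z.re| := by
      rw [← Real.exp_add]; apply Real.exp_le_exp.2; linarith
    linarith

lemma half_exp_abs_le_cosh (x : ℝ) : Real.exp |x| / 2 ≤ Real.cosh x := by
  rw [← Real.cosh_abs, Real.cosh_eq]
  have := Real.exp_pos (-|x|)
  linarith

lemma inv_cosh_div_le {b : ℝ} (hb : 0 < b) (x : ℝ) :
    (Real.cosh (x / b))⁻¹ ≤ 2 * Real.exp (-(b⁻¹ * |x|)) := by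
  have := half_exp_abs_le_cosh (x / b)
  rw [abs_div, abs_of_pos hb, div_eq_inv_mul |x|] at this
  calc (Real.cosh (x / b))⁻¹ ≤ (Real.exp (b⁻¹ * |x|) / 2)⁻¹ := inv_anti₀ (by positivity) this
    _ = _ := by rw [inv_div, Real.exp_neg, div_eq_mul_inv]

/-- The Fourier transform of the hyperbolic secant at zero. -/
lemma integral_inv_cosh_div {b : ℝ} (hb : 0 < b) :
    ∫ x : ℝ, (Real.cosh (x / b))⁻¹ = π * b := by
  have hder : ∀ x : ℝ, HasDerivAt (fun x => 2 * b * Real.arctan (Real.exp (x / b)))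
      (Real.cosh (x / b))⁻¹ x := by
    intro x
    have h1 : HasDerivAt (fun x : ℝ => x / b) (1 / b) x := (hasDerivAt_id x).div_const b
    refine ((h1.exp.arctan).const_mul (2 * b)).congr_deriv ?_
    rw [Real.cosh_eq, Real.exp_neg]
    have := Real.exp_pos (x / b)
    field_simp
    ring
  have hInt : Integrable fun x : ℝ => (Real.cosh (x / b))⁻¹ := by
    refine ((integrable_exp_neg_mul_abs (inv_pos.2 hb)).const_mul 2).mono'
      (Continuous.aestronglyMeasurable ?_) (Eventually.of_forall fun x => ?_)
    · exact (Real.continuous_cosh.comp (continuous_id.div_const b)).inv₀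
        fun x => (Real.cosh_pos _).ne'
    · rw [Real.norm_eq_abs, abs_of_pos (inv_pos.2 (Real.cosh_pos _))]
      exact inv_cosh_div_le hb x
  have hbot : Tendsto (fun x => 2 * b * Real.arctan (Real.exp (x / b))) atBot (𝓝 (2 * b * 0)) := by
    refine Tendsto.const_mul _ ?_
    rw [← Real.arctan_zero]
    exact (Real.continuous_arctan.tendsto 0).comp
      (Real.tendsto_exp_atBot.comp (tendsto_id.atBot_div_const hb))
  have htop : Tendsto (fun x => 2 * b * Real.arctan (Real.exp (x / b))) atTop
      (𝓝 (2 * b * (π / 2))) := by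
    refine Tendsto.const_mul _ ?_
    exact (Real.tendsto_arctan_atTop.mono_right nhdsWithin_le_nhds).comp
      (Real.tendsto_exp_atTop.comp (tendsto_id.atTop_div_const hb))
  rw [integral_of_hasDerivAt_of_tendsto hder hInt hbot htop]
  ring

lemma differentiable_dslope {f : ℂ → ℂ} (hf : Differentiable ℂ f) (c : ℂ) :
    Differentiable ℂ (dslope f c) := by
  rw [← differentiableOn_univ] at hf ⊢
  exact (Complex.differentiableOn_dslope univ_mem).2 hf

lemma norm_exp_neg_two_I_mul (z w : ℂ) :
    ‖Complex.exp (-2 * I * z * w)‖ = Real.exp (2 * (z.re * w.im + z.im * w.re)) := by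
  rw [Complex.norm_exp]
  congr 1
  simp
  ring

lemma norm_exp_neg_two_I_mul_le {z w : ℂ} {η : ℝ} (h : |w.im| ≤ η) :
    ‖Complex.exp (-2 * I * z * w)‖ ≤
      Real.exp (2 * |z.re| * η) * Real.exp (2 * |z.im| * |w.re|) := by
  rw [norm_exp_neg_two_I_mul, ← Real.exp_add]
  apply Real.exp_le_exp.2
  have h1 : z.re * w.im ≤ |z.re| * η :=
    (le_abs_self _).trans (by rw [abs_mul]; gcongr)
  have h2 : z.im * w.re ≤ |z.im| * |w.re| := (le_abs_self _).trans (abs_mul _ _).le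
  linarith

/-- `dslope` of `w ↦ sinh (r w)` at the origin. -/
def sinhSlope (r : ℝ) : ℂ → ℂ := dslope (fun w : ℂ => Complex.sinh (r * w)) 0

lemma differentiable_sinhSlope (r : ℝ) : Differentiable ℂ (sinhSlope r) :=
  differentiable_dslope (Complex.differentiable_sinh.comp (by fun_prop)) 0

lemma sinhSlope_of_ne {r : ℝ} {w : ℂ} (hw : w ≠ 0) :
    sinhSlope r w = Complex.sinh (r * w) / w := by
  simp [sinhSlope, dslope_of_ne _ hw, slope_def_field]

lemma sinhSlope_ne_zero {r : ℝ} (hr : 0 < r) {w : ℂ} (h : r * |w.im| ≤ π / 2) :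
    sinhSlope r w ≠ 0 := by
  rcases eq_or_ne w 0 with rfl | hw
  · have : HasDerivAt (fun w : ℂ => Complex.sinh (r * w)) (r : ℂ) 0 := by
      have h1 : HasDerivAt (fun w : ℂ => (r : ℂ) * w) (r : ℂ) 0 := by
        simpa using (hasDerivAt_id (0 : ℂ)).const_mul (r : ℂ)
      simpa using h1.csinh
    rw [sinhSlope, dslope_same, this.deriv]
    exact_mod_cast hr.ne'
  · rw [sinhSlope_of_ne hw]
    refine div_ne_zero (sinh_ne_zero_of_abs_im_le ?_ ?_) hw
    · simpa [abs_mul, abs_of_pos hr] using h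
    · exact mul_ne_zero (by exact_mod_cast hr.ne') hw

/-- The Fourier transform of the hyperbolic secant. -/
lemma cosh_mul_integral_exp_div_cosh {b : ℝ} (hb : 0 < b) {z : ℂ} (hz : 2 * |z.im| < b⁻¹) :
    Complex.cosh (π * b * z) *
      ∫ t : ℝ, Complex.exp (-2 * I * z * t) * (Complex.cosh (t / b))⁻¹ = π * b := by
  set F : ℂ → ℂ := fun w => dslope (fun w => Complex.exp (-2 * I * z * w)) 0 w /
    sinhSlope b⁻¹ w with hFdef
  have hbpi : b⁻¹ * (π * b / 2) = π / 2 := by field_simp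
  have hS : ∀ w : ℂ, |w.im| ≤ π * b / 2 → sinhSlope b⁻¹ w ≠ 0 := fun w hw =>
    sinhSlope_ne_zero (inv_pos.2 hb) (by rw [← hbpi]; gcongr)
  have hFd : ∀ w : ℂ, |w.im| ≤ π * b / 2 → DifferentiableAt ℂ F w := fun w hw =>
    DifferentiableAt.div (differentiable_dslope (by fun_prop) 0 w)
      (differentiable_sinhSlope _ w) (hS w hw)
  have hFne : ∀ w : ℂ, w ≠ 0 → F w = (Complex.exp (-2 * I * z * w) - 1) /
      Complex.sinh (w / b) := by
    intro w hw
    simp only [hFdef]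
    rw [sinhSlope_of_ne hw, dslope_of_ne _ hw, slope_def_field]
    simp only [mul_zero, Complex.exp_zero, sub_zero, Complex.ofReal_inv]
    rw [div_div_div_cancel_right₀ hw, div_eq_inv_mul w]
  have him : ∀ w : ℂ, -(π * b / 2) ≤ w.im → w.im ≤ π * b / 2 → |w.im| ≤ π * b / 2 :=
    fun w h1 h2 => abs_le.2 ⟨h1, h2⟩
  obtain ⟨k, hk, hsinh⟩ := exists_le_norm_sinh (inv_pos.2 hb)
  obtain ⟨C, hC⟩ := exists_norm_le_exp_of_one_le (F := F) (y₁ := -(π * b / 2)) (y₂ := π * b / 2)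
    (c := b⁻¹ - 2 * |z.im|) (C := (Real.exp (2 * |z.re| * (π * b / 2)) + 1) / k)
    (fun w h1 h2 => (hFd w (him w h1 h2)).continuousAt) (by
      intro w h1 h2 h3
      have hw : w ≠ 0 := by rintro rfl; simp at h3; linarith
      rw [hFne w hw, norm_div]
      have hs := hsinh (w / b) (by
        rw [Complex.div_ofReal_re, abs_div, abs_of_pos hb, div_eq_inv_mul]
        exact le_mul_of_one_le_right (inv_pos.2 hb).le h3)
      rw [Complex.div_ofReal_re, abs_div, abs_of_pos hb, div_eq_inv_mul] at hs
      have hn : ‖Complex.exp (-2 * I * z * w) - 1‖ ≤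
          (Real.exp (2 * |z.re| * (π * b / 2)) + 1) * Real.exp (2 * |z.im| * |w.re|) := by
        refine (norm_sub_le _ _).trans ?_
        rw [norm_one, add_mul, one_mul]
        refine add_le_add (norm_exp_neg_two_I_mul_le (him w h1 h2)) (Real.one_le_exp ?_)
        positivity
      calc _ ≤ ((Real.exp (2 * |z.re| * (π * b / 2)) + 1) * Real.exp (2 * |z.im| * |w.re|)) /
            (k * Real.exp (b⁻¹ * |w.re|)) := by gcongr
        _ = _ := by
          rw [mul_div_mul_comm, ← Real.exp_sub]
          congr 2
          ring)
  have key := integral_line_eq (F := F) (by have := Real.pi_pos; linarith [mul_pos this hb])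
    (sub_pos.2 hz) (fun w h1 h2 => hFd w (him w h1 h2)) hC
  have hη : (π * b / 2 : ℝ) ≠ 0 := by positivity
  have hcosh : ∀ x : ℝ, Complex.cosh (x / b) ≠ 0 := fun x => by
    rw [← Complex.ofReal_div, ← Complex.ofReal_cosh]
    exact_mod_cast (Real.cosh_pos _).ne'
  have hI1 : Integrable fun t : ℝ => Complex.exp (-2 * I * z * t) * (Complex.cosh (t / b))⁻¹ := by
    refine integrable_of_norm_le_exp (C := 2) (c := b⁻¹ - 2 * |z.im|) ?_ (sub_pos.2 hz) fun t => ?_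
    · exact Continuous.mul (by fun_prop) ((Complex.continuous_cosh.comp (by fun_prop)).inv₀ hcosh)
    · rw [norm_mul, norm_inv, ← Complex.ofReal_div, ← Complex.ofReal_cosh, Complex.norm_real,
        Real.norm_eq_abs, abs_of_pos (Real.cosh_pos _), ← div_eq_mul_inv, div_le_iff₀
        (Real.cosh_pos _)]
      have h1 := norm_exp_neg_two_I_mul_le (z := z) (w := t) (η := 0) (by simp)
      have h2 := half_exp_abs_le_cosh (t / b)
      rw [abs_div, abs_of_pos hb, div_eq_inv_mul |t|] at h2
      simp only [mul_zero, Real.exp_zero, one_mul, Complex.ofReal_re] at h1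
      calc _ ≤ Real.exp (2 * |z.im| * |t|) := h1
        _ = 2 * Real.exp (-((b⁻¹ - 2 * |z.im|) * |t|)) * (Real.exp (b⁻¹ * |t|) / 2) := by
          have : 2 * |z.im| * |t| = -((b⁻¹ - 2 * |z.im|) * |t|) + b⁻¹ * |t| := by ring
          rw [this, Real.exp_add]; ring
        _ ≤ _ := by gcongr
  have hI0 : Integrable fun t : ℝ => (Complex.cosh (t / b))⁻¹ := by
    refine integrable_of_norm_le_exp (C := 2) (c := b⁻¹) ?_ (inv_pos.2 hb) fun t => ?_
    · exact (Complex.continuous_cosh.comp (by fun_prop)).inv₀ hcosh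
    · rw [norm_inv, ← Complex.ofReal_div, ← Complex.ofReal_cosh, Complex.norm_real,
        Real.norm_eq_abs, abs_of_pos (Real.cosh_pos _)]
      exact inv_cosh_div_le hb t
  have hY0 : ∫ t : ℝ, (Complex.cosh (t / b))⁻¹ = π * b := by
    have := integral_inv_cosh_div hb
    rw [← Complex.ofReal_mul, ← this, ← integral_complex_ofReal]
    simp
  have hne : ∀ (x y : ℝ), y ≠ 0 → (x + y * I : ℂ) ≠ 0 := by
    intro x y hy h
    apply hy
    simpa using congrArg Complex.im h
  have hbc : (b : ℂ) ≠ 0 := by exact_mod_cast hb.ne'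
  have e1 : ∀ x : ℝ, F (x + (π * b / 2 : ℝ) * I) = -I * (Complex.exp (π * b * z) *
      (Complex.exp (-2 * I * z * x) * (Complex.cosh (x / b))⁻¹) - (Complex.cosh (x / b))⁻¹) := by
    intro x
    rw [hFne _ (hne _ _ hη)]
    have h1 : ((x : ℂ) + (π * b / 2 : ℝ) * I) / b = x / b + (π / 2 : ℂ) * I := by
      push_cast; field_simp
    have h2 : Complex.sinh ((x : ℂ) / b + (π / 2 : ℂ) * I) = I * Complex.cosh (x / b) := by
      rw [Complex.sinh_add, Complex.cosh_mul_I, Complex.sinh_mul_I, Complex.cos_pi_div_two,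
        Complex.sin_pi_div_two]; ring
    have h3 : Complex.exp (-2 * I * z * (x + (π * b / 2 : ℝ) * I)) =
        Complex.exp (π * b * z) * Complex.exp (-2 * I * z * x) := by
      rw [← Complex.exp_add]; congr 1; push_cast; linear_combination (-π * b * z) * Complex.I_sq
    rw [h1, h2, h3, div_eq_mul_inv, mul_inv, Complex.inv_I]
    ring
  have e2 : ∀ x : ℝ, F (x + (-(π * b / 2) : ℝ) * I) = I * (Complex.exp (-(π * b * z)) *
      (Complex.exp (-2 * I * z * x) * (Complex.cosh (x / b))⁻¹) - (Complex.cosh (x / b))⁻¹) := by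
    intro x
    rw [hFne _ (hne _ _ (neg_ne_zero.2 hη))]
    have h1 : ((x : ℂ) + (-(π * b / 2) : ℝ) * I) / b = x / b - (π / 2 : ℂ) * I := by
      push_cast; field_simp; ring
    have h2 : Complex.sinh ((x : ℂ) / b - (π / 2 : ℂ) * I) = -I * Complex.cosh (x / b) := by
      rw [Complex.sinh_sub, Complex.cosh_mul_I, Complex.sinh_mul_I, Complex.cos_pi_div_two,
        Complex.sin_pi_div_two]; ring
    have h3 : Complex.exp (-2 * I * z * (x + (-(π * b / 2) : ℝ) * I)) =
        Complex.exp (-(π * b * z)) * Complex.exp (-2 * I * z * x) := by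
      rw [← Complex.exp_add]; congr 1; push_cast; linear_combination (π * b * z) * Complex.I_sq
    rw [h1, h2, h3, div_eq_mul_inv, mul_inv, inv_neg, Complex.inv_I]
    ring
  simp_rw [e1, e2] at key
  rw [integral_const_mul, integral_const_mul, integral_sub (hI1.const_mul _) hI0,
    integral_sub (hI1.const_mul _) hI0, integral_const_mul, integral_const_mul, hY0] at key
  rw [Complex.cosh]
  linear_combination (-I / 2) * key + ((Complex.exp (-(π * b * z)) + Complex.exp (π * b * z)) *
    (∫ t : ℝ, Complex.exp (-2 * I * z * t) * (Complex.cosh (t / b))⁻¹) / 2 - π * b) * Complex.I_sq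

end Analysis

section Dilogarithm

open Complex (I)
open Set Filter Topology

section Laplace

variable {ρ : ℝ → ℂ} {C c : ℝ}

lemma norm_exp_mul_le_exp (hb : ∀ x, ‖ρ x‖ ≤ C * Real.exp (-(c * |x|))) {p Y : ℝ} (hp : |p| ≤ Y)
    (x : ℝ) : Real.exp (p * x) * ‖ρ x‖ ≤ C * Real.exp (-((c - Y) * |x|)) := by
  have hC : 0 ≤ C * Real.exp (-(c * |x|)) := (norm_nonneg _).trans (hb x)
  calc Real.exp (p * x) * ‖ρ x‖ ≤ Real.exp (Y * |x|) * (C * Real.exp (-(c * |x|))) := by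
        have h1 : p * x ≤ Y * |x| :=
          (le_abs_self _).trans (by rw [abs_mul]; gcongr)
        gcongr
        exact hb x
    _ = C * (Real.exp (Y * |x|) * Real.exp (-(c * |x|))) := by ring
    _ = _ := by rw [← Real.exp_add]; congr 2; ring

lemma integrable_exp_mul_norm (hρ : Continuous ρ) (hb : ∀ x, ‖ρ x‖ ≤ C * Real.exp (-(c * |x|)))
    {p : ℝ} (hp : |p| < c) : Integrable fun x => Real.exp (p * x) * ‖ρ x‖ := by
  refine ((integrable_exp_neg_mul_abs (sub_pos.2 hp)).const_mul C).mono'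
    (Continuous.aestronglyMeasurable (by fun_prop)) (Eventually.of_forall fun x => ?_)
  rw [Real.norm_of_nonneg (by positivity)]
  exact norm_exp_mul_le_exp hb le_rfl x

lemma integrable_exp_mul (hρ : Continuous ρ) (hb : ∀ x, ‖ρ x‖ ≤ C * Real.exp (-(c * |x|)))
    {s : ℂ} (hs : |s.re| < c) : Integrable fun x : ℝ => Complex.exp (s * x) * ρ x :=
  integrable_laplace hρ.aestronglyMeasurable (integrable_exp_mul_norm hρ hb hs)
    (integrable_exp_mul_norm hρ hb hs) le_rfl le_rfl

lemma hasDerivAt_integral_exp_mul (hρ : Continuous ρ)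
    (hb : ∀ x, ‖ρ x‖ ≤ C * Real.exp (-(c * |x|))) {s : ℂ} (hs : |s.re| < c) :
    HasDerivAt (fun s : ℂ => ∫ x : ℝ, Complex.exp (s * x) * ρ x)
      (∫ x : ℝ, x * Complex.exp (s * x) * ρ x) s := by
  obtain ⟨q, h1, h2⟩ := exists_between hs
  have hq : 0 < q := (abs_nonneg _).trans_lt h1
  have h3 := abs_lt.1 h1
  exact hasDerivAt_laplace hρ.aestronglyMeasurable
    (integrable_exp_mul_norm hρ hb (p := -q) (by rwa [abs_neg, abs_of_pos hq]))
    (integrable_exp_mul_norm hρ hb (p := q) (by rwa [abs_of_pos hq])) h3.1 h3.2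

lemma exists_norm_integral_exp_mul_le (hb : ∀ x, ‖ρ x‖ ≤ C * Real.exp (-(c * |x|)))
    {Y : ℝ} (hY : Y < c) :
    ∃ D : ℝ, ∀ s : ℂ, |s.re| ≤ Y → ‖∫ x : ℝ, Complex.exp (s * x) * ρ x‖ ≤ D := by
  refine ⟨∫ x, C * Real.exp (-((c - Y) * |x|)), fun s hs => ?_⟩
  refine norm_integral_le_of_norm_le
    ((integrable_exp_neg_mul_abs (sub_pos.2 hY)).const_mul C) (Eventually.of_forall fun x => ?_)
  rw [norm_mul, norm_exp_mul_ofReal]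
  exact norm_exp_mul_le_exp hb hs x

end Laplace

variable {b : ℝ}

/-- The denominator of the kernel of the quantum dilogarithm, on the contour of integration. -/
def phiDen (b t : ℝ) : ℂ :=
  4 * Complex.sinh ((t + I * (π * b / 2)) * b) * Complex.sinh ((t + I * (π * b / 2)) / b) *
    (t + I * (π * b / 2))

lemma continuous_phiDen (b : ℝ) : Continuous (phiDen b) := by
  unfold phiDen
  simp only [div_eq_mul_inv _ (b : ℂ)]
  have := Complex.continuous_sinh
  fun_prop

lemma sin_pi_mul_sq_pos (hb : 0 < b) (hb1 : b ≤ 1) : 0 < Real.sin (π * b / 2 * b) := by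
  have hpi := Real.pi_pos
  apply Real.sin_pos_of_pos_of_lt_pi (by positivity)
  have : b * b ≤ 1 := by nlinarith
  nlinarith

lemma exists_le_norm_phiDen (hb : 0 < b) (hb1 : b ≤ 1) :
    ∃ k > 0, ∀ t, k * Real.exp ((b + b⁻¹) * |t|) ≤ ‖phiDen b t‖ := by
  have hs := sin_pi_mul_sq_pos hb hb1
  have hpi := Real.pi_pos
  refine ⟨4 * (Real.sin (π * b / 2 * b) * (1 / 2)) * (1 / 2) * (π * b / 2), by positivity,
    fun t => ?_⟩
  have h1 := norm_sinh_ge ((t + I * (π * b / 2)) * b)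
  have h2 := norm_sinh_ge ((t + I * (π * b / 2)) / b)
  have h3 := Complex.abs_im_le_norm (t + I * (π * b / 2))
  have e1 : (((t : ℂ) + I * (π * b / 2)) * b).im = π * b / 2 * b := by
    simp [Complex.mul_im, ← Complex.ofReal_mul]
  have e2 : (((t : ℂ) + I * (π * b / 2)) * b).re = t * b := by
    simp [Complex.mul_im, ← Complex.ofReal_mul]
  have e3 : (((t : ℂ) + I * (π * b / 2)) / b).im = π / 2 := by
    simp [Complex.div_ofReal_im, ← Complex.ofReal_mul]
    field_simp
  have e4 : (((t : ℂ) + I * (π * b / 2)) / b).re = t / b := by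
    simp [Complex.div_ofReal_re, ← Complex.ofReal_mul]
  have e5 : ((t : ℂ) + I * (π * b / 2)).im = π * b / 2 := by
    simp [← Complex.ofReal_mul]
  rw [e1, e2] at h1
  rw [e3, e4, Real.sin_pi_div_two, one_mul] at h2
  rw [e5, abs_of_pos (by positivity)] at h3
  have h4 := half_exp_abs_le_cosh (t * b)
  have h5 := half_exp_abs_le_cosh (t / b)
  rw [phiDen, norm_mul, norm_mul, norm_mul]
  have h6 : Real.exp ((b + b⁻¹) * |t|) = Real.exp |t * b| * Real.exp |t / b| := by
    rw [← Real.exp_add, abs_mul, abs_div, abs_of_pos hb]; congr 1; ring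
  have h7 : Real.sin (π * b / 2 * b) * (Real.exp |t * b| / 2) ≤
      ‖Complex.sinh ((t + I * (π * b / 2)) * b)‖ := le_trans (by gcongr) h1
  have h8 := h5.trans h2
  rw [h6]
  calc _ = 4 * (Real.sin (π * b / 2 * b) * (Real.exp |t * b| / 2)) * (Real.exp |t / b| / 2) *
        (π * b / 2) := by ring
    _ ≤ _ := by
      have : ‖(4 : ℂ)‖ = 4 := by norm_num
      rw [this]
      gcongr

lemma phiDen_ne_zero (hb : 0 < b) (hb1 : b ≤ 1) (t : ℝ) : phiDen b t ≠ 0 := by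
  obtain ⟨k, hk, h⟩ := exists_le_norm_phiDen hb hb1
  exact norm_pos_iff.1 ((by positivity : (0 : ℝ) < _).trans_le (h t))

lemma continuous_inv_phiDen (hb : 0 < b) (hb1 : b ≤ 1) : Continuous fun t => (phiDen b t)⁻¹ :=
  (continuous_phiDen b).inv₀ (phiDen_ne_zero hb hb1)

lemma exists_norm_inv_phiDen_le (hb : 0 < b) (hb1 : b ≤ 1) :
    ∃ C, ∀ t, ‖(phiDen b t)⁻¹‖ ≤ C * Real.exp (-((b + b⁻¹) * |t|)) := by
  obtain ⟨k, hk, h⟩ := exists_le_norm_phiDen hb hb1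
  refine ⟨k⁻¹, fun t => ?_⟩
  rw [norm_inv, Real.exp_neg, ← mul_inv]
  exact inv_anti₀ (by positivity) (h t)

/-- The logarithm of Faddeev's quantum dilogarithm on the strip `|Im z| < (b + b⁻¹) / 2`. -/
def logPhi (b : ℝ) (z : ℂ) : ℂ := ∫ t : ℝ, phiKer b z (t + I * (π * b / 2))

lemma PhiS_eq_exp_logPhi (hb : 0 < b) (hb1 : b ≤ 1) (z : ℂ) :
    PhiS b z = Complex.exp (logPhi b z) := by
  rw [PhiS, logPhi, min_eq_left (hb1.trans ((one_le_inv₀ hb).2 hb1))]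

lemma phiKer_eq (b : ℝ) (z : ℂ) (t : ℝ) : phiKer b z (t + I * (π * b / 2)) =
    Complex.exp (π * b * z) * (Complex.exp (-2 * I * z * t) * (phiDen b t)⁻¹) := by
  rw [phiKer, phiDen, div_eq_mul_inv, ← mul_assoc, ← Complex.exp_add]
  congr 2
  linear_combination (-z * π * b) * Complex.I_sq

lemma logPhi_eq (b : ℝ) (z : ℂ) : logPhi b z =
    Complex.exp (π * b * z) * ∫ t : ℝ, Complex.exp (-2 * I * z * t) * (phiDen b t)⁻¹ := by
  simp_rw [logPhi, phiKer_eq, integral_const_mul]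

lemma re_neg_two_I_mul (z : ℂ) : (-2 * I * z).re = 2 * z.im := by simp

lemma abs_re_neg_two_I_mul (z : ℂ) : |(-2 * I * z).re| = 2 * |z.im| := by
  rw [re_neg_two_I_mul, abs_mul, abs_two]

lemma integrable_phiKer (hb : 0 < b) (hb1 : b ≤ 1) {z : ℂ} (hz : |z.im| < (b + b⁻¹) / 2) :
    Integrable fun t : ℝ => phiKer b z (t + I * (π * b / 2)) := by
  obtain ⟨C, hC⟩ := exists_norm_inv_phiDen_le hb hb1
  simp_rw [phiKer_eq]
  exact (integrable_exp_mul (continuous_inv_phiDen hb hb1) hC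
    (by rw [abs_re_neg_two_I_mul]; linarith)).const_mul _

lemma differentiableAt_logPhi (hb : 0 < b) (hb1 : b ≤ 1) {z : ℂ} (hz : |z.im| < (b + b⁻¹) / 2) :
    DifferentiableAt ℂ (logPhi b) z := by
  obtain ⟨C, hC⟩ := exists_norm_inv_phiDen_le hb hb1
  have h1 := (hasDerivAt_integral_exp_mul (continuous_inv_phiDen hb hb1) hC (s := -2 * I * z)
    (by rw [abs_re_neg_two_I_mul]; linarith)).differentiableAt
  have h2 : DifferentiableAt ℂ (fun z => ∫ t : ℝ, Complex.exp (-2 * I * z * t) * (phiDen b t)⁻¹)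
    z := h1.comp z (f := fun z : ℂ => -2 * I * z) (by fun_prop)
  have h3 : logPhi b = fun z => Complex.exp (π * b * z) *
    ∫ t : ℝ, Complex.exp (-2 * I * z * t) * (phiDen b t)⁻¹ := funext (logPhi_eq b)
  rw [h3]
  exact DifferentiableAt.mul (by fun_prop) h2

lemma norm_exp_pi_mul (b : ℝ) (z : ℂ) :
    ‖Complex.exp (π * b * z)‖ = Real.exp (π * b * z.re) := by
  rw [Complex.norm_exp, ← Complex.ofReal_mul, Complex.re_ofReal_mul]

lemma exists_norm_logPhi_le (hb : 0 < b) (hb1 : b ≤ 1) {Y : ℝ} (hY : Y < (b + b⁻¹) / 2) :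
    ∃ C, ∀ z : ℂ, |z.im| ≤ Y → ‖logPhi b z‖ ≤ C * Real.exp (π * b * z.re) := by
  obtain ⟨C, hC⟩ := exists_norm_inv_phiDen_le hb hb1
  obtain ⟨D, hD⟩ := exists_norm_integral_exp_mul_le hC (Y := 2 * Y) (by linarith)
  refine ⟨D, fun z hz => ?_⟩
  rw [logPhi_eq, norm_mul, norm_exp_pi_mul, mul_comm]
  gcongr
  exact hD _ (by rw [abs_re_neg_two_I_mul]; linarith)

/-! ### The functional equation -/

/-- The density whose Laplace transform is, up to a factor, the difference of two shifts of the
logarithm of the quantum dilogarithm. -/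
def shiftDensity (b t : ℝ) : ℂ := I / 2 * (((t : ℂ) + I * (π * b / 2))⁻¹ * (Complex.cosh (t / b))⁻¹)

lemma contour_ne_zero (hb : 0 < b) (t : ℝ) : (t : ℂ) + I * (π * b / 2) ≠ 0 := by
  intro h
  have := congrArg Complex.im h
  simp [← Complex.ofReal_mul] at this
  exact hb.ne' this

lemma cosh_ofReal_div_ne_zero (b t : ℝ) : Complex.cosh (t / b) ≠ 0 := by
  rw [← Complex.ofReal_div, ← Complex.ofReal_cosh]
  exact_mod_cast (Real.cosh_pos _).ne'

lemma continuous_shiftDensity (hb : 0 < b) : Continuous (shiftDensity b) := by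
  unfold shiftDensity
  refine continuous_const.mul ((Continuous.inv₀ (by fun_prop) (contour_ne_zero hb)).mul
    (Continuous.inv₀ ?_ (cosh_ofReal_div_ne_zero b)))
  exact Complex.continuous_cosh.comp (Complex.continuous_ofReal.div_const _)

lemma norm_shiftDensity_le (hb : 0 < b) (t : ℝ) :
    ‖shiftDensity b t‖ ≤ 2 / (π * b) * Real.exp (-(b⁻¹ * |t|)) := by
  have hpi := Real.pi_pos
  have h3 := Complex.abs_im_le_norm (t + I * (π * b / 2))
  have e5 : ((t : ℂ) + I * (π * b / 2)).im = π * b / 2 := by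
    simp [← Complex.ofReal_mul]
  rw [e5, abs_of_pos (by positivity)] at h3
  have h4 : ‖(Complex.cosh (t / b))⁻¹‖ = (Real.cosh (t / b))⁻¹ := by
    rw [← Complex.ofReal_div, ← Complex.ofReal_cosh, norm_inv, Complex.norm_real,
      Real.norm_of_nonneg (Real.cosh_pos _).le]
  rw [shiftDensity, norm_mul, norm_mul, norm_div, Complex.norm_I, h4, norm_inv]
  have h5 : ‖(t : ℂ) + I * (π * b / 2)‖⁻¹ ≤ (π * b / 2)⁻¹ := inv_anti₀ (by positivity) h3
  calc _ ≤ 1 / ‖(2 : ℂ)‖ * ((π * b / 2)⁻¹ * (2 * Real.exp (-(b⁻¹ * |t|)))) := by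
        gcongr
        exact inv_cosh_div_le hb t
    _ = _ := by
        rw [Complex.norm_two]
        field_simp

lemma logPhi_sub_logPhi (hb : 0 < b) (hb1 : b ≤ 1) {z : ℂ} (hz : 2 * |z.im| < b⁻¹) :
    logPhi b (z - I * b / 2) - logPhi b (z + I * b / 2) = Complex.exp (π * b * z) *
      ∫ t : ℝ, Complex.exp (-2 * I * z * t) * shiftDensity b t := by
  have hz' := abs_lt.1 (show |z.im| < b⁻¹ / 2 by linarith)
  have e1 : (z - I * b / 2).im = z.im - b / 2 := by simp
  have e2 : (z + I * b / 2).im = z.im + b / 2 := by simp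
  rw [logPhi, logPhi, ← integral_sub
    (integrable_phiKer hb hb1 (by rw [e1, abs_lt]; constructor <;> linarith))
    (integrable_phiKer hb hb1 (by rw [e2, abs_lt]; constructor <;> linarith)),
    ← integral_const_mul]
  congr 1
  ext t
  have hs : Complex.sinh ((t + I * (π * b / 2)) / b) = I * Complex.cosh (t / b) := by
    have : ((t : ℂ) + I * (π * b / 2)) / b = t / b + π / 2 * I := by
      have : (b : ℂ) ≠ 0 := by exact_mod_cast hb.ne'
      field_simp
    rw [this, Complex.sinh_add, Complex.cosh_mul_I, Complex.sinh_mul_I, Complex.cos_pi_div_two,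
      Complex.sin_pi_div_two]
    ring
  have hd := phiDen_ne_zero hb hb1 t
  rw [phiDen] at hd
  have hd1 : Complex.sinh ((t + I * (π * b / 2)) * b) ≠ 0 := by
    intro h; rw [h] at hd; simp at hd
  have hw := contour_ne_zero hb t
  have hch := cosh_ofReal_div_ne_zero b t
  have hE : ∀ σ : ℂ, Complex.exp (-2 * I * (z + σ * (I * b / 2)) * (t + I * (π * b / 2))) =
      Complex.exp (π * b * z) * Complex.exp (-2 * I * z * t) *
        Complex.exp (σ * ((t + I * (π * b / 2)) * b)) := by
    intro σ
    rw [← Complex.exp_add, ← Complex.exp_add]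
    congr 1
    linear_combination (-z * π * b - σ * b * (t + I * (π * b / 2))) * Complex.I_sq
  have hm := hE (-1)
  have hp := hE 1
  rw [show z + -1 * (I * b / 2) = z - I * b / 2 by ring] at hm
  rw [show z + 1 * (I * b / 2) = z + I * b / 2 by ring] at hp
  rw [phiKer, phiKer, hm, hp, hs, shiftDensity]
  generalize hW : ((t : ℂ) + I * (π * b / 2)) = W at *
  have hsinh : Complex.exp (1 * (W * b)) - Complex.exp (-1 * (W * b)) =
      2 * Complex.sinh (W * b) := by
    rw [Complex.two_sinh]; ring_nf
  have hI := Complex.I_ne_zero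
  generalize Complex.sinh (W * b) = S at hsinh hd1 ⊢
  generalize Complex.exp (1 * (W * b)) = E1 at hsinh ⊢
  generalize Complex.exp (-1 * (W * b)) = E2 at hsinh ⊢
  field_simp
  rw [Complex.I_sq]
  linear_combination (-2 : ℂ) * hsinh

lemma hasDerivAt_shift (hb : 0 < b) {z : ℂ} (hz : 2 * |z.im| < b⁻¹) :
    HasDerivAt (fun z => Complex.exp (π * b * z) *
      ∫ t : ℝ, Complex.exp (-2 * I * z * t) * shiftDensity b t)
      (Complex.exp (π * b * z) * ∫ t : ℝ, Complex.exp (-2 * I * z * t) * (Complex.cosh (t / b))⁻¹)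
      z := by
  have hs : |(-2 * I * z).re| < b⁻¹ := by rwa [abs_re_neg_two_I_mul]
  have h1 := hasDerivAt_integral_exp_mul (continuous_shiftDensity hb) (norm_shiftDensity_le hb) hs
  have h2 : HasDerivAt (fun z : ℂ => -2 * I * z) (-2 * I) z := by
    simpa using (hasDerivAt_id z).const_mul (-2 * I)
  have h3 := h1.comp z h2
  have h4 : HasDerivAt (fun z : ℂ => (π : ℂ) * b * z) (π * b) z := by
    simpa using (hasDerivAt_id z).const_mul ((π : ℂ) * b)
  refine (h4.cexp.mul h3).congr_deriv ?_
  have i1 := integrable_exp_mul (continuous_shiftDensity hb) (norm_shiftDensity_le hb) hs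
  have i2 : Integrable fun t : ℝ => Complex.exp (-2 * I * z * t) * (Complex.cosh (t / b))⁻¹ := by
    refine integrable_exp_mul (C := 2) (c := b⁻¹) (Continuous.inv₀ ?_ (cosh_ofReal_div_ne_zero b))
      (fun t => ?_) hs
    · exact Complex.continuous_cosh.comp (Complex.continuous_ofReal.div_const _)
    · rw [Pi.inv_apply, ← Complex.ofReal_div, ← Complex.ofReal_cosh, norm_inv, Complex.norm_real,
        Real.norm_of_nonneg (Real.cosh_pos _).le]
      exact inv_cosh_div_le hb t
  have hpt : ∀ t : ℝ, (t : ℂ) * Complex.exp (-2 * I * z * t) * shiftDensity b t =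
      I / 2 * (Complex.exp (-2 * I * z * t) * (Complex.cosh (t / b))⁻¹) -
        I * (π * b / 2) * (Complex.exp (-2 * I * z * t) * shiftDensity b t) := by
    intro t
    have hw := contour_ne_zero hb t
    rw [shiftDensity]
    generalize Complex.exp (-2 * I * z * t) = E1
    generalize (Complex.cosh (t / b))⁻¹ = E2
    linear_combination (I / 2 * E1 * E2) * mul_inv_cancel₀ hw
  simp_rw [hpt]
  rw [integral_sub (i2.const_mul _) (i1.const_mul _), integral_const_mul, integral_const_mul]
  simp only [Function.comp]
  linear_combination (-Complex.exp (π * b * z) *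
    (∫ t : ℝ, Complex.exp (-2 * I * z * t) * (Complex.cosh (t / b))⁻¹) +
    Complex.exp (π * b * z) * π * b *
      (∫ t : ℝ, Complex.exp (-2 * I * z * t) * shiftDensity b t)) * Complex.I_sq

lemma one_add_exp_eq (b : ℝ) (z : ℂ) : 1 + Complex.exp (2 * π * b * z) =
    2 * Complex.exp (π * b * z) * Complex.cosh (π * b * z) := by
  have h : Complex.exp (π * b * z) * Complex.exp (-(π * b * z)) = 1 := by
    rw [← Complex.exp_add]; simp
  have h2 : Complex.exp (2 * π * b * z) = Complex.exp (π * b * z) * Complex.exp (π * b * z) := by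
    rw [← Complex.exp_add]; congr 1; ring
  rw [Complex.cosh, h2]
  linear_combination -h

lemma cosh_pi_mul_ne_zero (hb : 0 < b) {z : ℂ} (hz : 2 * |z.im| < b⁻¹) :
    Complex.cosh (π * b * z) ≠ 0 := by
  intro h
  have h1 := cosh_mul_integral_exp_div_cosh hb hz
  rw [h, zero_mul] at h1
  have : (π : ℂ) * b ≠ 0 := mul_ne_zero (by exact_mod_cast Real.pi_ne_zero)
    (by exact_mod_cast hb.ne')
  exact this h1.symm

lemma one_add_exp_ne_zero (hb : 0 < b) {z : ℂ} (hz : 2 * |z.im| < b⁻¹) :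
    1 + Complex.exp (2 * π * b * z) ≠ 0 := by
  rw [one_add_exp_eq]
  exact mul_ne_zero (mul_ne_zero two_ne_zero (Complex.exp_ne_zero _)) (cosh_pi_mul_ne_zero hb hz)

lemma exp_shift_eq (hb : 0 < b) {z : ℂ} (hz : 2 * |z.im| < b⁻¹) :
    Complex.exp (Complex.exp (π * b * z) *
      ∫ t : ℝ, Complex.exp (-2 * I * z * t) * shiftDensity b t) =
      1 + Complex.exp (2 * π * b * z) := by
  set Λ : ℂ → ℂ := fun z => Complex.exp (π * b * z) *
      ∫ t : ℝ, Complex.exp (-2 * I * z * t) * shiftDensity b t with hΛ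
  set E : ℂ → ℂ := fun z => Complex.exp (Λ z) / (1 + Complex.exp (2 * π * b * z)) with hE
  set S : Set ℂ := {z | -(b⁻¹ / 2) < z.im} ∩ {z | z.im < b⁻¹ / 2} with hS
  have memS : ∀ z : ℂ, z ∈ S ↔ 2 * |z.im| < b⁻¹ := by
    intro z
    have : 2 * |z.im| < b⁻¹ ↔ |z.im| < b⁻¹ / 2 := by
      constructor <;> intro h <;> linarith
    rw [this, abs_lt]; rfl
  have hSo : IsOpen S := (isOpen_lt continuous_const Complex.continuous_im).inter
    (isOpen_lt Complex.continuous_im continuous_const)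
  have hSc : Convex ℝ S := (convex_halfSpace_im_gt _).inter (convex_halfSpace_im_lt _)
  have hder : ∀ z ∈ S, HasDerivAt E 0 z := by
    intro z hz
    rw [memS] at hz
    have h1 := (hasDerivAt_shift hb hz).cexp
    have h4 : HasDerivAt (fun z : ℂ => 2 * (π : ℂ) * b * z) (2 * π * b) z := by
      simpa using (hasDerivAt_id z).const_mul (2 * (π : ℂ) * b)
    have h5 := (h4.cexp).const_add 1
    refine (h1.div h5 (one_add_exp_ne_zero hb hz)).congr_deriv ?_
    have h6 := cosh_mul_integral_exp_div_cosh hb hz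
    have h7 := one_add_exp_eq b z
    have h8 : Complex.exp (2 * π * b * z) = Complex.exp (π * b * z) * Complex.exp (π * b * z) := by
      rw [← Complex.exp_add]; congr 1; ring
    rw [div_eq_zero_iff]
    left
    set J := ∫ t : ℝ, Complex.exp (-2 * I * z * t) * (Complex.cosh (t / b))⁻¹
    rw [h7, h8]
    linear_combination (2 * Complex.exp (Λ z) * Complex.exp (π * b * z) ^ 2) * h6
  have hconst : ∀ n : ℕ, E (z - n) = E z := by
    intro n
    refine hSo.is_const_of_deriv_eq_zero hSc.isPreconnected
      (fun w hw => (hder w hw).differentiableAt.differentiableWithinAt)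
      (fun w hw => (hder w hw).deriv) ?_ ((memS z).2 hz)
    rw [memS]; simpa using hz
  have hlim : Tendsto (fun n : ℕ => E (z - n)) atTop (𝓝 1) := by
    have hre : Tendsto (fun n : ℕ => π * b * (z - n).re) atTop atBot := by
      refine Tendsto.const_mul_atBot (by have := Real.pi_pos; positivity) ?_
      have : (fun n : ℕ => (z - n).re) = fun n : ℕ => z.re + -(n : ℝ) := by
        ext n; simp [sub_eq_add_neg]
      rw [this]
      exact tendsto_atBot_add_const_left _ _ (tendsto_neg_atTop_atBot.comp
        tendsto_natCast_atTop_atTop)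
    have hexp : Tendsto (fun n : ℕ => Complex.exp (π * b * (z - n))) atTop (𝓝 0) := by
      rw [tendsto_zero_iff_norm_tendsto_zero]
      simp_rw [norm_exp_pi_mul]
      exact Real.tendsto_exp_atBot.comp hre
    have h2 : Tendsto (fun n : ℕ => Λ (z - n)) atTop (𝓝 0) := by
      obtain ⟨D, hD⟩ := exists_norm_integral_exp_mul_le (norm_shiftDensity_le hb) hz
      have h3 : Tendsto (fun n : ℕ => Real.exp (π * b * (z - n).re) * D) atTop (𝓝 (0 * D)) :=
        (Real.tendsto_exp_atBot.comp hre).mul_const D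
      rw [zero_mul] at h3
      refine squeeze_zero_norm (fun n => ?_) h3
      rw [hΛ]
      simp only
      rw [norm_mul, norm_exp_pi_mul]
      gcongr
      refine hD _ ?_
      rw [abs_re_neg_two_I_mul]; simp
    have h8 : ∀ w : ℂ, Complex.exp (2 * π * b * w) =
        Complex.exp (π * b * w) * Complex.exp (π * b * w) := by
      intro w; rw [← Complex.exp_add]; congr 1; ring
    have h9 := (((Complex.continuous_exp.tendsto 0).comp h2).div
      ((hexp.mul hexp).const_add 1) (by simp))
    simp only [Complex.exp_zero, mul_zero, add_zero, div_one] at h9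
    refine h9.congr fun n => ?_
    simp only [hE, h8]
    rfl
  have h1 : E z = 1 := by
    simp_rw [hconst] at hlim
    exact tendsto_nhds_unique tendsto_const_nhds hlim
  rw [hE] at h1
  exact (div_eq_one_iff_eq (one_add_exp_ne_zero hb hz)).1 h1

lemma PhiS_functional (hb : 0 < b) (hb1 : b ≤ 1) {z : ℂ} (hz : 2 * |z.im| < b⁻¹) :
    PhiS b (z - I * b / 2) = (1 + Complex.exp (2 * π * b * z)) * PhiS b (z + I * b / 2) := by
  rw [PhiS_eq_exp_logPhi hb hb1, PhiS_eq_exp_logPhi hb hb1, ← exp_shift_eq hb hz,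
    ← logPhi_sub_logPhi hb hb1 hz, ← Complex.exp_add]
  congr 1
  ring

end Dilogarithm

section Inversion

open Complex (I)
open Set Filter Topology

variable {b : ℝ}

lemma two_le_add_inv (hb : 0 < b) : 2 ≤ b + b⁻¹ := by
  have h : b * b⁻¹ = 1 := mul_inv_cancel₀ hb.ne'
  nlinarith [sq_nonneg (b - b⁻¹), inv_pos.2 hb]

/-- The second order remainder of the symmetrised kernel integrates to zero. -/
lemma integral_symm_kernel_eq_zero (hb : 0 < b) (hb1 : b ≤ 1) {z : ℂ}
    (hz : |z.im| < (b + b⁻¹) / 2) :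
    ∫ t : ℝ, (Complex.exp (-2 * I * z * (t + I * (π * b / 2))) +
      Complex.exp (-2 * I * (-z) * (t + I * (π * b / 2))) - 2 +
        4 * z ^ 2 * (t + I * (π * b / 2)) ^ 2) / phiDen b t = 0 := by
  have hpi := Real.pi_pos
  set η : ℝ := π * b / 2 with hη
  have hη0 : 0 < η := by positivity
  set G : ℂ → ℂ := fun w => (Complex.exp (-2 * I * z * w) + Complex.exp (-2 * I * (-z) * w) - 2 +
    4 * z ^ 2 * w ^ 2) / (4 * Complex.sinh (w * b) * Complex.sinh (w / b) * w) with hG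
  set A : ℂ → ℂ := dslope (dslope (fun w => z * w - Complex.sin (z * w)) 0) 0 with hA
  set B : ℂ → ℂ := dslope (fun w => z * w + Complex.sin (z * w)) 0 with hB
  set F : ℂ → ℂ := fun w => A w * B w / (sinhSlope b w * sinhSlope b⁻¹ w) with hF
  have d1 : Differentiable ℂ fun w => z * w - Complex.sin (z * w) := by fun_prop
  have d2 : Differentiable ℂ fun w => z * w + Complex.sin (z * w) := by fun_prop
  have dA : Differentiable ℂ A := differentiable_dslope (differentiable_dslope d1 0) 0
  have dB : Differentiable ℂ B := differentiable_dslope d2 0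
  have hS1 : ∀ w : ℂ, |w.im| ≤ η → sinhSlope b w ≠ 0 := fun w hw =>
    sinhSlope_ne_zero hb (by
      have : b * |w.im| ≤ 1 * η := by gcongr
      have : η ≤ π / 2 := by rw [hη]; nlinarith
      linarith)
  have hS2 : ∀ w : ℂ, |w.im| ≤ η → sinhSlope b⁻¹ w ≠ 0 := fun w hw =>
    sinhSlope_ne_zero (inv_pos.2 hb) (by
      have h : b⁻¹ * η = π / 2 := by rw [hη]; field_simp
      rw [← h]; gcongr)
  have hFd : ∀ w : ℂ, |w.im| ≤ η → DifferentiableAt ℂ F w := fun w hw =>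
    ((dA w).mul (dB w)).div ((differentiable_sinhSlope b w).mul (differentiable_sinhSlope b⁻¹ w))
      (mul_ne_zero (hS1 w hw) (hS2 w hw))
  have hder0 : deriv (fun w => z * w - Complex.sin (z * w)) 0 = 0 := by
    have h4 : HasDerivAt (fun w : ℂ => z * w) z 0 := by
      simpa using (hasDerivAt_id (0 : ℂ)).const_mul z
    have h5 := (h4.sub h4.csin).deriv
    simp at h5
    exact h5
  have hFG : ∀ w : ℂ, w ≠ 0 → F w = G w := by
    intro w hw
    have hA' : A w = (z * w - Complex.sin (z * w)) / w / w := by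
      rw [hA, dslope_of_ne _ hw, slope_def_field, dslope_same, hder0, dslope_of_ne _ hw,
        slope_def_field]
      simp
    have hB' : B w = (z * w + Complex.sin (z * w)) / w := by
      rw [hB, dslope_of_ne _ hw, slope_def_field]
      simp
    have hsin : Complex.exp (-2 * I * z * w) + Complex.exp (-2 * I * (-z) * w) - 2 =
        -4 * Complex.sin (z * w) ^ 2 := by
      have e1 : Complex.exp (-2 * I * z * w) = Complex.exp (-(z * w) * I) ^ 2 := by
        rw [← Complex.exp_nat_mul]; congr 1; push_cast; ring
      have e2 : Complex.exp (-2 * I * (-z) * w) = Complex.exp (z * w * I) ^ 2 := by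
        rw [← Complex.exp_nat_mul]; congr 1; push_cast; ring
      have e3 : Complex.exp (-(z * w) * I) * Complex.exp (z * w * I) = 1 := by
        rw [← Complex.exp_add]; simp
      rw [e1, e2, Complex.sin]
      linear_combination (2 - (Complex.exp (-(z * w) * I) - Complex.exp (z * w * I)) ^ 2 * 0) * e3
        + (Complex.exp (-(z * w) * I) - Complex.exp (z * w * I)) ^ 2 * Complex.I_sq
    simp only [hF, hG]
    rw [hA', hB', sinhSlope_of_ne hw, sinhSlope_of_ne hw, hsin, mul_comm w (b : ℂ),
      div_eq_inv_mul w (b : ℂ), Complex.ofReal_inv]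
    generalize Complex.sinh (b * w) = s1
    generalize Complex.sinh ((b : ℂ)⁻¹ * w) = s2
    rcases eq_or_ne s1 0 with rfl | h1
    · simp
    rcases eq_or_ne s2 0 with rfl | h2
    · simp
    field_simp
    ring
  have hGodd : ∀ w : ℂ, G (-w) = -G w := by
    intro w
    simp only [hG]
    rw [neg_mul w (b : ℂ), neg_div (b : ℂ) w, Complex.sinh_neg, Complex.sinh_neg,
      show -2 * I * z * -w = -2 * I * -z * w by ring,
      show -2 * I * -z * -w = -2 * I * z * w by ring, ← div_neg]
    congr 1 <;> ring
  set c : ℝ := (b + b⁻¹) / 2 - |z.im| with hc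
  have hc0 : 0 < c := by linarith
  have hQ := two_le_add_inv hb
  obtain ⟨k1, hk1, hs1⟩ := exists_le_norm_sinh hb
  obtain ⟨k2, hk2, hs2⟩ := exists_le_norm_sinh (inv_pos.2 hb)
  set M : ℝ := 2 * Real.exp (2 * |z.re| * η) + 2 + 4 * ‖z‖ ^ 2 * (4 + 2 * η ^ 2) with hM
  have him : ∀ w : ℂ, -η ≤ w.im → w.im ≤ η → |w.im| ≤ η := fun w h1 h2 => abs_le.2 ⟨h1, h2⟩
  obtain ⟨C, hC⟩ := exists_norm_le_exp_of_one_le (F := F) (y₁ := -η) (y₂ := η)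
    (c := c) (C := M / (4 * k1 * k2))
    (fun w h1 h2 => (hFd w (him w h1 h2)).continuousAt) (by
      intro w h1 h2 h3
      have hw : w ≠ 0 := by rintro rfl; simp at h3; linarith
      have him' := him w h1 h2
      have hs1' := hs1 (w * b) (by
        rw [Complex.re_mul_ofReal, abs_mul, abs_of_pos hb]
        exact le_mul_of_one_le_left hb.le h3)
      have hs2' := hs2 (w / b) (by
        rw [Complex.div_ofReal_re, abs_div, abs_of_pos hb, div_eq_mul_inv]
        exact le_mul_of_one_le_left (inv_pos.2 hb).le h3)
      rw [Complex.re_mul_ofReal, abs_mul, abs_of_pos hb] at hs1'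
      rw [Complex.div_ofReal_re, abs_div, abs_of_pos hb, div_eq_mul_inv] at hs2'
      have hw1 : 1 ≤ ‖w‖ := h3.trans (Complex.abs_re_le_norm w)
      have hwsq : ‖w‖ ^ 2 ≤ (4 + 2 * η ^ 2) * Real.exp |w.re| := by
        have h4 : ‖w‖ ^ 2 = |w.re| ^ 2 + |w.im| ^ 2 := by
          rw [← Complex.normSq_eq_norm_sq, Complex.normSq_apply, sq_abs, sq_abs]; ring
        have h5 := Real.quadratic_le_exp_of_nonneg (abs_nonneg w.re)
        have h6 : |w.im| ^ 2 ≤ η ^ 2 := by gcongr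
        have h7 : 1 ≤ Real.exp |w.re| := Real.one_le_exp (abs_nonneg _)
        have h8 : η ^ 2 * 1 ≤ η ^ 2 * Real.exp |w.re| := by gcongr
        nlinarith [abs_nonneg w.re]
      have e1 : Real.exp |w.re| ≤ Real.exp ((b + b⁻¹ - c) * |w.re|) := by
        apply Real.exp_le_exp.2
        have : 1 ≤ b + b⁻¹ - c := by rw [hc]; linarith [abs_nonneg z.im]
        nlinarith [abs_nonneg w.re]
      have e2 : Real.exp (2 * |z.im| * |w.re|) ≤ Real.exp ((b + b⁻¹ - c) * |w.re|) := by
        apply Real.exp_le_exp.2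
        have : 2 * |z.im| ≤ b + b⁻¹ - c := by rw [hc]; linarith
        gcongr
      have e3 : 1 ≤ Real.exp ((b + b⁻¹ - c) * |w.re|) :=
        (Real.one_le_exp (abs_nonneg _)).trans e1
      have n1 := norm_exp_neg_two_I_mul_le (z := z) him'
      have n2 := norm_exp_neg_two_I_mul_le (z := -z) him'
      rw [Complex.neg_re, Complex.neg_im, abs_neg, abs_neg] at n2
      have hn : ‖Complex.exp (-2 * I * z * w) + Complex.exp (-2 * I * (-z) * w) - 2 +
          4 * z ^ 2 * w ^ 2‖ ≤ M * Real.exp ((b + b⁻¹ - c) * |w.re|) := by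
        have t1 := norm_add_le (Complex.exp (-2 * I * z * w) + Complex.exp (-2 * I * (-z) * w) - 2)
          (4 * z ^ 2 * w ^ 2)
        have t2 := norm_sub_le (Complex.exp (-2 * I * z * w) + Complex.exp (-2 * I * (-z) * w)) 2
        have t3 := norm_add_le (Complex.exp (-2 * I * z * w)) (Complex.exp (-2 * I * (-z) * w))
        have t4 : ‖4 * z ^ 2 * w ^ 2‖ = 4 * ‖z‖ ^ 2 * ‖w‖ ^ 2 := by
          rw [norm_mul, norm_mul, norm_pow, norm_pow]; norm_num
        have t5 : ‖z‖ ^ 2 * ‖w‖ ^ 2 ≤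
            ‖z‖ ^ 2 * ((4 + 2 * η ^ 2) * Real.exp ((b + b⁻¹ - c) * |w.re|)) := by
          gcongr
          exact hwsq.trans (by gcongr)
        have t6 : Real.exp (2 * |z.re| * η) * Real.exp (2 * |z.im| * |w.re|) ≤
          Real.exp (2 * |z.re| * η) * Real.exp ((b + b⁻¹ - c) * |w.re|) := by gcongr
        rw [Complex.norm_two] at t2
        rw [hM]
        nlinarith
      rw [hFG w hw, hG]
      simp only
      rw [norm_div, norm_mul, norm_mul, norm_mul]
      have h4 : ‖(4 : ℂ)‖ = 4 := by norm_num
      rw [h4]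
      calc _ ≤ (M * Real.exp ((b + b⁻¹ - c) * |w.re|)) / (4 * (k1 * Real.exp (|w.re| * b)) *
            (k2 * Real.exp (|w.re| * b⁻¹)) * 1) := by gcongr
        _ = M / (4 * k1 * k2) * (Real.exp ((b + b⁻¹ - c) * |w.re|) /
            (Real.exp (|w.re| * b) * Real.exp (|w.re| * b⁻¹))) := by
          field_simp
        _ = _ := by
          rw [← Real.exp_add, ← Real.exp_sub]
          congr 2
          ring)
  have key := integral_line_eq (F := F) (by linarith) hc0
    (fun w h1 h2 => hFd w (him w h1 h2)) hC
  have hne : ∀ (x y : ℝ), y ≠ 0 → (x + y * I : ℂ) ≠ 0 := by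
    intro x y hy h
    apply hy
    simpa using congrArg Complex.im h
  have k1 : ∫ x : ℝ, F (x + (-η : ℝ) * I) = ∫ x : ℝ, G (x + (-η : ℝ) * I) := by
    congr 1; ext x; exact hFG _ (hne _ _ (neg_ne_zero.2 hη0.ne'))
  have k2 : ∫ x : ℝ, F (x + η * I) = ∫ x : ℝ, G (x + η * I) := by
    congr 1; ext x; exact hFG _ (hne _ _ hη0.ne')
  have k3 : ∫ x : ℝ, G (x + (-η : ℝ) * I) = -∫ x : ℝ, G (x + η * I) := by
    rw [← integral_neg_eq_self, ← integral_neg]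
    congr 1; ext x
    rw [← hGodd]
    congr 1
    push_cast; ring
  rw [k1, k2, k3] at key
  have : ∫ x : ℝ, G (x + η * I) = 0 := by
    linear_combination (-1 / 2 : ℂ) * key
  rw [← this]
  congr 1; ext t
  have e : (t : ℂ) + I * (π * b / 2) = t + η * I := by rw [hη]; push_cast; ring
  rw [phiDen, e]

lemma exists_logPhi_add_logPhi_neg (hb : 0 < b) (hb1 : b ≤ 1) :
    ∃ m₀ m₂ : ℂ, ∀ z : ℂ, |z.im| < (b + b⁻¹) / 2 →
      logPhi b z + logPhi b (-z) = m₀ + m₂ * z ^ 2 := by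
  obtain ⟨C, hC⟩ := exists_norm_inv_phiDen_le hb hb1
  have hQ := two_le_add_inv hb
  have i0 : Integrable fun t : ℝ => (phiDen b t)⁻¹ :=
    integrable_of_norm_le_exp (continuous_inv_phiDen hb hb1) (by linarith) hC
  have i2 : Integrable fun t : ℝ => ((t : ℂ) + I * (π * b / 2)) ^ 2 * (phiDen b t)⁻¹ := by
    refine integrable_of_norm_le_exp (C := (4 + 2 * (π * b / 2) ^ 2) * C) (c := 1)
      (Continuous.mul (by fun_prop) (continuous_inv_phiDen hb hb1)) one_pos fun t => ?_
    have hwsq : ‖(t : ℂ) + I * (π * b / 2)‖ ^ 2 ≤ (4 + 2 * (π * b / 2) ^ 2) * Real.exp |t| := by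
      have h4 : ‖(t : ℂ) + I * (π * b / 2)‖ ^ 2 = |t| ^ 2 + (π * b / 2) ^ 2 := by
        rw [← Complex.normSq_eq_norm_sq, Complex.normSq_apply, sq_abs]
        simp [← Complex.ofReal_mul]
        ring
      have h5 := Real.quadratic_le_exp_of_nonneg (abs_nonneg t)
      have h7 : 1 ≤ Real.exp |t| := Real.one_le_exp (abs_nonneg _)
      have h8 : (π * b / 2) ^ 2 * 1 ≤ (π * b / 2) ^ 2 * Real.exp |t| := by gcongr
      nlinarith [abs_nonneg t]
    rw [norm_mul, norm_pow]
    calc _ ≤ ((4 + 2 * (π * b / 2) ^ 2) * Real.exp |t|) *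
          (C * Real.exp (-((b + b⁻¹) * |t|))) := by gcongr; exact hC t
      _ = (4 + 2 * (π * b / 2) ^ 2) * C * (Real.exp |t| * Real.exp (-((b + b⁻¹) * |t|))) := by ring
      _ ≤ _ := by
        have hC0 : 0 ≤ C := by
          have := (norm_nonneg _).trans (hC 0)
          simpa using this
        rw [← Real.exp_add]
        gcongr
        nlinarith [abs_nonneg t]
  refine ⟨2 * ∫ t : ℝ, (phiDen b t)⁻¹,
    -4 * ∫ t : ℝ, ((t : ℂ) + I * (π * b / 2)) ^ 2 * (phiDen b t)⁻¹, fun z hz => ?_⟩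
  have hz' : |(-z).im| < (b + b⁻¹) / 2 := by simpa using hz
  have h := integral_symm_kernel_eq_zero hb hb1 hz
  have hpt : ∀ t : ℝ, (Complex.exp (-2 * I * z * (t + I * (π * b / 2))) +
      Complex.exp (-2 * I * (-z) * (t + I * (π * b / 2))) - 2 +
        4 * z ^ 2 * (t + I * (π * b / 2)) ^ 2) / phiDen b t =
      (phiKer b z (t + I * (π * b / 2)) + phiKer b (-z) (t + I * (π * b / 2))) -
      (2 * (phiDen b t)⁻¹ - 4 * z ^ 2 * (((t : ℂ) + I * (π * b / 2)) ^ 2 * (phiDen b t)⁻¹)) := by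
    intro t
    rw [phiKer, phiKer, phiDen]
    ring
  simp_rw [hpt] at h
  have i3 : Integrable fun t : ℝ =>
      phiKer b z (t + I * (π * b / 2)) + phiKer b (-z) (t + I * (π * b / 2)) :=
    (integrable_phiKer hb hb1 hz).add (integrable_phiKer hb hb1 hz')
  have i4 : Integrable fun t : ℝ => 2 * (phiDen b t)⁻¹ -
      4 * z ^ 2 * (((t : ℂ) + I * (π * b / 2)) ^ 2 * (phiDen b t)⁻¹) :=
    (i0.const_mul _).sub (i2.const_mul _)
  rw [integral_sub i3 i4, integral_add (integrable_phiKer hb hb1 hz)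
    (integrable_phiKer hb hb1 hz'), integral_sub (i0.const_mul _) (i2.const_mul _),
    integral_const_mul, integral_const_mul] at h
  rw [logPhi, logPhi]
  linear_combination h

lemma PhiS_ne_zero (b : ℝ) (z : ℂ) : PhiS b z ≠ 0 := Complex.exp_ne_zero _

/-- The inversion relation of the quantum dilogarithm. -/
lemma exists_PhiS_mul_PhiS_neg (hb : 0 < b) (hb1 : b ≤ 1) :
    ∃ ζ : ℂ, ζ ≠ 0 ∧ ∀ z : ℂ, |z.im| < (b + b⁻¹) / 2 →
      PhiS b z * PhiS b (-z) = ζ * Complex.exp (π * I * z ^ 2) := by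
  obtain ⟨m₀, m₂, h⟩ := exists_logPhi_add_logPhi_neg hb hb1
  have hP : ∀ z : ℂ, |z.im| < (b + b⁻¹) / 2 →
      PhiS b z * PhiS b (-z) = Complex.exp m₀ * Complex.exp (m₂ * z ^ 2) := by
    intro z hz
    rw [PhiS_eq_exp_logPhi hb hb1, PhiS_eq_exp_logPhi hb hb1, ← Complex.exp_add, h z hz,
      Complex.exp_add]
  have hbi := inv_pos.2 hb
  have key : ∀ x : ℝ, Complex.exp (-2 * I * b * m₂ * x) = Complex.exp (2 * π * b * x) := by
    intro x
    have h0 : 2 * |(x : ℂ).im| < b⁻¹ := by simpa using hbi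
    have h0' : 2 * |(-x : ℂ).im| < b⁻¹ := by simpa using hbi
    have h1 := PhiS_functional hb hb1 h0
    have h2 := PhiS_functional hb hb1 h0'
    have h3 := hP (x - I * b / 2) (by simp [abs_of_pos (half_pos hb)]; linarith)
    have h4 := hP (x + I * b / 2) (by simp [abs_of_pos (half_pos hb)]; linarith)
    rw [show -((x : ℂ) - I * b / 2) = -x + I * b / 2 by ring] at h3
    rw [show -((x : ℂ) + I * b / 2) = -x - I * b / 2 by ring, h2] at h4
    rw [h1] at h3
    have e1 : Complex.exp (2 * π * b * -x) * Complex.exp (2 * π * b * x) = 1 := by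
      rw [← Complex.exp_add]; ring_nf; simp
    have e2 : Complex.exp (-2 * I * b * m₂ * x) * Complex.exp (m₂ * (x + I * b / 2) ^ 2) =
        Complex.exp (m₂ * (x - I * b / 2) ^ 2) := by
      rw [← Complex.exp_add]; ring_nf
    have n1 := PhiS_ne_zero b (x + I * b / 2)
    have n2 := PhiS_ne_zero b (-x + I * b / 2)
    have n3 := Complex.exp_ne_zero m₀
    have n4 := Complex.exp_ne_zero (m₂ * (x + I * b / 2) ^ 2)
    have e3 : (Complex.exp m₀ * Complex.exp (m₂ * (x + I * b / 2) ^ 2)) *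
        (Complex.exp (-2 * I * b * m₂ * x) - Complex.exp (2 * π * b * x)) = 0 := by
      linear_combination (Complex.exp m₀) * e2 - h3 + Complex.exp (2 * π * b * x) * h4
        - PhiS b (x + I * b / 2) * PhiS b (-x + I * b / 2) * e1
    exact sub_eq_zero.1 ((mul_eq_zero.1 e3).resolve_left (mul_ne_zero n3 n4))
  have hder : -2 * I * b * m₂ = 2 * π * b := by
    have l1 : ∀ k : ℂ, HasDerivAt (fun x : ℝ => Complex.exp (k * x)) k 0 := by
      intro k
      have h1 : HasDerivAt (fun x : ℂ => Complex.exp (k * x)) k ((0 : ℝ) : ℂ) := by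
        have := ((hasDerivAt_id ((0 : ℝ) : ℂ)).const_mul k).cexp
        simpa using this
      exact h1.comp_ofReal
    have h2 := l1 (2 * π * b)
    rw [← funext key] at h2
    exact (l1 _).unique h2
  have hm : m₂ = π * I := by
    have hb' : (b : ℂ) ≠ 0 := by exact_mod_cast hb.ne'
    have : (2 * b : ℂ) * (m₂ - π * I) = 0 := by
      linear_combination I * hder + 2 * b * m₂ * Complex.I_sq
    have := (mul_eq_zero.1 this).resolve_left (by simpa using hb')
    exact sub_eq_zero.1 this
  exact ⟨Complex.exp m₀, Complex.exp_ne_zero _, fun z hz => by rw [hP z hz, hm]⟩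

lemma norm_exp_pi_I_sq (z : ℂ) :
    ‖Complex.exp (π * I * z ^ 2)‖ = Real.exp (-(2 * π * z.im * z.re)) := by
  rw [Complex.norm_exp]
  congr 1
  simp [pow_two]
  ring

/-- Two-sided bounds for the quantum dilogarithm in closed substrips. -/
lemma exists_norm_PhiS_le (hb : 0 < b) (hb1 : b ≤ 1) {Y : ℝ} (hY : Y < (b + b⁻¹) / 2) :
    ∃ C, 0 < C ∧ ∀ z : ℂ, |z.im| ≤ Y →
      ‖PhiS b z‖ ≤ C * Real.exp (-(2 * π * z.im * max z.re 0)) ∧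
      ‖(PhiS b z)⁻¹‖ ≤ C * Real.exp (2 * π * z.im * max z.re 0) := by
  obtain ⟨D, hD⟩ := exists_norm_logPhi_le hb hb1 hY
  obtain ⟨ζ, hζ, hinv⟩ := exists_PhiS_mul_PhiS_neg hb hb1
  have hζ' := norm_pos_iff.2 hζ
  have hpi := Real.pi_pos
  set E := Real.exp (max D 0) with hE
  have hE0 : 0 < E := Real.exp_pos _
  have hleft : ∀ z : ℂ, |z.im| ≤ Y → z.re ≤ 0 → ‖PhiS b z‖ ≤ E ∧ ‖(PhiS b z)⁻¹‖ ≤ E := by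
    intro z hz hre
    have h1 : ‖logPhi b z‖ ≤ max D 0 := by
      refine (hD z hz).trans ?_
      have h2 : Real.exp (π * b * z.re) ≤ 1 := by
        rw [Real.exp_le_one_iff]
        have := mul_pos hpi hb
        nlinarith
      calc D * Real.exp (π * b * z.re) ≤ max D 0 * Real.exp (π * b * z.re) := by
            gcongr; exact le_max_left _ _
        _ ≤ max D 0 * 1 := by gcongr
        _ = _ := mul_one _
    have h3 := (abs_le.1 ((Complex.abs_re_le_norm _).trans h1))
    rw [PhiS_eq_exp_logPhi hb hb1, ← Complex.exp_neg, Complex.norm_exp, Complex.norm_exp]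
    exact ⟨Real.exp_le_exp.2 h3.2, Real.exp_le_exp.2 (by rw [Complex.neg_re]; linarith)⟩
  refine ⟨E * (1 + ‖ζ‖ + ‖ζ‖⁻¹), by positivity, fun z hz => ?_⟩
  have m1 : E ≤ E * (1 + ‖ζ‖ + ‖ζ‖⁻¹) := le_mul_of_one_le_right hE0.le (by
    have := inv_pos.2 hζ'; linarith)
  have m2 : ‖ζ‖ ≤ 1 + ‖ζ‖ + ‖ζ‖⁻¹ := by have := inv_pos.2 hζ'; linarith
  have m3 : ‖ζ‖⁻¹ ≤ 1 + ‖ζ‖ + ‖ζ‖⁻¹ := by have := inv_pos.2 hζ'; linarith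
  rcases le_total z.re 0 with hre | hre
  · rw [max_eq_right hre, mul_zero, neg_zero, Real.exp_zero, mul_one]
    exact ⟨(hleft z hz hre).1.trans m1, (hleft z hz hre).2.trans m1⟩
  · rw [max_eq_left hre]
    obtain ⟨h1, h2⟩ := hleft (-z) (by simpa using hz) (by simpa using hre)
    have h3 := hinv z (hz.trans_lt hY)
    have h4 : PhiS b z = ζ * Complex.exp (π * I * z ^ 2) * (PhiS b (-z))⁻¹ := by
      rw [← h3, mul_assoc, mul_inv_cancel₀ (PhiS_ne_zero _ _), mul_one]
    rw [h4, mul_inv, mul_inv, inv_inv, norm_mul, norm_mul, norm_mul, norm_mul, norm_inv ζ,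
      norm_inv (Complex.exp _), norm_exp_pi_I_sq, ← Real.exp_neg, neg_neg]
    constructor
    · calc _ ≤ (1 + ‖ζ‖ + ‖ζ‖⁻¹) * Real.exp (-(2 * π * z.im * z.re)) * E := by gcongr
        _ = _ := by ring
    · calc _ ≤ (1 + ‖ζ‖ + ‖ζ‖⁻¹) * Real.exp (2 * π * z.im * z.re) * E := by gcongr
        _ = _ := by ring

lemma differentiableAt_PhiS (hb : 0 < b) (hb1 : b ≤ 1) {z : ℂ} (hz : |z.im| < (b + b⁻¹) / 2) :
    DifferentiableAt ℂ (PhiS b) z := by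
  have : PhiS b = fun z => Complex.exp (logPhi b z) := funext (PhiS_eq_exp_logPhi hb hb1)
  rw [this]
  exact (differentiableAt_logPhi hb hb1 hz).cexp

lemma tendsto_PhiS_add_atBot (hb : 0 < b) (hb1 : b ≤ 1) {z : ℂ} (hz : |z.im| < (b + b⁻¹) / 2) :
    Tendsto (fun x : ℝ => PhiS b (x + z)) atBot (𝓝 1) := by
  obtain ⟨D, hD⟩ := exists_norm_logPhi_le hb hb1 hz
  have hre : Tendsto (fun x : ℝ => π * b * (x + z).re) atBot atBot := by
    refine Tendsto.const_mul_atBot (by have := Real.pi_pos; positivity) ?_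
    simp only [Complex.add_re, Complex.ofReal_re]
    exact tendsto_atBot_add_const_right _ _ tendsto_id
  have h3 : Tendsto (fun x : ℝ => D * Real.exp (π * b * (x + z).re)) atBot (𝓝 (D * 0)) :=
    (Real.tendsto_exp_atBot.comp hre).const_mul D
  rw [mul_zero] at h3
  have h4 : Tendsto (fun x : ℝ => logPhi b (x + z)) atBot (𝓝 0) :=
    squeeze_zero_norm (fun n => hD _ (by simp)) h3
  have h5 := (Complex.continuous_exp.tendsto 0).comp h4
  rw [Complex.exp_zero] at h5
  exact h5.congr fun n => (PhiS_eq_exp_logPhi hb hb1 _).symm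

lemma continuous_PhiS_ofReal_add (hb : 0 < b) (hb1 : b ≤ 1) {z : ℂ}
    (hz : |z.im| < (b + b⁻¹) / 2) : Continuous fun x : ℝ => PhiS b (x + z) := by
  rw [continuous_iff_continuousAt]
  intro x
  exact ContinuousAt.comp (f := fun x : ℝ => (x : ℂ) + z) (g := PhiS b)
    (differentiableAt_PhiS hb hb1 (by simpa using hz)).continuousAt (by fun_prop)

lemma exists_norm_PhiS_add_le (hb : 0 < b) (hb1 : b ≤ 1) {Y : ℝ} (hY : Y < (b + b⁻¹) / 2)
    (r : ℝ) : ∃ C, 0 < C ∧ ∀ x z : ℂ, |z.re| ≤ r → |(x + z).im| ≤ Y →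
      ‖PhiS b (x + z)‖ ≤ C * Real.exp (-(2 * π * (x + z).im * max x.re 0)) ∧
      ‖(PhiS b (x + z))⁻¹‖ ≤ C * Real.exp (2 * π * (x + z).im * max x.re 0) := by
  obtain ⟨C, hC0, hC⟩ := exists_norm_PhiS_le hb hb1 hY
  have hpi := Real.pi_pos
  refine ⟨C * Real.exp (2 * π * (Y * r)), by positivity, fun x z hr hz => ?_⟩
  obtain ⟨h1, h2⟩ := hC _ hz
  have hm : |max (x + z).re 0 - max x.re 0| ≤ r := by
    refine (abs_max_sub_max_le_abs _ _ _).trans ?_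
    simpa using hr
  have hk : |(x + z).im * (max (x + z).re 0 - max x.re 0)| ≤ Y * r := by
    rw [abs_mul]
    have := (abs_nonneg _).trans hz
    gcongr
  rw [abs_le] at hk
  constructor
  · refine h1.trans ?_
    rw [mul_assoc C, ← Real.exp_add]
    gcongr
    nlinarith
  · refine h2.trans ?_
    rw [mul_assoc C, ← Real.exp_add]
    gcongr
    nlinarith

end Inversion

section Ramanujan

open Complex (I)
open Set Filter Topology

variable {b : ℝ} {u v w : ℂ}

lemma exp_mul_sub_max_le {p d x : ℝ} :
    Real.exp (p * x) * Real.exp (-(d * max x 0)) ≤ Real.exp (-(min p (d - p) * |x|)) := by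
  rw [← Real.exp_add]
  apply Real.exp_le_exp.2
  rcases le_total x 0 with h | h
  · rw [max_eq_right h, abs_of_nonpos h]
    nlinarith [min_le_left p (d - p)]
  · rw [max_eq_left h, abs_of_nonneg h]
    nlinarith [min_le_right p (d - p)]

/-- The ratio of two shifts of the quantum dilogarithm. -/
def phiRatio (b : ℝ) (u v x : ℂ) : ℂ := PhiS b (x + u) * (PhiS b (x + v))⁻¹

/-- The Fourier transform of a ratio of two shifts of the quantum dilogarithm. -/
def ramInt (b : ℝ) (u v w : ℂ) : ℂ :=
  ∫ x : ℝ, Complex.exp (-2 * π * I * w * x) * phiRatio b u v x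

lemma continuous_phiRatio (hb : 0 < b) (hb1 : b ≤ 1) (hu : |u.im| < (b + b⁻¹) / 2)
    (hv : |v.im| < (b + b⁻¹) / 2) : Continuous fun x : ℝ => phiRatio b u v x :=
  (continuous_PhiS_ofReal_add hb hb1 hu).mul
    ((continuous_PhiS_ofReal_add hb hb1 hv).inv₀ fun _ => PhiS_ne_zero _ _)

lemma exists_norm_phiRatio_le (hb : 0 < b) (hb1 : b ≤ 1) {Y : ℝ} (hY : Y < (b + b⁻¹) / 2)
    (u v : ℂ) : ∃ C, 0 < C ∧ ∀ x : ℂ, |(x + u).im| ≤ Y → |(x + v).im| ≤ Y →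
      ‖phiRatio b u v x‖ ≤ C * Real.exp (-(2 * π * (u.im - v.im) * max x.re 0)) := by
  obtain ⟨C1, hC1, h1⟩ := exists_norm_PhiS_add_le hb hb1 hY |u.re|
  obtain ⟨C2, hC2, h2⟩ := exists_norm_PhiS_add_le hb hb1 hY |v.re|
  refine ⟨C1 * C2, by positivity, fun x hx1 hx2 => ?_⟩
  have e1 := (h1 x u le_rfl hx1).1
  have e2 := (h2 x v le_rfl hx2).2
  rw [phiRatio, norm_mul]
  calc _ ≤ _ := mul_le_mul e1 e2 (norm_nonneg _) (by positivity)
    _ = C1 * C2 * (Real.exp (-(2 * π * (x + u).im * max x.re 0)) *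
        Real.exp (2 * π * (x + v).im * max x.re 0)) := by ring
    _ = _ := by
      rw [← Real.exp_add]
      congr 2
      simp
      ring

lemma exists_norm_phiRatio_ofReal_le (hb : 0 < b) (hb1 : b ≤ 1) (hu : |u.im| < (b + b⁻¹) / 2)
    (hv : |v.im| < (b + b⁻¹) / 2) : ∃ C, 0 < C ∧ ∀ x : ℝ,
      ‖phiRatio b u v x‖ ≤ C * Real.exp (-(2 * π * (u.im - v.im) * max x 0)) := by
  obtain ⟨C, hC, h⟩ := exists_norm_phiRatio_le hb hb1 (max_lt hu hv) u v
  exact ⟨C, hC, fun x => by simpa using h x (by simp) (by simp)⟩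

lemma norm_exp_two_pi_I (w x : ℂ) : ‖Complex.exp (-2 * π * I * w * x)‖ =
    Real.exp (2 * π * w.im * x.re) * Real.exp (2 * π * w.re * x.im) := by
  rw [Complex.norm_exp, ← Real.exp_add]
  congr 1
  simp
  ring

lemma integrable_exp_mul_norm_phiRatio (hb : 0 < b) (hb1 : b ≤ 1) (hu : |u.im| < (b + b⁻¹) / 2)
    (hv : |v.im| < (b + b⁻¹) / 2) {p : ℝ} (h0 : 0 < p) (h1 : p < 2 * π * (u.im - v.im)) :
    Integrable fun x : ℝ => Real.exp (p * x) * ‖phiRatio b u v x‖ := by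
  obtain ⟨C, hC, h⟩ := exists_norm_phiRatio_ofReal_le hb hb1 hu hv
  refine ((integrable_exp_neg_mul_abs (lt_min h0 (sub_pos.2 h1))).const_mul C).mono'
    (Continuous.aestronglyMeasurable ?_) (Eventually.of_forall fun x => ?_)
  · have := continuous_phiRatio hb hb1 hu hv
    fun_prop
  · rw [Real.norm_of_nonneg (by positivity)]
    calc _ ≤ Real.exp (p * x) * (C * Real.exp (-(2 * π * (u.im - v.im) * max x 0))) := by
          gcongr; exact h x
      _ = C * (Real.exp (p * x) * Real.exp (-(2 * π * (u.im - v.im) * max x 0))) := by ring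
      _ ≤ _ := by gcongr; exact exp_mul_sub_max_le

lemma re_neg_two_pi_I_mul (w : ℂ) : (-2 * π * I * w).re = 2 * π * w.im := by simp

lemma integrable_ramInt (hb : 0 < b) (hb1 : b ≤ 1) (hu : |u.im| < (b + b⁻¹) / 2)
    (hv : |v.im| < (b + b⁻¹) / 2) (h0 : 0 < w.im) (h1 : w.im < u.im - v.im) :
    Integrable fun x : ℝ => Complex.exp (-2 * π * I * w * x) * phiRatio b u v x := by
  have hpi := Real.pi_pos
  have := integrable_exp_mul_norm_phiRatio hb hb1 hu hv (p := 2 * π * w.im) (by positivity)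
    (by gcongr)
  exact integrable_laplace (continuous_phiRatio hb hb1 hu hv).aestronglyMeasurable this this
    (re_neg_two_pi_I_mul w).ge (re_neg_two_pi_I_mul w).le

lemma differentiableAt_ramInt (hb : 0 < b) (hb1 : b ≤ 1) (hu : |u.im| < (b + b⁻¹) / 2)
    (hv : |v.im| < (b + b⁻¹) / 2) (h0 : 0 < w.im) (h1 : w.im < u.im - v.im) :
    DifferentiableAt ℂ (ramInt b u v) w := by
  have hpi := Real.pi_pos
  obtain ⟨y, hy1, hy2⟩ := exists_between h1
  have ip := integrable_exp_mul_norm_phiRatio hb hb1 hu hv (p := 2 * π * (w.im / 2)) (by positivity)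
    (by gcongr; linarith)
  have iq := integrable_exp_mul_norm_phiRatio hb hb1 hu hv (p := 2 * π * y)
    (by have := h0.trans hy1; positivity) (by gcongr)
  have h := (hasDerivAt_laplace (continuous_phiRatio hb hb1 hu hv).aestronglyMeasurable ip iq
    (s := -2 * π * I * w) (by rw [re_neg_two_pi_I_mul]; gcongr; linarith)
    (by rw [re_neg_two_pi_I_mul]; gcongr)).differentiableAt
  exact h.comp w (f := fun w : ℂ => -2 * π * I * w) (by fun_prop)

lemma exists_norm_ramInt_le (hb : 0 < b) (hb1 : b ≤ 1) (hu : |u.im| < (b + b⁻¹) / 2)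
    (hv : |v.im| < (b + b⁻¹) / 2) {y₁ y₂ : ℝ} (h0 : 0 < y₁) (h12 : y₁ ≤ y₂)
    (h1 : y₂ < u.im - v.im) :
    ∃ C, ∀ w : ℂ, y₁ ≤ w.im → w.im ≤ y₂ → ‖ramInt b u v w‖ ≤ C := by
  have hpi := Real.pi_pos
  have ip := integrable_exp_mul_norm_phiRatio hb hb1 hu hv (p := 2 * π * y₁) (by positivity)
    (by gcongr; linarith)
  have iq := integrable_exp_mul_norm_phiRatio hb hb1 hu hv (p := 2 * π * y₂)
    (by have := h0.trans_le h12; positivity) (by gcongr)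
  refine ⟨_, fun w hw1 hw2 => norm_integral_le_of_norm_le (ip.add iq)
    (Eventually.of_forall fun x => ?_)⟩
  rw [norm_mul, norm_exp_mul_ofReal, re_neg_two_pi_I_mul, Pi.add_apply, ← add_mul]
  gcongr
  exact exp_mul_le_add_exp (by gcongr) (by gcongr)

lemma ramInt_add_mul_I (hb : 0 < b) (hb1 : b ≤ 1) {τ : ℝ} (hτ : 0 ≤ τ)
    (hu : |u.im| < (b + b⁻¹) / 2) (hv : |v.im| < (b + b⁻¹) / 2)
    (hu' : |u.im + τ| < (b + b⁻¹) / 2) (hv' : |v.im + τ| < (b + b⁻¹) / 2)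
    (h0 : 0 < w.im) (h1 : w.im < u.im - v.im) :
    ramInt b (u + τ * I) (v + τ * I) w = Complex.exp (-2 * π * w * τ) * ramInt b u v w := by
  have hpi := Real.pi_pos
  obtain ⟨Y, hY, hYu, hYv, hYu', hYv'⟩ : ∃ Y < (b + b⁻¹) / 2, |u.im| ≤ Y ∧ |v.im| ≤ Y ∧
      |u.im + τ| ≤ Y ∧ |v.im + τ| ≤ Y := by
    refine ⟨max (max |u.im| |v.im|) (max |u.im + τ| |v.im + τ|),
      max_lt (max_lt hu hv) (max_lt hu' hv'), ?_, ?_, ?_, ?_⟩ <;> simp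
  rw [abs_le] at hYu hYv hYu' hYv'
  have hY' : ∀ z : ℂ, 0 ≤ z.im → z.im ≤ τ → |(z + u).im| ≤ Y ∧ |(z + v).im| ≤ Y := by
    intro z h2 h3
    rw [Complex.add_im, Complex.add_im, abs_le, abs_le]
    refine ⟨⟨?_, ?_⟩, ⟨?_, ?_⟩⟩ <;> linarith
  obtain ⟨C, hC, hr⟩ := exists_norm_phiRatio_le hb hb1 hY u v
  have key := integral_line_eq
    (F := fun z : ℂ => Complex.exp (-2 * π * I * w * z) * phiRatio b u v z) (y₁ := 0) (y₂ := τ)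
    (C := C * Real.exp (2 * π * |w.re| * τ))
    (c := min (2 * π * w.im) (2 * π * (u.im - v.im) - 2 * π * w.im)) hτ
    (lt_min (by positivity) (sub_pos.2 (by gcongr))) (fun z h2 h3 => ?_) (fun z h2 h3 => ?_)
  · rw [ramInt, ramInt]
    simp only [Complex.ofReal_zero, zero_mul, add_zero] at key
    rw [key, ← integral_const_mul]
    congr 1
    ext x
    rw [← mul_assoc, ← Complex.exp_add, phiRatio, phiRatio]
    congr 2
    · linear_combination (2 * π * w * τ) * Complex.I_sq
    · congr 1; ring
    · congr 2; ring
  · obtain ⟨h4, h5⟩ := hY' z h2 h3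
    have d1 := differentiableAt_PhiS hb hb1 (h4.trans_lt hY)
    have d2 := differentiableAt_PhiS hb hb1 (h5.trans_lt hY)
    have d3 : DifferentiableAt ℂ (fun z => PhiS b (z + u)) z :=
      d1.comp z (f := fun z => z + u) (by fun_prop)
    have d4 : DifferentiableAt ℂ (fun z => PhiS b (z + v)) z :=
      d2.comp z (f := fun z => z + v) (by fun_prop)
    unfold phiRatio
    exact DifferentiableAt.mul (by fun_prop) (d3.mul (d4.inv (PhiS_ne_zero _ _)))
  · obtain ⟨h4, h5⟩ := hY' z h2 h3
    rw [norm_mul, norm_exp_two_pi_I]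
    have h6 : 2 * π * w.re * z.im ≤ 2 * π * |w.re| * τ := by
      have := le_abs_self w.re
      have := abs_nonneg w.re
      rw [mul_assoc, mul_assoc (2 * π)]
      gcongr
    calc _ ≤ Real.exp (2 * π * w.im * z.re) * Real.exp (2 * π * |w.re| * τ) *
          (C * Real.exp (-(2 * π * (u.im - v.im) * max z.re 0))) := by
          gcongr
          exact hr z h4 h5
      _ = C * Real.exp (2 * π * |w.re| * τ) * (Real.exp (2 * π * w.im * z.re) *
          Real.exp (-(2 * π * (u.im - v.im) * max z.re 0))) := by ring
      _ ≤ _ := by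
          gcongr
          exact exp_mul_sub_max_le

/-- The two contiguity relations. -/
lemma ramInt_contiguity (hb : 0 < b) (hb1 : b ≤ 1) (hu : |u.im| < (b + b⁻¹) / 2)
    (hv : |v.im| < (b + b⁻¹) / 2) (hu' : |u.im + b| < (b + b⁻¹) / 2)
    (h0 : 0 < w.im) (h1 : w.im < u.im - v.im) :
    ramInt b u v w = ramInt b (u + b * I) v w + Complex.exp (2 * π * b * (u + I * b / 2)) *
        ramInt b (u + b * I) v (w + b * I) ∧
    Complex.exp (-2 * π * w * b) * ramInt b u v w = ramInt b (u + b * I) v w +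
      Complex.exp (2 * π * b * (v + I * b / 2)) * ramInt b (u + b * I) v (w + b * I) := by
  have hu2 := abs_lt.1 hu'
  have hv2 := abs_lt.1 hv
  have hu1 := abs_lt.1 hu
  have hv' : |v.im + b| < (b + b⁻¹) / 2 := abs_lt.2 ⟨by linarith, by linarith⟩
  have e1 : (u + b * I).im = u.im + b := by simp
  have e2 : (w + b * I).im = w.im + b := by simp
  have e3 : (v + b * I).im = v.im + b := by simp
  have i1 := integrable_ramInt hb hb1 (u := u + b * I) (v := v) (w := w) (by rwa [e1]) hv h0
    (by rw [e1]; linarith)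
  have i2 := integrable_ramInt hb hb1 (u := u + b * I) (v := v) (w := w + b * I) (by rwa [e1]) hv
    (by rw [e2]; linarith) (by rw [e1, e2]; linarith)
  have hfun : ∀ (y : ℂ) (x : ℝ), |y.im| < (b + b⁻¹) / 2 → |y.im + b| < (b + b⁻¹) / 2 →
      PhiS b (x + y) = (1 + Complex.exp (2 * π * b * (x + y + I * b / 2))) *
        PhiS b (x + (y + b * I)) := by
    intro y x h2 h3
    rw [abs_lt] at h2 h3
    have := PhiS_functional hb hb1 (z := x + y + I * b / 2) (by
      have : |(x + y + I * b / 2).im| < b⁻¹ / 2 := by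
        simp only [Complex.add_im, Complex.ofReal_im, zero_add]
        have : (I * b / 2).im = b / 2 := by simp
        rw [this, abs_lt]
        constructor <;> linarith
      linarith)
    rw [show (x : ℂ) + y + I * b / 2 - I * b / 2 = x + y by ring,
      show (x : ℂ) + y + I * b / 2 + I * b / 2 = x + (y + b * I) by ring] at this
    exact this
  have hexp : ∀ (y : ℂ) (x : ℝ), Complex.exp (-2 * π * I * w * x) *
      Complex.exp (2 * π * b * (x + y + I * b / 2)) =
      Complex.exp (2 * π * b * (y + I * b / 2)) *
        Complex.exp (-2 * π * I * (w + b * I) * x) := by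
    intro y x
    rw [← Complex.exp_add, ← Complex.exp_add]
    congr 1
    linear_combination (2 * π * b * x) * Complex.I_sq
  constructor
  · rw [ramInt, ramInt, ramInt, ← integral_const_mul, ← integral_add i1 (i2.const_mul _)]
    congr 1
    ext x
    rw [phiRatio, phiRatio, hfun u x hu hu']
    linear_combination (PhiS b (x + (u + b * I)) * (PhiS b (x + v))⁻¹) * hexp u x
  · rw [← ramInt_add_mul_I hb hb1 hb.le hu hv hu' hv' h0 h1]
    rw [ramInt, ramInt, ramInt, ← integral_const_mul, ← integral_add i1 (i2.const_mul _)]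
    congr 1
    ext x
    have h2 := hfun v x hv hv'
    have n1 := PhiS_ne_zero b (x + v)
    have n2 := PhiS_ne_zero b (x + (v + b * I))
    have h3 : (PhiS b (x + (v + b * I)))⁻¹ =
        (1 + Complex.exp (2 * π * b * (x + v + I * b / 2))) * (PhiS b (x + v))⁻¹ := by
      rw [eq_mul_inv_iff_mul_eq₀ n1, h2]
      field_simp
    rw [phiRatio, phiRatio, h3]
    linear_combination (PhiS b (x + (u + b * I)) * (PhiS b (x + v))⁻¹) * hexp v x

end Ramanujan

section Periodic

open Complex (I)
open Set Filter Topology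

/-- The open horizontal strip of half-width `β` about the line `Im z = y`. -/
def hStrip (y β : ℝ) : Set ℂ := {z | |z.im - y| < β}

lemma hStrip_eq (y β : ℝ) : hStrip y β = {z : ℂ | y - β < z.im} ∩ {z : ℂ | z.im < y + β} := by
  ext z
  simp only [hStrip, mem_ofPred_eq, mem_inter_iff, abs_lt]
  constructor <;> rintro ⟨h1, h2⟩ <;> constructor <;> linarith

lemma isOpen_hStrip (y β : ℝ) : IsOpen (hStrip y β) := by
  rw [hStrip_eq]
  exact (isOpen_lt continuous_const Complex.continuous_im).inter
    (isOpen_lt Complex.continuous_im continuous_const)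

lemma isPreconnected_hStrip (y β : ℝ) : IsPreconnected (hStrip y β) := by
  rw [hStrip_eq]
  exact ((convex_halfSpace_im_gt _).inter (convex_halfSpace_im_lt _)).isPreconnected

/-- A holomorphic function on a strip whose norm is periodic in the imaginary direction and which
decays in the real direction vanishes. -/
lemma eq_zero_of_norm_periodic {k : ℂ → ℂ} {y b β C c : ℝ} (h1 : b / 2 < β)
    (h2 : β ≤ b) (hc : 0 < c) (hd : DifferentiableOn ℂ k (hStrip y β))
    (hper : ∀ z ∈ hStrip y β, z + b * I ∈ hStrip y β → ‖k (z + b * I)‖ = ‖k z‖)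
    (hdec : ∀ z : ℂ, |z.im - y| ≤ b / 2 → ‖k z‖ ≤ C * Real.exp (-(c * |z.re|))) :
    ∀ z ∈ hStrip y β, k z = 0 := by
  have hred : ∀ z ∈ hStrip y β, ∃ p : ℂ, |p.im - y| ≤ b / 2 ∧ ‖k p‖ = ‖k z‖ := by
    intro z hz
    have hz' := abs_lt.1 (show |z.im - y| < β from hz)
    rcases lt_or_ge (z.im - y) (-(b / 2)) with h | h
    · have him : (z + b * I).im = z.im + b := by simp
      refine ⟨z + b * I, ?_, hper z hz ?_⟩
      · rw [him, abs_le]; constructor <;> linarith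
      · rw [hStrip, mem_ofPred_eq, him, abs_lt]; constructor <;> linarith
    rcases lt_or_ge (b / 2) (z.im - y) with h' | h'
    · have him : (z - b * I).im = z.im - b := by simp
      refine ⟨z - b * I, ?_, ?_⟩
      · rw [him, abs_le]; constructor <;> linarith
      · have := hper (z - b * I) ?_ (by simpa using hz)
        · rw [← this]; simp
        · rw [hStrip, mem_ofPred_eq, him, abs_lt]; constructor <;> linarith
    · exact ⟨z, abs_le.2 ⟨h, h'⟩, rfl⟩
  by_contra! hcon
  obtain ⟨z, hz, hkz⟩ := hcon
  obtain ⟨p, hp, hpz⟩ := hred z hz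
  have hkp : 0 < ‖k p‖ := by rw [hpz]; exact norm_pos_iff.2 hkz
  have hlim : ∀ ε > 0, ∃ R, ∀ x : ℝ, R ≤ |x| → C * Real.exp (-(c * |x|)) < ε := by
    intro ε hε
    have h3 : Tendsto (fun r : ℝ => C * Real.exp (-(c * r))) atTop (𝓝 (C * 0)) :=
      (Real.tendsto_exp_neg_atTop_nhds_zero.comp (tendsto_id.const_mul_atTop hc)).const_mul C
    rw [mul_zero] at h3
    obtain ⟨R, hR⟩ := eventually_atTop.1 (h3.eventually (gt_mem_nhds hε))
    exact ⟨R, fun x hx => hR _ hx⟩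
  obtain ⟨R, hR⟩ := hlim _ hkp
  set K : Set ℂ := Icc (-max R |p.re|) (max R |p.re|) ×ℂ Icc (y - b / 2) (y + b / 2) with hK
  have hKc : IsCompact K := isCompact_Icc.reProdIm isCompact_Icc
  have hKs : K ⊆ hStrip y β := by
    rintro q ⟨-, h3, h4⟩
    rw [hStrip, mem_ofPred_eq, abs_lt]; constructor <;> linarith
  have hpK : p ∈ K := by
    rw [abs_le] at hp
    exact ⟨abs_le.1 (le_max_right _ _), by linarith, by linarith⟩
  obtain ⟨q, hqK, hq⟩ := hKc.exists_isMaxOn ⟨p, hpK⟩ (hd.continuousOn.mono hKs).norm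
  have hkq : ‖k p‖ ≤ ‖k q‖ := hq hpK
  have hqmax : ∀ x : ℂ, |x.im - y| ≤ b / 2 → ‖k x‖ ≤ ‖k q‖ := by
    intro x hx
    rcases le_or_gt |x.re| (max R |p.re|) with h | h
    · rw [abs_le] at hx
      exact hq (show x ∈ K from ⟨abs_le.1 h, by linarith, by linarith⟩)
    · exact ((hdec x hx).trans_lt (hR _ ((le_max_left _ _).trans h.le))).le.trans hkq
  have hmax : IsMaxOn (norm ∘ k) (hStrip y β) q := by
    intro x hx
    obtain ⟨x', hx', e⟩ := hred x hx
    show ‖k x‖ ≤ ‖k q‖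
    rw [← e]
    exact hqmax x' hx'
  have hconst := Complex.norm_eqOn_of_isPreconnected_of_isMaxOn (isPreconnected_hStrip y β)
    (isOpen_hStrip y β) hd (hKs hqK) hmax
  obtain ⟨R', hR'⟩ := hlim _ (hkp.trans_le hkq)
  have hqim : |q.im - y| ≤ b / 2 := by
    obtain ⟨-, h3, h4⟩ := hqK
    rw [abs_le]; constructor <;> linarith
  set q' : ℂ := (|R'| : ℝ) + q.im * I with hq'
  have e1 : q'.im = q.im := by simp [hq']
  have e2 : q'.re = |R'| := by simp [hq']
  have h5 : ‖k q'‖ = ‖k q‖ := hconst (show q' ∈ hStrip y β by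
    rw [hStrip, mem_ofPred_eq, e1]; linarith)
  have h6 := (hdec q' (by rwa [e1])).trans_lt (hR' _ (by rw [e2, abs_abs]; exact le_abs_self _))
  rw [h5] at h6
  exact lt_irrefl _ h6

lemma sinhSlope_ne_zero_of_lt_pi {r : ℝ} (hr : 0 < r) {w : ℂ} (h : r * |w.im| < π) :
    sinhSlope r w ≠ 0 := by
  rcases eq_or_ne w 0 with rfl | hw
  · exact sinhSlope_ne_zero hr (by simp; positivity)
  · rw [sinhSlope_of_ne hw]
    refine div_ne_zero (fun h0 => ?_) hw
    have h1 := norm_sinh_sq (r * w)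
    rw [h0, norm_zero, Complex.re_ofReal_mul, Complex.im_ofReal_mul] at h1
    have h2 : Real.sinh (r * w.re) = 0 := by
      nlinarith [sq_nonneg (Real.sinh (r * w.re)), sq_nonneg (Real.sin (r * w.im))]
    have h3 : Real.sin (r * w.im) = 0 := by
      nlinarith [sq_nonneg (Real.sinh (r * w.re)), sq_nonneg (Real.sin (r * w.im))]
    rw [Real.sinh_eq_zero] at h2
    have h5 : |r * w.im| < π := by rwa [abs_mul, abs_of_pos hr]
    rw [abs_lt] at h5
    have h4 := (Real.sin_eq_zero_iff_of_lt_of_lt h5.1 h5.2).1 h3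
    apply hw
    apply Complex.ext
    · simpa [hr.ne'] using h2
    · simpa [hr.ne'] using h4

/-- A periodic holomorphic function of moderate growth on a strip is constant. -/
lemma eq_const_of_periodic {h : ℂ → ℂ} {y b β C m : ℝ} (hb : 0 < b) (h1 : b / 2 < β)
    (h2 : β ≤ b) (hm0 : 0 ≤ m) (hm : m < π / b) (hd : DifferentiableOn ℂ h (hStrip y β))
    (hper : ∀ z ∈ hStrip y β, z + b * I ∈ hStrip y β → h (z + b * I) = h z)
    (hgr : ∀ z : ℂ, |z.im - y| ≤ b / 2 → ‖h z‖ ≤ C * Real.exp (m * |z.re|)) :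
    ∀ z ∈ hStrip y β, h z = h (y * I) := by
  have hpi := Real.pi_pos
  set z₀ : ℂ := y * I with hz₀
  have i0 : z₀.im = y := by simp [hz₀]
  have r0 : z₀.re = 0 := by simp [hz₀]
  have hz₀m : z₀ ∈ hStrip y β := by rw [hStrip, mem_ofPred_eq, i0]; simp; linarith
  have hpb : 0 < π / b := by positivity
  set k : ℂ → ℂ := fun z => dslope h z₀ z / sinhSlope (π / b) (z - z₀) with hk
  have hS : ∀ z ∈ hStrip y β, sinhSlope (π / b) (z - z₀) ≠ 0 := by
    intro z hz
    apply sinhSlope_ne_zero_of_lt_pi hpb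
    rw [Complex.sub_im, i0]
    calc π / b * |z.im - y| < π / b * β := by gcongr; exact hz
      _ ≤ π / b * b := by gcongr
      _ = π := by field_simp
  have hkd : DifferentiableOn ℂ k (hStrip y β) := by
    refine DifferentiableOn.div
      ((Complex.differentiableOn_dslope ((isOpen_hStrip y β).mem_nhds hz₀m)).2 hd) ?_ hS
    exact ((differentiable_sinhSlope (π / b)).comp (by fun_prop :
      Differentiable ℂ fun z : ℂ => z - z₀)).differentiableOn
  have hkne : ∀ z, z ≠ z₀ → k z = (h z - h z₀) / Complex.sinh ((π / b : ℝ) * (z - z₀)) := by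
    intro z hz
    simp only [hk]
    rw [sinhSlope_of_ne (sub_ne_zero.2 hz), dslope_of_ne _ hz, slope_def_field,
      div_div_div_cancel_right₀ (sub_ne_zero.2 hz)]
  have hbc : (b : ℂ) ≠ 0 := by exact_mod_cast hb.ne'
  have hkper : ∀ z ∈ hStrip y β, z + b * I ∈ hStrip y β → ‖k (z + b * I)‖ = ‖k z‖ := by
    intro z hz hz'
    have n1 : z ≠ z₀ := by
      rintro rfl
      have := abs_lt.1 (show |(z₀ + b * I).im - y| < β from hz')
      rw [Complex.add_im, i0] at this
      simp at this
      linarith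
    have n2 : z + b * I ≠ z₀ := by
      intro e
      have e' : z = z₀ - b * I := by rw [← e]; ring
      have := abs_lt.1 (show |z.im - y| < β from hz)
      rw [e', Complex.sub_im, i0] at this
      simp at this
      linarith
    have e : ((π / b : ℝ) : ℂ) * (z + b * I - z₀) = (π / b : ℝ) * (z - z₀) + π * I := by
      push_cast; field_simp; ring
    rw [hkne _ n1, hkne _ n2, hper z hz hz', e, Complex.sinh_add, Complex.cosh_mul_I,
      Complex.sinh_mul_I, Complex.cos_pi, Complex.sin_pi, norm_div, norm_div]
    simp
  obtain ⟨κ, hκ, hsinh⟩ := exists_le_norm_sinh hpb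
  have hC : 0 ≤ C := by
    have := (norm_nonneg _).trans (hgr z₀ (by rw [i0]; simp; linarith))
    exact nonneg_of_mul_nonneg_left this (Real.exp_pos _)
  have hmem : ∀ z : ℂ, y - b / 2 ≤ z.im → z.im ≤ y + b / 2 → z ∈ hStrip y β := by
    intro z h3 h4
    rw [hStrip, mem_ofPred_eq, abs_lt]; constructor <;> linarith
  obtain ⟨D, hD⟩ := exists_norm_le_exp_of_one_le (F := k) (y₁ := y - b / 2) (y₂ := y + b / 2)
    (C := (C + C) / κ) (c := π / b - m)
    (fun z h3 h4 => (hkd.differentiableAt ((isOpen_hStrip y β).mem_nhds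
      (hmem z h3 h4))).continuousAt) (by
      intro z h3 h4 h5
      have hz : z ≠ z₀ := by rintro rfl; rw [r0] at h5; simp at h5; linarith
      have hre : (((π / b : ℝ) : ℂ) * (z - z₀)).re = π / b * z.re := by
        rw [Complex.re_ofReal_mul, Complex.sub_re, r0, sub_zero]
      have hs := hsinh ((π / b : ℝ) * (z - z₀)) (by
        rw [hre, abs_mul, abs_of_pos hpb]
        exact le_mul_of_one_le_right hpb.le h5)
      rw [hre, abs_mul, abs_of_pos hpb] at hs
      have g1 := hgr z (abs_le.2 ⟨by linarith, by linarith⟩)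
      have g2 := hgr z₀ (by rw [i0]; simp; linarith)
      rw [r0, abs_zero, mul_zero, Real.exp_zero] at g2
      have g3 : (1 : ℝ) ≤ Real.exp (m * |z.re|) := Real.one_le_exp (by positivity)
      have g4 : ‖h z - h z₀‖ ≤ (C + C) * Real.exp (m * |z.re|) := by
        refine (norm_sub_le _ _).trans ?_
        rw [add_mul]
        exact add_le_add g1 (g2.trans (by gcongr))
      rw [hkne z hz, norm_div]
      calc _ ≤ ((C + C) * Real.exp (m * |z.re|)) / (κ * Real.exp (π / b * |z.re|)) := by gcongr
        _ = _ := by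
          rw [mul_div_mul_comm, ← Real.exp_sub]
          congr 2
          ring)
  have hk0 := eq_zero_of_norm_periodic h1 h2 (sub_pos.2 hm) hkd hkper (C := D) (fun z hz => by
    rw [abs_le] at hz
    exact hD z (by linarith) (by linarith))
  intro z hz
  rcases eq_or_ne z z₀ with rfl | hne
  · rfl
  have h3 := hk0 z hz
  simp only [hk] at h3
  have h4 := (div_eq_zero_iff.1 h3).resolve_right (hS z hz)
  rw [dslope_of_ne _ hne, slope_def_field] at h4
  exact sub_eq_zero.1 ((div_eq_zero_iff.1 h4).resolve_right (sub_ne_zero.2 hne))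

lemma eqOn_const_of_eqOn_hStrip {h : ℂ → ℂ} {y β β' : ℝ} (hβ : 0 < β) (hβ' : β ≤ β')
    (hd : DifferentiableOn ℂ h (hStrip y β')) {κ : ℂ} (hc : ∀ z ∈ hStrip y β, h z = κ) :
    ∀ z ∈ hStrip y β', h z = κ := by
  have hz₀ : ∀ r > 0, (y * I : ℂ) ∈ hStrip y r := fun r hr => by simpa [hStrip] using hr
  have ha : AnalyticOnNhd ℂ h (hStrip y β') := hd.analyticOnNhd (isOpen_hStrip y β')
  exact ha.eqOn_of_preconnected_of_eventuallyEq (g := fun _ => κ) analyticOnNhd_const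
    (isPreconnected_hStrip y β') (hz₀ β' (hβ.trans_le hβ'))
    (Filter.eventuallyEq_of_mem ((isOpen_hStrip y β).mem_nhds (hz₀ β hβ)) hc)

end Periodic

section Ramanujan

open Complex (I)
open Set Filter Topology

variable {b : ℝ} {u v w : ℂ}

/-- The product of quantum dilogarithms giving `ramInt b u v w` up to a factor independent
of `w`. -/
def ramProd (b : ℝ) (u v w : ℂ) : ℂ :=
  Complex.exp (2 * π * I * w * (v + cB b)) *
    (PhiS b (cB b - w) * (PhiS b (u - v - cB b - w))⁻¹)

lemma cB_im (b : ℝ) : (cB b).im = (b + b⁻¹) / 2 := by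
  rw [cB, show I * (b + (b⁻¹ : ℝ)) / 2 = (((b + b⁻¹) / 2 : ℝ) : ℂ) * I by push_cast; ring]
  simp

lemma cB_re (b : ℝ) : (cB b).re = 0 := by
  rw [cB, show I * (b + (b⁻¹ : ℝ)) / 2 = (((b + b⁻¹) / 2 : ℝ) : ℂ) * I by push_cast; ring]
  simp

lemma exp_two_pi_mul_cB (hb : 0 < b) (z : ℂ) :
    Complex.exp (2 * π * b * (cB b + z)) = -Complex.exp (π * I * b ^ 2 + 2 * π * b * z) := by
  have hb0 : (b : ℂ) ≠ 0 := by exact_mod_cast hb.ne'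
  have : 2 * π * b * (cB b + z) = (π * I * b ^ 2 + 2 * π * b * z) + π * I := by
    rw [cB]; push_cast; field_simp; ring
  rw [this, Complex.exp_add, Complex.exp_pi_mul_I]; ring

lemma exp_neg_two_pi_mul_cB (hb : 0 < b) (z : ℂ) :
    Complex.exp (2 * π * b * (z - cB b)) = -Complex.exp (2 * π * b * z - π * I * b ^ 2) := by
  have hb0 : (b : ℂ) ≠ 0 := by exact_mod_cast hb.ne'
  have : 2 * π * b * (z - cB b) = (2 * π * b * z - π * I * b ^ 2) - π * I := by
    rw [cB]; push_cast; field_simp; ring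
  rw [this, Complex.exp_sub, Complex.exp_pi_mul_I]; ring

/-- The first-order difference equation of the integral. -/
lemma ramInt_shift (hb : 0 < b) (hb1 : b ≤ 1) (hu : |u.im| < (b + b⁻¹) / 2)
    (hv : |v.im| < (b + b⁻¹) / 2) (hu' : |u.im + b| < (b + b⁻¹) / 2)
    (h0 : 0 < w.im) (h1 : w.im < u.im - v.im) :
    ramInt b (u + b * I) v w * (1 - Complex.exp (-2 * π * b * w)) =
      Complex.exp (π * I * b ^ 2) * (Complex.exp (2 * π * b * u) * Complex.exp (-2 * π * b * w) -
        Complex.exp (2 * π * b * v)) * ramInt b (u + b * I) v (w + b * I) := by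
  obtain ⟨h2, h3⟩ := ramInt_contiguity hb hb1 hu hv hu' h0 h1
  rw [show -2 * π * w * b = -2 * π * b * w by ring, h2] at h3
  have e : ∀ z : ℂ, Complex.exp (2 * π * b * (z + I * b / 2)) =
      Complex.exp (π * I * b ^ 2) * Complex.exp (2 * π * b * z) := fun z => by
    rw [← Complex.exp_add]; ring_nf
  rw [e, e] at h3
  linear_combination -h3

/-- The functional equation for the first dilogarithm of `ramProd`. -/
lemma PhiS_cB_sub (hb : 0 < b) (hb1 : b ≤ 1) (h0 : 0 < w.im) (h1 : w.im < b⁻¹) :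
    1 - Complex.exp (-2 * π * b * w) ≠ 0 ∧
    PhiS b (cB b - (w + b * I)) = (1 - Complex.exp (-2 * π * b * w)) * PhiS b (cB b - w) := by
  have him : 2 * |(cB b - w - I * b / 2).im| < b⁻¹ := by
    have : (cB b - w - I * b / 2).im = b⁻¹ / 2 - w.im := by
      simp [cB_im]; ring
    rw [this]
    have : |b⁻¹ / 2 - w.im| < b⁻¹ / 2 := by rw [abs_lt]; constructor <;> linarith
    linarith
  have e : 1 + Complex.exp (2 * π * b * (cB b - w - I * b / 2)) =
      1 - Complex.exp (-2 * π * b * w) := by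
    rw [show cB b - w - I * b / 2 = cB b + (- w - I * b / 2) by ring, exp_two_pi_mul_cB hb]
    ring_nf
  refine ⟨e ▸ one_add_exp_ne_zero hb him, ?_⟩
  have := PhiS_functional hb hb1 him
  rw [e] at this
  convert this using 2 <;> ring_nf

/-- The functional equation for the second dilogarithm of `ramProd`. -/
lemma PhiS_sub_cB_sub (hb : 0 < b) (hb1 : b ≤ 1) (h0 : 0 < u.im - v.im - w.im)
    (h1 : u.im - v.im - w.im < b⁻¹) :
    Complex.exp (2 * π * b * v) - Complex.exp (2 * π * b * u) * Complex.exp (-2 * π * b * w) ≠ 0 ∧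
    Complex.exp (2 * π * b * v) * PhiS b (u - v - cB b - w) =
      (Complex.exp (2 * π * b * v) - Complex.exp (2 * π * b * u) * Complex.exp (-2 * π * b * w)) *
        PhiS b (u + b * I - v - cB b - w) := by
  have him : 2 * |(u - v - w + I * b / 2 - cB b).im| < b⁻¹ := by
    have : (u - v - w + I * b / 2 - cB b).im = u.im - v.im - w.im - b⁻¹ / 2 := by
      simp [cB_im]; ring
    rw [this]
    have : |u.im - v.im - w.im - b⁻¹ / 2| < b⁻¹ / 2 := by rw [abs_lt]; constructor <;> linarith
    linarith
  have e : Complex.exp (2 * π * b * v) *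
      (1 + Complex.exp (2 * π * b * (u - v - w + I * b / 2 - cB b))) =
      Complex.exp (2 * π * b * v) -
        Complex.exp (2 * π * b * u) * Complex.exp (-2 * π * b * w) := by
    rw [exp_neg_two_pi_mul_cB hb, mul_add, mul_one, mul_neg, ← Complex.exp_add, ← Complex.exp_add,
      ← sub_eq_add_neg]
    ring_nf
  refine ⟨e ▸ mul_ne_zero (Complex.exp_ne_zero _) (one_add_exp_ne_zero hb him), ?_⟩
  have := PhiS_functional hb hb1 him
  rw [show u - v - w + I * b / 2 - cB b - I * b / 2 = u - v - cB b - w by ring,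
    show u - v - w + I * b / 2 - cB b + I * b / 2 = u + b * I - v - cB b - w by ring] at this
  rw [← e, this, ← mul_assoc]

/-- `ramProd` satisfies the same difference equation as `ramInt`. -/
lemma ramProd_shift (hb : 0 < b) (hb1 : b ≤ 1) (h0 : 0 < w.im) (h1 : w.im < u.im - v.im)
    (h2 : u.im - v.im < b⁻¹) :
    ramProd b (u + b * I) v w * (1 - Complex.exp (-2 * π * b * w)) =
      Complex.exp (π * I * b ^ 2) * (Complex.exp (2 * π * b * u) * Complex.exp (-2 * π * b * w) -
        Complex.exp (2 * π * b * v)) * ramProd b (u + b * I) v (w + b * I) := by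
  obtain ⟨-, e1⟩ := PhiS_cB_sub hb hb1 h0 (h1.trans h2)
  obtain ⟨n2, e2⟩ := PhiS_sub_cB_sub (u := u) (v := v) (w := w) hb hb1 (by linarith) (by linarith)
  have hV := Complex.exp_ne_zero (2 * π * b * v)
  have e3 : u + b * I - v - cB b - (w + b * I) = u - v - cB b - w := by ring
  have e4 : Complex.exp (2 * π * I * (w + b * I) * (v + cB b)) *
      (Complex.exp (π * I * b ^ 2) * Complex.exp (2 * π * b * v)) =
      - Complex.exp (2 * π * I * w * (v + cB b)) := by
    have := exp_neg_two_pi_mul_cB hb (-v)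
    rw [← Complex.exp_add, ← Complex.exp_add]
    have e5 : 2 * π * I * (w + b * I) * (v + cB b) + (π * I * b ^ 2 + 2 * π * b * v) =
        (2 * π * I * w * (v + cB b) + (π * I * b ^ 2 + 2 * π * b * v)) +
          2 * π * b * (-v - cB b) := by
      linear_combination (2 * π * b * (v + cB b)) * Complex.I_sq
    rw [e5, Complex.exp_add, this, mul_neg, ← Complex.exp_add]
    congr 2
    ring
  have hP := PhiS_ne_zero b (u - v - cB b - w)
  have hP' := PhiS_ne_zero b (u + b * I - v - cB b - w)
  rw [ramProd, ramProd, e1, e3]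
  have e6 : (PhiS b (u - v - cB b - w))⁻¹ *
      (Complex.exp (2 * π * b * v) - Complex.exp (2 * π * b * u) * Complex.exp (-2 * π * b * w)) =
      Complex.exp (2 * π * b * v) * (PhiS b (u + b * I - v - cB b - w))⁻¹ := by
    rw [inv_mul_eq_div, div_eq_iff hP, eq_comm, mul_right_comm, e2, mul_assoc, mul_inv_cancel₀ hP',
      mul_one]
  linear_combination (Complex.exp (π * I * b ^ 2) *
    (Complex.exp (2 * π * I * (w + b * I) * (v + cB b)) *
      (1 - Complex.exp (-2 * π * b * w)) * PhiS b (cB b - w))) * e6 +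
    (1 - Complex.exp (-2 * π * b * w)) * PhiS b (cB b - w) *
      (PhiS b (u + b * I - v - cB b - w))⁻¹ * e4

lemma ramProd_ne_zero (b : ℝ) (u v w : ℂ) : ramProd b u v w ≠ 0 :=
  mul_ne_zero (Complex.exp_ne_zero _)
    (mul_ne_zero (PhiS_ne_zero _ _) (inv_ne_zero (PhiS_ne_zero _ _)))

lemma differentiableAt_ramProd (hb : 0 < b) (hb1 : b ≤ 1) (h0 : 0 < w.im)
    (h1 : w.im < u.im - v.im) (h2 : u.im - v.im < b + b⁻¹) :
    DifferentiableAt ℂ (ramProd b u v) w := by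
  have d1 : DifferentiableAt ℂ (fun w => PhiS b (cB b - w)) w := by
    refine DifferentiableAt.comp w (g := PhiS b) (differentiableAt_PhiS hb hb1 ?_)
      (by fun_prop)
    rw [Complex.sub_im, cB_im, abs_lt]; constructor <;> linarith
  have d2 : DifferentiableAt ℂ (fun w => PhiS b (u - v - cB b - w)) w := by
    refine DifferentiableAt.comp w (g := PhiS b) (differentiableAt_PhiS hb hb1 ?_)
      (by fun_prop)
    simp only [Complex.sub_im, cB_im]
    rw [abs_lt]; constructor <;> linarith
  exact DifferentiableAt.mul (by fun_prop) (d1.mul (d2.inv (PhiS_ne_zero _ _)))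

lemma ramInt_div_ramProd_add (hb : 0 < b) (hb1 : b ≤ 1) (hu : |u.im| < (b + b⁻¹) / 2)
    (hv : |v.im| < (b + b⁻¹) / 2) (hu' : |u.im - b| < (b + b⁻¹) / 2)
    (h0 : 0 < w.im) (h1 : w.im + b < u.im - v.im) :
    ramInt b u v (w + b * I) / ramProd b u v (w + b * I) = ramInt b u v w / ramProd b u v w := by
  have hui : (u - b * I).im = u.im - b := by simp
  have e : u - b * I + b * I = u := by ring
  have h2 : (u - b * I).im - v.im < b⁻¹ := by
    rw [hui]; linarith [(abs_lt.1 hu).2, (abs_lt.1 hv).1]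
  have r1 := ramInt_shift (u := u - b * I) (v := v) (w := w) hb hb1 (by rwa [hui]) hv
    (by rw [hui, sub_add_cancel]; exact hu) h0 (by rw [hui]; linarith)
  have r2 := ramProd_shift (u := u - b * I) (v := v) (w := w) hb hb1 h0
    (by rw [hui]; linarith) h2
  have n1 := (PhiS_cB_sub (w := w) hb hb1 h0 (by rw [hui] at h2; linarith)).1
  rw [e] at r1 r2
  rw [div_eq_div_iff (ramProd_ne_zero _ _ _ _) (ramProd_ne_zero _ _ _ _)]
  apply mul_left_cancel₀ n1
  linear_combination r2 * ramInt b u v (w + b * I) - r1 * ramProd b u v (w + b * I)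

end Ramanujan

section RamanujanConst

open Complex (I)
open Set Filter Topology

variable {b : ℝ} {u v w : ℂ}

lemma inv_ramProd (b : ℝ) (u v w : ℂ) : (ramProd b u v w)⁻¹ =
    Complex.exp (-2 * π * I * w * (v + cB b)) * phiRatio b (u - v - cB b) (cB b) (-w) := by
  rw [ramProd, phiRatio, mul_inv, mul_inv, inv_inv, ← Complex.exp_neg,
    show -w + (u - v - cB b) = u - v - cB b - w by ring, show -w + cB b = cB b - w by ring,
    mul_comm (PhiS b (cB b - w))⁻¹]
  congr 2
  ring

lemma exists_ramInt_eq_of_symm (hb : 0 < b) (hb1 : b ≤ 1) {d : ℝ} (hd : b < d)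
    (hd' : d < b + b⁻¹) (hu : u.im = d / 2) (hv : v.im = -(d / 2)) :
    ∃ κ : ℂ, ∀ w : ℂ, 0 < w.im → w.im < d → ramInt b u v w = κ * ramProd b u v w := by
  have hpi := Real.pi_pos
  have hd0 : 0 < d := hb.trans hd
  have hbi : 0 < b⁻¹ := inv_pos.2 hb
  have au : |u.im| < (b + b⁻¹) / 2 := by rw [hu, abs_lt]; constructor <;> linarith
  have av : |v.im| < (b + b⁻¹) / 2 := by rw [hv, abs_lt]; constructor <;> linarith
  have au' : |u.im - b| < (b + b⁻¹) / 2 := by rw [hu, abs_lt]; constructor <;> linarith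
  have huv : u.im - v.im = d := by rw [hu, hv]; ring
  obtain ⟨C1, h1⟩ := exists_norm_ramInt_le hb hb1 au av (y₁ := (d - b) / 2) (y₂ := (d + b) / 2)
    (by linarith) (by linarith) (by rw [huv]; linarith)
  obtain ⟨C2, hC2, h2⟩ := exists_norm_phiRatio_le hb hb1 (Y := (b + b⁻¹) / 2 - (d - b) / 2)
    (by linarith) (u - v - cB b) (cB b)
  have hstrip : ∀ {z : ℂ}, z ∈ hStrip (d / 2) (d / 2) → 0 < z.im ∧ z.im < d := fun {z} hz => by
    have := abs_lt.1 (show |z.im - d / 2| < d / 2 from hz)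
    constructor <;> linarith [this.1, this.2]
  have hdiff : DifferentiableOn ℂ (fun w => ramInt b u v w / ramProd b u v w)
      (hStrip (d / 2) (d / 2)) := fun z hz => by
    obtain ⟨i0, i1⟩ := hstrip hz
    exact ((differentiableAt_ramInt hb hb1 au av i0 (by rwa [huv])).div
      (differentiableAt_ramProd hb hb1 i0 (by rwa [huv]) (by rwa [huv]))
      (ramProd_ne_zero _ _ _ _)).differentiableWithinAt
  have hsub : hStrip (d / 2) (min (d / 2) b) ⊆ hStrip (d / 2) (d / 2) := fun z hz =>
    lt_of_lt_of_le (show |z.im - d / 2| < min (d / 2) b from hz) (min_le_left _ _)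
  have hconst := eq_const_of_periodic (h := fun w => ramInt b u v w / ramProd b u v w) (y := d / 2)
    (b := b) (β := min (d / 2) b) (m := π * (b + b⁻¹ - d))
    (C := C1 * (C2 * Real.exp (π * (d + b) * |v.re|))) hb
    (lt_min (by linarith) (by linarith)) (min_le_right _ _) (by nlinarith)
    (by rw [div_eq_mul_inv]; gcongr; linarith) (hdiff.mono hsub) ?_ ?_
  · refine ⟨_, fun w hw0 hw1 => (div_eq_iff (ramProd_ne_zero b u v w)).1 <|
      eqOn_const_of_eqOn_hStrip (lt_min (by linarith) hb) (min_le_left _ _) hdiff hconst w ?_⟩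
    change |w.im - d / 2| < d / 2
    rw [abs_lt]; constructor <;> linarith
  · intro z hz hz'
    have i0 := (hstrip (hsub hz)).1
    have i1 := (hstrip (hsub hz')).2
    rw [Complex.add_im, Complex.im_ofReal_mul, Complex.I_im, mul_one] at i1
    exact ramInt_div_ramProd_add hb hb1 au av au' i0 (by rwa [huv])
  · intro z hz
    rw [abs_le] at hz
    have i1 : (u - v - cB b).im = d - (b + b⁻¹) / 2 := by
      rw [Complex.sub_im, Complex.sub_im, huv, cB_im]
    have k1 := h1 z (by linarith [hz.1]) (by linarith [hz.2])
    have k2 := h2 (-z) (by rw [Complex.add_im, Complex.neg_im, i1, abs_le]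
                           constructor <;> linarith [hz.1, hz.2])
      (by rw [Complex.add_im, Complex.neg_im, cB_im, abs_le]
          constructor <;> linarith [hz.1, hz.2])
    rw [i1, cB_im, Complex.neg_re] at k2
    have k3 : ‖Complex.exp (-2 * π * I * z * (v + cB b))‖ ≤
        Real.exp (π * (b + b⁻¹ - d) * z.re) * Real.exp (π * (d + b) * |v.re|) := by
      rw [norm_exp_two_pi_I, Complex.add_re, cB_re, add_zero, Complex.add_im, cB_im, hv, mul_comm]
      have : z.im * v.re ≤ (d + b) / 2 * |v.re| := by
        have hz0 : 0 ≤ z.im := by linarith [hz.1]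
        calc z.im * v.re ≤ z.im * |v.re| := by gcongr; exact le_abs_self _
          _ ≤ _ := by gcongr; linarith [hz.2]
      gcongr ?_ * ?_
      · exact Real.exp_le_exp.2 (by nlinarith)
      · exact Real.exp_le_exp.2 (by nlinarith)
    rw [div_eq_mul_inv, inv_ramProd, norm_mul, norm_mul]
    have k4 : Real.exp (π * (b + b⁻¹ - d) * z.re) *
        Real.exp (-(2 * π * (d - (b + b⁻¹) / 2 - (b + b⁻¹) / 2) * max (-z.re) 0)) =
        Real.exp (π * (b + b⁻¹ - d) * |z.re|) := by
      rw [← Real.exp_add]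
      congr 1
      rcases le_total z.re 0 with h | h
      · rw [max_eq_left (by linarith), abs_of_nonpos h]; ring
      · rw [max_eq_right (by linarith), abs_of_nonneg h]; ring
    have hC1 : 0 ≤ C1 := (norm_nonneg _).trans k1
    calc _ ≤ C1 * ((Real.exp (π * (b + b⁻¹ - d) * z.re) * Real.exp (π * (d + b) * |v.re|)) *
        (C2 * Real.exp (-(2 * π * (d - (b + b⁻¹) / 2 - (b + b⁻¹) / 2) * max (-z.re) 0)))) := by
          gcongr
      _ = _ := by rw [← k4]; ring

lemma ramProd_add_mul_I (b τ : ℝ) (u v w : ℂ) :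
    ramProd b (u + τ * I) (v + τ * I) w = Complex.exp (-2 * π * w * τ) * ramProd b u v w := by
  rw [ramProd, ramProd, show u + τ * I - (v + τ * I) - cB b - w = u - v - cB b - w by ring,
    ← mul_assoc (Complex.exp (-2 * π * w * τ)), ← Complex.exp_add]
  congr 2
  linear_combination (2 * π * w * τ) * Complex.I_sq

lemma exists_ramInt_eq (hb : 0 < b) (hb1 : b ≤ 1) (hu : |u.im| < (b + b⁻¹) / 2)
    (hv : |v.im| < (b + b⁻¹) / 2) (hd : b < u.im - v.im) :
    ∃ κ : ℂ, ∀ w : ℂ, 0 < w.im → w.im < u.im - v.im →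
      ramInt b u v w = κ * ramProd b u v w := by
  have hu1 := abs_lt.1 hu
  have hv1 := abs_lt.1 hv
  set τ : ℝ := (u.im + v.im) / 2 with hτ
  have hui : (u - τ * I).im = (u.im - v.im) / 2 := by simp [hτ]; ring
  have hvi : (v - τ * I).im = -((u.im - v.im) / 2) := by simp [hτ]; ring
  have hu' : |(u - τ * I).im| < (b + b⁻¹) / 2 := by
    rw [hui, abs_lt]; constructor <;> linarith [hu1.1, hu1.2, hv1.1, hv1.2]
  have hv' : |(v - τ * I).im| < (b + b⁻¹) / 2 := by
    rw [hvi, abs_lt]; constructor <;> linarith [hu1.1, hu1.2, hv1.1, hv1.2]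
  obtain ⟨κ, h⟩ := exists_ramInt_eq_of_symm (u := u - τ * I) (v := v - τ * I) hb hb1 hd
    (by linarith [hu1.2, hv1.1]) hui hvi
  refine ⟨κ, fun w h0 h1 => ?_⟩
  rcases le_total 0 τ with h2 | h2
  · have := ramInt_add_mul_I (u := u - τ * I) (v := v - τ * I) (w := w) hb hb1 h2 hu' hv'
      (by simpa using hu) (by simpa using hv) h0 (by rw [hui, hvi]; linarith)
    have h3 := ramProd_add_mul_I b τ (u - τ * I) (v - τ * I) w
    rw [sub_add_cancel, sub_add_cancel] at this h3
    rw [this, h3, h w h0 h1]; ring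
  · have := ramInt_add_mul_I (τ := -τ) (u := u) (v := v) (w := w) hb hb1 (by linarith) hu hv
      (by simpa [← sub_eq_add_neg] using hu') (by simpa [← sub_eq_add_neg] using hv') h0 h1
    have h3 := ramProd_add_mul_I b (-τ) u v w
    have e : ∀ z : ℂ, z + ((-τ : ℝ) : ℂ) * I = z - τ * I := fun z => by push_cast; ring
    rw [e, e] at this h3
    have h4 := h w h0 h1
    rw [this, h3] at h4
    exact mul_left_cancel₀ (Complex.exp_ne_zero _) (h4.trans (by ring))

end RamanujanConst

section RamanujanLimit

open Complex (I)
open Set Filter Topology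

variable {b : ℝ} {u v w : ℂ}

lemma tendsto_phiRatio_atBot (hb : 0 < b) (hb1 : b ≤ 1) (hu : |u.im| < (b + b⁻¹) / 2)
    (hv : |v.im| < (b + b⁻¹) / 2) : Tendsto (fun x : ℝ => phiRatio b u v x) atBot (𝓝 1) := by
  simpa [phiRatio] using (tendsto_PhiS_add_atBot hb hb1 hu).mul
    ((tendsto_PhiS_add_atBot hb hb1 hv).inv₀ one_ne_zero)

lemma tendsto_phiRatio_atTop (hb : 0 < b) (hb1 : b ≤ 1) (hu : |u.im| < (b + b⁻¹) / 2)
    (hv : |v.im| < (b + b⁻¹) / 2) (hd : 0 < u.im - v.im) :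
    Tendsto (fun x : ℝ => phiRatio b u v x) atTop (𝓝 0) := by
  have hpi := Real.pi_pos
  obtain ⟨C, hC, h⟩ := exists_norm_phiRatio_ofReal_le hb hb1 hu hv
  refine squeeze_zero_norm h ?_
  have h1 : Tendsto (fun x : ℝ => -(2 * π * (u.im - v.im) * max x 0)) atTop atBot := by
    refine tendsto_neg_atTop_atBot.comp (Tendsto.const_mul_atTop (by positivity) ?_)
    exact tendsto_atTop_mono (fun x => le_max_left x 0) tendsto_id
  simpa using (Real.tendsto_exp_atBot.comp h1).const_mul C

/-- The behaviour of the integral near the simple pole at `w = 0`. -/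
lemma tendsto_mul_ramInt (hb : 0 < b) (hb1 : b ≤ 1) (hu : |u.im| < (b + b⁻¹) / 2)
    (hv : |v.im| < (b + b⁻¹) / 2) (hd : 0 < u.im - v.im) :
    Tendsto (fun τ : ℝ => (τ : ℂ) * ramInt b u v (τ * I)) (𝓝[>] 0) (𝓝 (1 / (2 * π))) := by
  have hpi := Real.pi_pos
  obtain ⟨C, hC, h⟩ := exists_norm_phiRatio_ofReal_le hb hb1 hu hv
  have hlim : ∫ y : ℝ, (Iio (0 : ℝ)).indicator (fun y : ℝ => Complex.exp ((2 * π : ℂ) * y)) y =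
      1 / (2 * π) := by
    rw [integral_indicator measurableSet_Iio, ← integral_Iic_eq_integral_Iio,
      integral_exp_mul_complex_Iic (by simpa using hpi)]
    simp
  rw [← hlim]
  have key : Tendsto (fun τ : ℝ => ∫ y : ℝ, Complex.exp ((2 * π : ℂ) * y) *
      phiRatio b u v ((τ⁻¹ * y : ℝ) : ℂ)) (𝓝[>] 0)
      (𝓝 (∫ y : ℝ, (Iio (0 : ℝ)).indicator (fun y : ℝ => Complex.exp ((2 * π : ℂ) * y)) y)) := by
    refine tendsto_integral_filter_of_dominated_convergence
      (fun y => C * Real.exp (-(2 * π * |y|))) (Eventually.of_forall fun τ => ?_) ?_ ?_ ?_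
    · have := (continuous_phiRatio hb hb1 hu hv).comp (continuous_const_mul τ⁻¹)
      exact Continuous.aestronglyMeasurable (by fun_prop)
    · have : ∀ᶠ τ : ℝ in 𝓝[>] 0, τ ∈ Ioo 0 ((u.im - v.im) / 2) :=
        Ioo_mem_nhdsGT (by linarith)
      filter_upwards [this] with τ hτ
      refine Eventually.of_forall fun y => ?_
      rw [norm_mul]
      have e1 : ‖Complex.exp ((2 * π : ℂ) * y)‖ = Real.exp (2 * π * y) := by
        rw [Complex.norm_exp]; simp
      have e2 : Real.exp (-(2 * π * (u.im - v.im) * max (τ⁻¹ * y) 0)) ≤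
          Real.exp (-(4 * π * max y 0)) := by
        apply Real.exp_le_exp.2
        have h0 : 0 ≤ max y 0 := le_max_right _ _
        have e3 : max (τ⁻¹ * y) 0 = τ⁻¹ * max y 0 := by
          rw [mul_max_of_nonneg _ _ (inv_nonneg.2 hτ.1.le), mul_zero]
        have e4 : 2 ≤ (u.im - v.im) * τ⁻¹ := by
          rw [← div_eq_mul_inv, le_div_iff₀ hτ.1]; linarith [hτ.2]
        rw [e3]
        have : 2 * max y 0 ≤ (u.im - v.im) * τ⁻¹ * max y 0 := by gcongr
        nlinarith
      have e5 := exp_mul_sub_max_le (p := 2 * π) (d := 4 * π) (x := y)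
      rw [show 4 * π - 2 * π = 2 * π by ring, min_self] at e5
      calc _ ≤ Real.exp (2 * π * y) * (C * Real.exp (-(4 * π * max y 0))) := by
            rw [e1]; gcongr; exact (h _).trans (by gcongr)
        _ = C * (Real.exp (2 * π * y) * Real.exp (-(4 * π * max y 0))) := by ring
        _ ≤ _ := by gcongr
    · exact (integrable_exp_neg_mul_abs (by positivity)).const_mul C
    · have h0 : ∀ᵐ y : ℝ, y ≠ 0 := by simp [ae_iff]
      filter_upwards [h0] with y hy
      rcases lt_or_gt_of_ne hy with h1 | h1
      · rw [indicator_of_mem (show y ∈ Iio 0 from h1)]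
        have : Tendsto (fun τ : ℝ => τ⁻¹ * y) (𝓝[>] 0) atBot :=
          tendsto_inv_nhdsGT_zero.atTop_mul_const_of_neg h1
        simpa using ((tendsto_phiRatio_atBot hb hb1 hu hv).comp this).const_mul
          (Complex.exp ((2 * π : ℂ) * y))
      · rw [indicator_of_notMem (show y ∉ Iio 0 by simpa using h1.le)]
        have : Tendsto (fun τ : ℝ => τ⁻¹ * y) (𝓝[>] 0) atTop :=
          tendsto_inv_nhdsGT_zero.atTop_mul_const h1
        simpa using ((tendsto_phiRatio_atTop hb hb1 hu hv hd).comp this).const_mul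
          (Complex.exp ((2 * π : ℂ) * y))
  refine key.congr' ?_
  filter_upwards [self_mem_nhdsWithin] with τ (hτ : 0 < τ)
  have hc : (τ : ℂ) ≠ 0 := by exact_mod_cast hτ.ne'
  have := Measure.integral_comp_mul_left (fun x : ℝ => Complex.exp ((2 * π : ℂ) * (τ * x)) *
      phiRatio b u v x) τ⁻¹
  rw [inv_inv, abs_of_pos hτ] at this
  rw [ramInt, ← Complex.real_smul]
  refine (Eq.trans (integral_congr_ae (Eventually.of_forall fun y => ?_)) this).trans
    (congrArg (τ • ·) (integral_congr_ae (Eventually.of_forall fun y => ?_)))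
  · congr 2
    push_cast
    field_simp
  · dsimp only
    congr 2
    linear_combination (2 * π * τ * y) * Complex.I_sq

/-- `Φ_𝖻` has a simple pole at `c_𝖻`, and the residue normalises the integral. -/
lemma exists_ramInt_eq_mul_ramProd_of_lt (hb : 0 < b) (hb1 : b ≤ 1) :
    ∃ κ : ℂ, ∀ u v w : ℂ, |u.im| < (b + b⁻¹) / 2 → |v.im| < (b + b⁻¹) / 2 → b < u.im - v.im →
      0 < w.im → w.im < u.im - v.im →
      ramInt b u v w = κ * PhiS b (u - v - cB b) * ramProd b u v w := by
  have hpi := Real.pi_pos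
  have hbi : 0 < b⁻¹ := inv_pos.2 hb
  have key : ∀ u v κ' : ℂ, |u.im| < (b + b⁻¹) / 2 → |v.im| < (b + b⁻¹) / 2 → b < u.im - v.im →
      (∀ w : ℂ, 0 < w.im → w.im < u.im - v.im → ramInt b u v w = κ' * ramProd b u v w) →
      Tendsto (fun τ : ℝ => κ' * (τ * PhiS b (cB b - τ * I))) (𝓝[>] 0)
        (𝓝 (PhiS b (u - v - cB b) / (2 * π))) := by
    intro u v κ' hu hv hd h
    have hu1 := abs_lt.1 hu
    have hv1 := abs_lt.1 hv
    have t1 := tendsto_mul_ramInt hb hb1 hu hv (hb.trans hd)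
    have hc : ContinuousAt (fun τ : ℝ => Complex.exp (-2 * π * I * (τ * I) * (v + cB b)) *
        PhiS b (u - v - cB b - τ * I)) 0 := by
      have hp : ContinuousAt (fun τ : ℝ => PhiS b (u - v - cB b - τ * I)) 0 := by
        refine ContinuousAt.comp (g := PhiS b) (f := fun τ : ℝ => u - v - cB b - τ * I)
          (DifferentiableAt.continuousAt (𝕜 := ℂ) (differentiableAt_PhiS hb hb1 ?_))
          (by fun_prop)
        simp only [Complex.ofReal_zero, zero_mul, sub_zero, Complex.sub_im, cB_im]
        rw [abs_lt]; constructor <;> linarith [hu1.2, hv1.1]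
      exact ContinuousAt.mul (by fun_prop) hp
    have t2 := (hc.tendsto.mono_left nhdsWithin_le_nhds).mul t1
    simp only [Complex.ofReal_zero, zero_mul, mul_zero, Complex.exp_zero, one_mul, sub_zero,
      mul_one_div] at t2
    refine t2.congr' ?_
    have : ∀ᶠ τ : ℝ in 𝓝[>] 0, τ ∈ Ioo 0 (u.im - v.im) := Ioo_mem_nhdsGT (hb.trans hd)
    filter_upwards [this] with τ hτ
    have hi : ((τ : ℂ) * I).im = τ := by simp
    rw [h (τ * I) (by rw [hi]; exact hτ.1) (by rw [hi]; exact hτ.2), ramProd]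
    have e1 : Complex.exp (-2 * π * I * (τ * I) * (v + cB b)) *
        Complex.exp (2 * π * I * (τ * I) * (v + cB b)) = 1 := by
      rw [← Complex.exp_add, ← Complex.exp_zero]; congr 1; ring
    have e2 := mul_inv_cancel₀ (PhiS_ne_zero b (u - v - cB b - τ * I))
    linear_combination (κ' * τ * PhiS b (cB b - τ * I)) * e1 +
      (κ' * τ * PhiS b (cB b - τ * I)) * Complex.exp (-2 * π * I * (τ * I) * (v + cB b)) *
        Complex.exp (2 * π * I * (τ * I) * (v + cB b)) * e2
  set d₀ : ℝ := b + b⁻¹ / 2 with hd₀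
  set u₀ : ℂ := (d₀ / 2 : ℝ) * I with hu₀
  set v₀ : ℂ := (-(d₀ / 2) : ℝ) * I with hv₀
  have iu : u₀.im = d₀ / 2 := by simp [hu₀]
  have iv : v₀.im = -(d₀ / 2) := by simp [hv₀]
  have au : |u₀.im| < (b + b⁻¹) / 2 := by rw [iu, abs_lt]; constructor <;> linarith
  have av : |v₀.im| < (b + b⁻¹) / 2 := by rw [iv, abs_lt]; constructor <;> linarith
  have ad : b < u₀.im - v₀.im := by rw [iu, iv]; linarith
  obtain ⟨κ₀, h₀⟩ := exists_ramInt_eq hb hb1 au av ad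
  have t₀ := key u₀ v₀ κ₀ au av ad h₀
  have hpc : (2 * π : ℂ) ≠ 0 := by exact_mod_cast (by positivity : 2 * π ≠ 0)
  have n₀ : PhiS b (u₀ - v₀ - cB b) / (2 * π) ≠ 0 := div_ne_zero (PhiS_ne_zero _ _) hpc
  have hκ₀ : κ₀ ≠ 0 := by
    rintro rfl
    simp only [zero_mul] at t₀
    exact n₀ (tendsto_nhds_unique t₀ tendsto_const_nhds)
  refine ⟨κ₀ / PhiS b (u₀ - v₀ - cB b), fun u v w hu hv hd h0 h1 => ?_⟩
  obtain ⟨κ', h'⟩ := exists_ramInt_eq hb hb1 hu hv hd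
  have t' := key u v κ' hu hv hd h'
  have t₁ := t₀.const_mul (κ' / κ₀)
  have : κ' / κ₀ * (PhiS b (u₀ - v₀ - cB b) / (2 * π)) = PhiS b (u - v - cB b) / (2 * π) := by
    refine tendsto_nhds_unique (t₁.congr fun τ => ?_) t'
    field_simp
  rw [h' w h0 h1]
  congr 1
  have hP := PhiS_ne_zero b (u₀ - v₀ - cB b)
  field_simp at this ⊢
  linear_combination this

end RamanujanLimit

section RamanujanFormula

open Complex (I)
open Set Filter Topology

variable {b : ℝ} {u v w : ℂ}

/-- Ramanujan's formula for the quantum dilogarithm, together with its degeneration, the Fourier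
transform of `1 / Φ_𝖻`. -/
theorem exists_ramanujan (hb : 0 < b) (hb1 : b ≤ 1) :
    ∃ κ : ℂ, (∀ u v w : ℂ, |u.im| < (b + b⁻¹) / 2 → |v.im| < (b + b⁻¹) / 2 →
      u.im + b < (b + b⁻¹) / 2 → 0 < w.im → w.im < u.im - v.im →
      ramInt b u v w = κ * PhiS b (u - v - cB b) * ramProd b u v w) ∧
    ∀ v w : ℂ, 0 < w.im → w.im < -v.im → -v.im < (b + b⁻¹) / 2 →
      ∫ x : ℝ, Complex.exp (-2 * π * I * w * x) * (PhiS b (x + v))⁻¹ =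
        κ * (Complex.exp (2 * π * I * w * (v + cB b)) * PhiS b (cB b - w)) := by
  have hpi := Real.pi_pos
  have hbi : 0 < b⁻¹ := inv_pos.2 hb
  obtain ⟨κ, h⟩ := exists_ramInt_eq_mul_ramProd_of_lt hb hb1
  have main : ∀ u v w : ℂ, |u.im| < (b + b⁻¹) / 2 → |v.im| < (b + b⁻¹) / 2 →
      u.im + b < (b + b⁻¹) / 2 → 0 < w.im → w.im < u.im - v.im →
      ramInt b u v w = κ * PhiS b (u - v - cB b) * ramProd b u v w := by
    intro u v w hu hv hub h0 h1
    have hu1 := abs_lt.1 hu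
    have hv1 := abs_lt.1 hv
    have hub' : |u.im + b| < (b + b⁻¹) / 2 := by rw [abs_lt]; constructor <;> linarith [hu1.1]
    have hui : (u + b * I).im = u.im + b := by simp
    obtain ⟨k1, k2⟩ := ramInt_contiguity hb hb1 hu hv hub' h0 h1
    have k3 := h (u + b * I) v w (by rwa [hui]) hv (by rw [hui]; linarith) h0
      (by rw [hui]; linarith)
    obtain ⟨n1, f1⟩ := PhiS_sub_cB_sub (u := u) (v := v) (w := w) hb hb1 (by linarith)
      (by linarith [hv1.1])
    obtain ⟨-, f2⟩ := PhiS_sub_cB_sub (u := u) (v := v) (w := 0) hb hb1 (by simp; linarith)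
      (by simp; linarith [hv1.1])
    simp only [sub_zero, mul_zero, Complex.exp_zero, mul_one] at f2
    have e : ∀ z : ℂ, Complex.exp (2 * π * b * (z + I * b / 2)) =
        Complex.exp (π * I * b ^ 2) * Complex.exp (2 * π * b * z) := fun z => by
      rw [← Complex.exp_add]; ring_nf
    rw [e] at k1 k2
    rw [show -2 * π * w * b = -2 * π * b * w by ring] at k2
    have k4 : (Complex.exp (2 * π * b * v) -
        Complex.exp (2 * π * b * u) * Complex.exp (-2 * π * b * w)) * ramInt b u v w =
        (Complex.exp (2 * π * b * v) - Complex.exp (2 * π * b * u)) *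
          ramInt b (u + b * I) v w := by
      linear_combination Complex.exp (2 * π * b * v) * k1 - Complex.exp (2 * π * b * u) * k2
    apply mul_left_cancel₀ n1
    rw [k4, k3, ramProd, ramProd]
    have hP := PhiS_ne_zero b (u - v - cB b - w)
    have hP' := PhiS_ne_zero b (u + b * I - v - cB b - w)
    have e6 : (PhiS b (u - v - cB b - w))⁻¹ * (Complex.exp (2 * π * b * v) -
        Complex.exp (2 * π * b * u) * Complex.exp (-2 * π * b * w)) =
        Complex.exp (2 * π * b * v) * (PhiS b (u + b * I - v - cB b - w))⁻¹ := by
      rw [inv_mul_eq_div, div_eq_iff hP, eq_comm, mul_right_comm, f1, mul_assoc,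
        mul_inv_cancel₀ hP', mul_one]
    linear_combination (-(κ * Complex.exp (2 * π * I * w * (v + cB b)) * PhiS b (cB b - w) *
      PhiS b (u - v - cB b))) * e6 - (κ * Complex.exp (2 * π * I * w * (v + cB b)) *
      PhiS b (cB b - w) * (PhiS b (u + b * I - v - cB b - w))⁻¹) * f2
  refine ⟨κ, main, fun v w h0 h1 h2 => ?_⟩
  set η : ℝ := (-v.im - w.im) / 2 with hη
  have hη0 : 0 < η := by rw [hη]; linarith
  have hηQ : η < (b + b⁻¹) / 2 := by rw [hη]; linarith
  set e : ℂ := ((-η : ℝ) : ℂ) * I with he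
  have eim : e.im = -η := by simp [he]
  have ere : e.re = 0 := by simp [he]
  have ae : |e.im| < (b + b⁻¹) / 2 := by rw [eim, abs_neg, abs_of_pos hη0]; exact hηQ
  have hv : |v.im| < (b + b⁻¹) / 2 := by rw [abs_lt]; constructor <;> linarith
  have t1 : Tendsto (fun s : ℝ => ramInt b (s + e) v w) atBot
      (𝓝 (κ * (Complex.exp (2 * π * I * w * (v + cB b)) * PhiS b (cB b - w)))) := by
    have hz1 : |(e - v - cB b).im| < (b + b⁻¹) / 2 := by
      rw [Complex.sub_im, Complex.sub_im, cB_im, eim, abs_lt]; constructor <;> linarith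
    have hz2 : |(e - v - cB b - w).im| < (b + b⁻¹) / 2 := by
      rw [Complex.sub_im, Complex.sub_im, Complex.sub_im, cB_im, eim, abs_lt]
      constructor <;> linarith
    have := (((tendsto_PhiS_add_atBot hb hb1 hz1).mul
      ((tendsto_PhiS_add_atBot hb hb1 hz2).inv₀ one_ne_zero)).const_mul
      (κ * (Complex.exp (2 * π * I * w * (v + cB b)) * PhiS b (cB b - w))))
    rw [inv_one, mul_one, mul_one] at this
    refine this.congr fun s => ?_
    have hi : ((s : ℂ) + e).im = -η := by simp [eim]
    rw [main (s + e) v w (by rw [hi, ← eim]; exact ae) hv (by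
      rw [hi]
      have : b ≤ b⁻¹ := hb1.trans ((one_le_inv₀ hb).2 hb1)
      linarith) h0 (by rw [hi]; linarith), ramProd,
      show (s : ℂ) + e - v - cB b = s + (e - v - cB b) by ring, ← add_sub_assoc]
    ring_nf
  refine tendsto_nhds_unique ?_ t1
  obtain ⟨C, hC, hP⟩ := exists_norm_PhiS_add_le hb hb1 hηQ 0
  obtain ⟨C', hC', hP'⟩ := exists_norm_PhiS_add_le hb hb1 hv |v.re|
  have hpos : 0 < min (2 * π * w.im) (2 * π * (-v.im - η) - 2 * π * w.im) := by
    refine lt_min (by positivity) ?_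
    have : 0 < -v.im - η - w.im := by linarith
    have : 0 < 2 * π * (-v.im - η - w.im) := by positivity
    linarith
  refine tendsto_integral_filter_of_dominated_convergence
    (fun x => C * C' * Real.exp (-(min (2 * π * w.im) (2 * π * (-v.im - η) - 2 * π * w.im) * |x|)))
    (Eventually.of_forall fun s => ?_) ?_ ((integrable_exp_neg_mul_abs hpos).const_mul _)
    (Eventually.of_forall fun x => ?_)
  · have := continuous_phiRatio hb hb1 (u := s + e) (v := v) (by simpa using ae) hv
    exact Continuous.aestronglyMeasurable (by fun_prop)
  · filter_upwards [eventually_le_atBot 0] with s hs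
    refine Eventually.of_forall fun x => ?_
    have k1 := (hP ((x + s : ℝ) : ℂ) e (by simp [ere])
      (by simp [eim, abs_of_pos hη0])).1
    have k2 := (hP' (x : ℂ) v le_rfl (by simp)).2
    simp only [Complex.add_im, Complex.ofReal_im, zero_add, eim, Complex.ofReal_re] at k1 k2
    have k3 : Real.exp (-(2 * π * -η * max (x + s) 0)) ≤ Real.exp (2 * π * η * max x 0) := by
      apply Real.exp_le_exp.2
      have : max (x + s) 0 ≤ max x 0 := max_le_max (by linarith) le_rfl
      have : 2 * π * η * max (x + s) 0 ≤ 2 * π * η * max x 0 := by gcongr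
      linarith
    rw [phiRatio, norm_mul, norm_mul, norm_exp_two_pi_I, Complex.ofReal_re, Complex.ofReal_im,
      mul_zero, Real.exp_zero, mul_one,
      show (x : ℂ) + (s + e) = ((x + s : ℝ) : ℂ) + e by push_cast; ring]
    have k4 := exp_mul_sub_max_le (p := 2 * π * w.im) (d := 2 * π * (-v.im - η)) (x := x)
    calc _ ≤ Real.exp (2 * π * w.im * x) * ((C * Real.exp (2 * π * η * max x 0)) *
          (C' * Real.exp (2 * π * v.im * max x 0))) := by
            gcongr
            exact k1.trans (by gcongr)
      _ = C * C' * (Real.exp (2 * π * w.im * x) *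
          Real.exp (-(2 * π * (-v.im - η) * max x 0))) := by
            rw [show -(2 * π * (-v.im - η) * max x 0) = 2 * π * η * max x 0 +
              2 * π * v.im * max x 0 by ring, Real.exp_add]
            ring
      _ ≤ _ := by gcongr
  · have hz : |((x : ℂ) + e).im| < (b + b⁻¹) / 2 := by simpa using ae
    have := ((tendsto_PhiS_add_atBot hb hb1 hz).mul_const ((PhiS b (x + v))⁻¹)).const_mul
      (Complex.exp (-2 * π * I * w * x))
    rw [one_mul] at this
    refine this.congr fun s => ?_
    rw [phiRatio, add_left_comm]

end RamanujanFormula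

section FourierProduct

open Complex (I)
open Set Filter Topology

lemma norm_exp_I_mul_ofReal (c x y : ℝ) : ‖Complex.exp (c * π * I * x * y)‖ = 1 := by
  rw [Complex.norm_exp]; simp

lemma integral_fourier_mul_exp {g : ℝ → ℂ} (hgc : Continuous g) (hg : Integrable g)
    (hG : Integrable fun s : ℝ => ∫ t : ℝ, g t * Complex.exp (-2 * π * I * s * t)) (q : ℝ) :
    ∫ s : ℝ, (∫ t : ℝ, g t * Complex.exp (-2 * π * I * s * t)) *
      Complex.exp (2 * π * I * q * s) = g q := by
  have e : FourierTransform.fourier g =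
      fun s : ℝ => ∫ t : ℝ, g t * Complex.exp (-2 * π * I * s * t) := by
    ext s
    rw [Real.fourier_real_eq_integral_exp_smul]
    refine integral_congr_ae (Eventually.of_forall fun t => ?_)
    dsimp only
    rw [smul_eq_mul, mul_comm]
    congr 2
    push_cast
    ring
  have := hg.fourierInv_fourier_eq (by rwa [e]) hgc.continuousAt (v := q)
  rw [e, Real.fourierInv_eq_fourier_neg, Real.fourier_real_eq_integral_exp_smul] at this
  rw [← this]
  refine integral_congr_ae (Eventually.of_forall fun s => ?_)
  dsimp only
  rw [smul_eq_mul, mul_comm]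
  congr 2
  push_cast
  ring

/-- The convolution of two Fourier transforms is the Fourier transform of the product. -/
lemma integral_fourier_mul_fourier_sub {f g : ℝ → ℂ} (hf : Integrable f) (hgc : Continuous g)
    (hg : Integrable g)
    (hG : Integrable fun s : ℝ => ∫ t : ℝ, g t * Complex.exp (-2 * π * I * s * t)) (v : ℝ) :
    ∫ x : ℝ, (∫ t : ℝ, g t * Complex.exp (-2 * π * I * (v - x : ℝ) * t)) *
        (∫ q : ℝ, f q * Complex.exp (-2 * π * I * x * q)) =
      ∫ q : ℝ, f q * g q * Complex.exp (-2 * π * I * v * q) := by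
  set G : ℝ → ℂ := fun s : ℝ => ∫ t : ℝ, g t * Complex.exp (-2 * π * I * s * t) with hGdef
  have hGv : Integrable fun x : ℝ => G (v - x) := hG.comp_sub_left v
  have h1 : ∀ x : ℝ, G (v - x) * (∫ q : ℝ, f q * Complex.exp (-2 * π * I * x * q)) =
      ∫ q : ℝ, G (v - x) * (f q * Complex.exp (-2 * π * I * x * q)) := fun x =>
    (integral_const_mul _ _).symm
  have h2 : ∀ q : ℝ, ∫ x : ℝ, G (v - x) * (f q * Complex.exp (-2 * π * I * x * q)) =
      f q * g q * Complex.exp (-2 * π * I * v * q) := fun q => by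
    have h := congrArg (· * (f q * Complex.exp (-2 * π * I * v * q)))
      (integral_fourier_mul_exp hgc hg hG q)
    rw [← integral_mul_const] at h
    rw [← integral_sub_left_eq_self _ volume v]
    refine Eq.trans (integral_congr_ae (Eventually.of_forall fun s => ?_))
      (h.trans (by ring))
    dsimp only
    have e1 : Complex.exp (-2 * π * I * (v - s : ℝ) * q) =
        Complex.exp (2 * π * I * q * s) * Complex.exp (-2 * π * I * v * q) := by
      rw [← Complex.exp_add]
      congr 1
      push_cast
      ring
    rw [sub_sub_cancel, e1]
    ring
  calc _ = ∫ x : ℝ, ∫ q : ℝ, G (v - x) * (f q * Complex.exp (-2 * π * I * x * q)) :=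
        integral_congr_ae (Eventually.of_forall h1)
    _ = ∫ q : ℝ, ∫ x : ℝ, G (v - x) * (f q * Complex.exp (-2 * π * I * x * q)) := by
        refine integral_integral_swap ?_
        have : Integrable (fun p : ℝ × ℝ => G (v - p.1) * f p.2) (volume.prod volume) :=
          hGv.mul_prod hf
        have h3 := this.mul_bdd (c := 1)
          (g := fun p : ℝ × ℝ => Complex.exp ((-2 : ℝ) * π * I * p.1 * p.2))
          (Continuous.aestronglyMeasurable (by fun_prop))
          (Eventually.of_forall fun p => (norm_exp_I_mul_ofReal _ _ _).le)
        refine h3.congr (Eventually.of_forall fun p => ?_)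
        simp only [Function.uncurry, mul_assoc]
        push_cast
        rfl
    _ = _ := integral_congr_ae (Eventually.of_forall h2)

end FourierProduct

section PsiTransform

open Complex (I)
open Set Filter Topology

variable {b a c : ℝ}

lemma cB_eq (b : ℝ) : cB b = ((b + b⁻¹) / 2 : ℝ) * I := by
  rw [cB]; push_cast; ring

lemma psiF_ofReal (hb : 0 < b) (ha : 0 < a) (hc : 0 < c) (hac : 0 < 1 / 2 - a - c) (t : ℝ) :
    psiF b a c t = (PhiS b (t + -2 * cB b * (a + c)))⁻¹ *
      Complex.exp (-4 * π * I * cB b * a * (t - cB b * (a + c)) -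
        π * I * cB b ^ 2 * (4 * (a - c) + 1) / 6) := by
  have hQ : 0 < b + b⁻¹ := by have := inv_pos.2 hb; positivity
  have him : ((t : ℂ) - 2 * cB b * (a + c)).im = -((b + b⁻¹) * (a + c)) := by
    rw [cB_eq]; simp; exact Or.inl (by ring)
  have h1 : ¬ ((t : ℂ) - 2 * cB b * (a + c)).im ≤ -((b + b⁻¹) / 2) := by
    rw [him, not_le]; nlinarith
  have h2 : ¬ (b + b⁻¹) / 2 ≤ ((t : ℂ) - 2 * cB b * (a + c)).im := by
    rw [him, not_le]; nlinarith
  rw [psiF, Phi, if_neg h1, if_neg h2, mul_assoc, ← Complex.exp_add]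
  congr 3 <;> ring

/-- The exponent in the closed form of the Fourier transform of `ψ_{a,c}`. -/
def psiExponent (C a c s : ℂ) : ℂ :=
  2 * π * I * (s + 2 * C * a) * (C - 2 * C * (a + c)) + 4 * π * I * C ^ 2 * a * (a + c) -
    π * I * C ^ 2 * (4 * (a - c) + 1) / 6

lemma psiT_eq (hb : 0 < b) {κ : ℂ}
    (hκ : ∀ v w : ℂ, 0 < w.im → w.im < -v.im → -v.im < (b + b⁻¹) / 2 →
      ∫ x : ℝ, Complex.exp (-2 * π * I * w * x) * (PhiS b (x + v))⁻¹ =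
        κ * (Complex.exp (2 * π * I * w * (v + cB b)) * PhiS b (cB b - w)))
    (ha : 0 < a) (hc : 0 < c) (hac : 0 < 1 / 2 - a - c) (s : ℝ) :
    psiT b a c s = κ * (PhiS b (cB b * (1 - 2 * a) - s) *
      Complex.exp (psiExponent (cB b) a c s)) := by
  have hQ : 0 < b + b⁻¹ := by have := inv_pos.2 hb; positivity
  have hv : (-2 * cB b * (a + c)).im = -((b + b⁻¹) * (a + c)) := by
    rw [cB_eq]; simp; exact Or.inl (by ring)
  have hw : ((s : ℂ) + 2 * cB b * a).im = (b + b⁻¹) * a := by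
    rw [cB_eq]; simp; exact Or.inl (by ring)
  have := hκ (-2 * cB b * (a + c)) (s + 2 * cB b * a) (by rw [hw]; positivity)
    (by rw [hw, hv]; nlinarith) (by rw [hv]; nlinarith)
  rw [psiT]
  have e : ∀ t : ℝ, psiF b a c t * Complex.exp (-2 * π * I * s * t) =
      Complex.exp (4 * π * I * cB b ^ 2 * a * (a + c) -
        π * I * cB b ^ 2 * (4 * (a - c) + 1) / 6) *
      (Complex.exp (-2 * π * I * (s + 2 * cB b * a) * t) *
        (PhiS b (t + -2 * cB b * (a + c)))⁻¹) := fun t => by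
    rw [psiF_ofReal hb ha hc hac, mul_assoc, ← Complex.exp_add, ← mul_assoc, ← Complex.exp_add,
      mul_comm]
    congr 2
    ring
  simp_rw [e]
  rw [integral_const_mul, this, psiExponent,
    show cB b * (1 - 2 * a) - s = cB b - (s + 2 * cB b * a) by ring]
  rw [mul_left_comm, ← mul_assoc (Complex.exp _), ← Complex.exp_add,
    mul_comm (PhiS b _)]
  congr 3
  ring

lemma continuous_psiF (hb : 0 < b) (hb1 : b ≤ 1) (ha : 0 < a) (hc : 0 < c)
    (hac : 0 < 1 / 2 - a - c) : Continuous fun t : ℝ => psiF b a c t := by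
  simp_rw [psiF_ofReal hb ha hc hac]
  have hQ : 0 < b + b⁻¹ := by have := inv_pos.2 hb; positivity
  have hv : |(-2 * cB b * (a + c)).im| < (b + b⁻¹) / 2 := by
    rw [cB_eq, abs_lt]; simp; constructor <;> nlinarith
  exact ((continuous_PhiS_ofReal_add hb hb1 hv).inv₀ fun _ => PhiS_ne_zero _ _).mul (by fun_prop)

lemma integrable_psiF (hb : 0 < b) (hb1 : b ≤ 1) (ha : 0 < a) (hc : 0 < c)
    (hac : 0 < 1 / 2 - a - c) : Integrable fun t : ℝ => psiF b a c t := by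
  have hpi := Real.pi_pos
  have hQ : 0 < b + b⁻¹ := by have := inv_pos.2 hb; positivity
  have him : (-2 * cB b * (a + c)).im = -((b + b⁻¹) * (a + c)) := by
    rw [cB_eq]; simp; exact Or.inl (by ring)
  have hre : (-2 * cB b * (a + c)).re = 0 := by rw [cB_eq]; simp
  have hv : |(-2 * cB b * (a + c)).im| < (b + b⁻¹) / 2 := by
    rw [him, abs_lt]; constructor <;> nlinarith
  obtain ⟨C, hC, h⟩ := exists_norm_PhiS_add_le hb hb1 hv 0
  set K : ℂ := 4 * π * I * cB b ^ 2 * a * (a + c) - π * I * cB b ^ 2 * (4 * (a - c) + 1) / 6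
    with hK
  have hpos : 0 < min (2 * π * (b + b⁻¹) * a)
      (2 * π * (b + b⁻¹) * (a + c) - 2 * π * (b + b⁻¹) * a) := by
    rw [show 2 * π * (b + b⁻¹) * (a + c) - 2 * π * (b + b⁻¹) * a = 2 * π * (b + b⁻¹) * c by ring]
    exact lt_min (by positivity) (by positivity)
  refine integrable_of_norm_le_exp (continuous_psiF hb hb1 ha hc hac) hpos
    (C := C * ‖Complex.exp K‖) fun t => ?_
  have h1 := (h t (-2 * cB b * (a + c)) (by rw [hre]; simp) (by simp)).2
  rw [Complex.add_im, Complex.ofReal_im, zero_add, him, Complex.ofReal_re] at h1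
  rw [psiF_ofReal hb ha hc hac, show -4 * π * I * cB b * a * (t - cB b * (a + c)) -
      π * I * cB b ^ 2 * (4 * (a - c) + 1) / 6 = -4 * π * I * cB b * a * t + K by rw [hK]; ring,
    Complex.exp_add, norm_mul, norm_mul]
  have h2 : ‖Complex.exp (-4 * π * I * cB b * a * t)‖ = Real.exp (2 * π * (b + b⁻¹) * a * t) := by
    rw [Complex.norm_exp, cB_eq]; congr 1; simp; exact Or.inl (Or.inl (by ring))
  have h3 := exp_mul_sub_max_le (p := 2 * π * (b + b⁻¹) * a) (d := 2 * π * (b + b⁻¹) * (a + c))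
    (x := t)
  rw [h2]
  calc _ ≤ C * Real.exp (2 * π * -((b + b⁻¹) * (a + c)) * max t 0) *
        (Real.exp (2 * π * (b + b⁻¹) * a * t) * ‖Complex.exp K‖) := by gcongr
    _ = C * ‖Complex.exp K‖ * (Real.exp (2 * π * (b + b⁻¹) * a * t) *
        Real.exp (-(2 * π * (b + b⁻¹) * (a + c) * max t 0))) := by
      rw [show 2 * π * -((b + b⁻¹) * (a + c)) * max t 0 =
        -(2 * π * (b + b⁻¹) * (a + c) * max t 0) by ring]
      ring
    _ ≤ _ := by gcongr

lemma continuous_psiT (hb : 0 < b) (hb1 : b ≤ 1) (ha : 0 < a) (hc : 0 < c)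
    (hac : 0 < 1 / 2 - a - c) : Continuous (psiT b a c) := by
  obtain ⟨κ, -, hκ⟩ := exists_ramanujan hb hb1
  have hQ : 0 < b + b⁻¹ := by have := inv_pos.2 hb; positivity
  rw [funext (psiT_eq hb hκ ha hc hac)]
  have hv : |(cB b * (1 - 2 * a)).im| < (b + b⁻¹) / 2 := by
    rw [cB_eq, abs_lt]; simp; constructor <;> nlinarith
  have := (continuous_PhiS_ofReal_add hb hb1 hv).comp continuous_neg
  have h2 : Continuous fun s : ℝ => PhiS b (cB b * (1 - 2 * a) - s) := by
    refine this.congr fun s => ?_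
    simp only [Function.comp]
    congr 1; push_cast; ring
  unfold psiExponent
  exact continuous_const.mul (h2.mul (by fun_prop))

/-- Exponential decay of the Fourier transform of `ψ_{a,c}`. -/
lemma exists_norm_psiT_le (hb : 0 < b) (hb1 : b ≤ 1) (ha : 0 < a) (hc : 0 < c)
    (hac : 0 < 1 / 2 - a - c) :
    ∃ C m : ℝ, 0 < C ∧ 0 < m ∧ ∀ s : ℝ, ‖psiT b a c s‖ ≤ C * Real.exp (-(m * |s|)) := by
  have hpi := Real.pi_pos
  have hQ : 0 < b + b⁻¹ := by have := inv_pos.2 hb; positivity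
  obtain ⟨κ, -, hκ⟩ := exists_ramanujan hb hb1
  have him : (cB b * (1 - 2 * a)).im = (b + b⁻¹) / 2 * (1 - 2 * a) := by rw [cB_eq]; simp
  have hre : (cB b * (1 - 2 * a)).re = 0 := by rw [cB_eq]; simp
  have hv : |(cB b * (1 - 2 * a)).im| < (b + b⁻¹) / 2 := by
    rw [him, abs_lt]; constructor <;> nlinarith
  obtain ⟨C, hC, h⟩ := exists_norm_PhiS_add_le hb hb1 hv 0
  set K : ℂ := psiExponent (cB b) a c 0 with hK
  set p : ℝ := 2 * π * (b + b⁻¹) * (1 / 2 - a - c) with hp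
  set d : ℝ := 2 * π * ((b + b⁻¹) / 2 * (1 - 2 * a)) with hd
  have hpos : 0 < min p (d - p) := by
    rw [show d - p = 2 * π * (b + b⁻¹) * c by rw [hp, hd]; ring]
    exact lt_min (by positivity) (by positivity)
  refine ⟨(‖κ‖ + 1) * (C * ‖Complex.exp K‖), _, ?_, hpos, fun s => ?_⟩
  · have : 0 < ‖Complex.exp K‖ := by simp
    positivity
  have h1 := (h (-s : ℝ) (cB b * (1 - 2 * a)) (by rw [hre]; simp) (by simp)).1
  rw [Complex.add_im, Complex.ofReal_im, zero_add, him, Complex.ofReal_re, ← hd] at h1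
  have h2 : ‖Complex.exp (psiExponent (cB b) a c s)‖ = Real.exp (p * -s) * ‖Complex.exp K‖ := by
    rw [show psiExponent (cB b) a c s = 2 * π * I * s * (cB b - 2 * cB b * (a + c)) + K by
      rw [hK, psiExponent, psiExponent]; ring, Complex.exp_add, norm_mul, Complex.norm_exp, cB_eq]
    congr 2
    simp [hp]
    ring
  have h3 := exp_mul_sub_max_le (p := p) (d := d) (x := -s)
  rw [abs_neg] at h3
  rw [psiT_eq hb hκ ha hc hac, norm_mul, norm_mul, h2,
    show cB b * (1 - 2 * a) - s = ((-s : ℝ) : ℂ) + cB b * (1 - 2 * a) by push_cast; ring]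
  clear_value p d K
  calc ‖κ‖ * (‖PhiS b (((-s : ℝ) : ℂ) + cB b * (1 - 2 * a))‖ *
        (Real.exp (p * -s) * ‖Complex.exp K‖))
      ≤ (‖κ‖ + 1) * (C * Real.exp (-(d * max (-s) 0)) *
        (Real.exp (p * -s) * ‖Complex.exp K‖)) := by gcongr; linarith
    _ = (‖κ‖ + 1) * (C * ‖Complex.exp K‖) *
        (Real.exp (p * -s) * Real.exp (-(d * max (-s) 0))) := by ring
    _ ≤ _ := by gcongr

lemma integrable_psiT (hb : 0 < b) (hb1 : b ≤ 1) (ha : 0 < a) (hc : 0 < c)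
    (hac : 0 < 1 / 2 - a - c) : Integrable (psiT b a c) := by
  obtain ⟨C, m, -, hm, h⟩ := exists_norm_psiT_le hb hb1 ha hc hac
  exact integrable_of_norm_le_exp (continuous_psiT hb hb1 ha hc hac) hm h

end PsiTransform

section PentagonIntegral

open Complex (I)
open Set Filter Topology

variable {b a0 a1 a2 a3 a4 c0 c1 c2 c3 c4 : ℝ}

/-- The exponential prefactor of the ratio `ψ_{a₃,c₃}(q - u) / ψ_{a₄,c₄}(q)`. -/
def ratioExponent (C a3 c3 a4 c4 u : ℂ) : ℂ :=
  4 * π * I * C * a3 * (u + C * (a3 + c3)) - 4 * π * I * C ^ 2 * a4 * (a4 + c4) -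
    π * I * C ^ 2 * (4 * (a3 - c3) + 1) / 6 + π * I * C ^ 2 * (4 * (a4 - c4) + 1) / 6

lemma psiF_ne_zero (hb : 0 < b) {a c : ℝ} (ha : 0 < a) (hc : 0 < c) (hac : 0 < 1 / 2 - a - c)
    (t : ℝ) : psiF b a c t ≠ 0 := by
  rw [psiF_ofReal hb ha hc hac]
  exact mul_ne_zero (inv_ne_zero (PhiS_ne_zero _ _)) (Complex.exp_ne_zero _)

lemma psiF_div_psiF_mul_exp (hb : 0 < b) (ha3 : 0 < a3) (hc3 : 0 < c3)
    (hb3 : 0 < 1 / 2 - a3 - c3) (ha4 : 0 < a4) (hc4 : 0 < c4) (hb4 : 0 < 1 / 2 - a4 - c4)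
    (u x q : ℝ) :
    psiF b a3 c3 (q - u : ℝ) * (psiF b a4 c4 q)⁻¹ * Complex.exp (-2 * π * I * x * q) =
      Complex.exp (ratioExponent (cB b) a3 c3 a4 c4 u) *
        (Complex.exp (-2 * π * I * (x + 2 * cB b * (a3 - a4)) * q) *
          phiRatio b (-2 * cB b * (a4 + c4)) (-u - 2 * cB b * (a3 + c3)) q) := by
  rw [psiF_ofReal hb ha3 hc3 hb3, psiF_ofReal hb ha4 hc4 hb4, phiRatio, mul_inv, inv_inv,
    ← Complex.exp_neg,
    show ((q - u : ℝ) : ℂ) + -2 * cB b * (a3 + c3) = q + (-u - 2 * cB b * (a3 + c3)) by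
      push_cast; ring]
  generalize PhiS b (q + (-u - 2 * cB b * (a3 + c3))) = X
  generalize PhiS b (q + -2 * cB b * (a4 + c4)) = Y
  have key : ∀ p q r s t : ℂ, p + q + r = s + t → X⁻¹ * Complex.exp p * (Y * Complex.exp q) *
      Complex.exp r = Complex.exp s * (Complex.exp t * (Y * X⁻¹)) := fun p q r s t h => by
    have := congrArg Complex.exp h
    rw [Complex.exp_add, Complex.exp_add, Complex.exp_add] at this
    linear_combination (X⁻¹ * Y) * this
  refine key _ _ _ _ _ ?_
  rw [ratioExponent]; push_cast; ring

/-- The positivity conditions and linear relations satisfied by the angles of the five tetrahedra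
in the pentagon identity. -/
structure PentagonAngles (a0 a1 a2 a3 a4 c0 c1 c2 c3 c4 : ℝ) : Prop where
  ha0 : 0 < a0
  ha2 : 0 < a2
  ha4 : 0 < a4
  hc0 : 0 < c0
  hc4 : 0 < c4
  hb0 : 0 < 1 / 2 - a0 - c0
  hb1 : 0 < 1 / 2 - a1 - c1
  hb2 : 0 < 1 / 2 - a2 - c2
  hb3 : 0 < 1 / 2 - a3 - c3
  hb4 : 0 < 1 / 2 - a4 - c4
  e1 : a1 = a0 + a2
  e2 : a3 = a2 + a4
  e3 : c1 = c0 + a4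
  e4 : c3 = a0 + c4
  e5 : c2 = c1 + c3

lemma cB_strip_im (u a c : ℝ) : ((-u : ℂ) - 2 * cB b * (a + c)).im = -((b + b⁻¹) * (a + c)) := by
  rw [cB_eq]; simp; exact Or.inl (by ring)

lemma cB_strip_im_zero (a c : ℝ) : (-2 * cB b * (a + c)).im = -((b + b⁻¹) * (a + c)) := by
  rw [cB_eq]; simp; exact Or.inl (by ring)

lemma cB_freq_im (x a c : ℝ) : ((x : ℂ) + 2 * cB b * (a - c)).im = (b + b⁻¹) * (a - c) := by
  rw [cB_eq]; simp; exact Or.inl (by ring)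

namespace PentagonAngles

lemma ha1 (h : PentagonAngles a0 a1 a2 a3 a4 c0 c1 c2 c3 c4) : 0 < a1 := by
  rw [h.e1]; exact add_pos h.ha0 h.ha2

lemma ha3 (h : PentagonAngles a0 a1 a2 a3 a4 c0 c1 c2 c3 c4) : 0 < a3 := by
  rw [h.e2]; exact add_pos h.ha2 h.ha4

lemma hc1 (h : PentagonAngles a0 a1 a2 a3 a4 c0 c1 c2 c3 c4) : 0 < c1 := by
  rw [h.e3]; exact add_pos h.hc0 h.ha4

lemma hc3 (h : PentagonAngles a0 a1 a2 a3 a4 c0 c1 c2 c3 c4) : 0 < c3 := by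
  rw [h.e4]; exact add_pos h.ha0 h.hc4

lemma hc2 (h : PentagonAngles a0 a1 a2 a3 a4 c0 c1 c2 c3 c4) : 0 < c2 := by
  rw [h.e5]; exact add_pos h.hc1 h.hc3

lemma integrable_ratio_mul_exp (h : PentagonAngles a0 a1 a2 a3 a4 c0 c1 c2 c3 c4)
    (hb : 0 < b) (hle : b ≤ 1) (u x : ℝ) :
    Integrable fun q : ℝ => psiF b a3 c3 (q - u : ℝ) * (psiF b a4 c4 q)⁻¹ *
      Complex.exp (-2 * π * I * x * q) := by
  have hQ : 0 < b + b⁻¹ := by have := inv_pos.2 hb; positivity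
  simp_rw [psiF_div_psiF_mul_exp hb h.ha3 h.hc3 h.hb3 h.ha4 h.hc4 h.hb4]
  have := h.ha0; have := h.ha2; have := h.ha4; have := h.hc4; have := h.hb3; have := h.hb4
  have := h.e2; have := h.e4
  refine (integrable_ramInt hb hle ?_ ?_ ?_ ?_).const_mul _
  · rw [cB_strip_im_zero, abs_lt]; constructor <;> nlinarith
  · rw [cB_strip_im, abs_lt]; constructor <;> nlinarith
  · rw [cB_freq_im]; nlinarith
  · rw [cB_freq_im, cB_strip_im, cB_strip_im_zero]; nlinarith

/-- The Fourier transform of a ratio of two tetrahedral functions, expressed through three Fourier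
transforms of tetrahedral functions. -/
lemma exp_mul_psiT_mul_psiT (h : PentagonAngles a0 a1 a2 a3 a4 c0 c1 c2 c3 c4)
    (hb : 0 < b) (hle : b ≤ 1) (u x : ℝ) :
    Complex.exp (-π * I * x ^ 2) * psiT b a2 c2 x * psiT b a0 c0 (u - x) =
      Complex.exp (π * I * cB b ^ 2 * (2 * (c0 + a2 + c4) - 1 / 2) / 3) * psiT b a1 c1 u *
        ∫ q : ℝ, psiF b a3 c3 (q - u : ℝ) * (psiF b a4 c4 q)⁻¹ *
          Complex.exp (-2 * π * I * x * q) := by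
  have hQ : 0 < b + b⁻¹ := by have := inv_pos.2 hb; positivity
  have hbi : 1 ≤ b⁻¹ := (one_le_inv₀ hb).2 hle
  obtain ⟨κ, hκ1, hκ⟩ := exists_ramanujan hb hle
  obtain ⟨ζ, hζ, hinv⟩ := exists_PhiS_mul_PhiS_neg hb hle
  simp_rw [psiF_div_psiF_mul_exp hb h.ha3 h.hc3 h.hb3 h.ha4 h.hc4 h.hb4]
  rw [integral_const_mul, psiT_eq hb hκ h.ha2 h.hc2 h.hb2, psiT_eq hb hκ h.ha0 h.hc0 h.hb0,
    psiT_eq hb hκ h.ha1 h.hc1 h.hb1]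
  have i0 : |(cB b * (1 - 2 * a0) - ((u - x : ℝ) : ℂ)).im| < (b + b⁻¹) / 2 := by
    have := h.ha0; have := h.hc0; have := h.hb0
    rw [cB_eq, abs_lt]; simp; constructor <;> nlinarith
  have i1 : |(cB b * (1 - 2 * a1) - (u : ℂ)).im| < (b + b⁻¹) / 2 := by
    have := h.ha1; have := h.hc1; have := h.hb1
    rw [cB_eq, abs_lt]; simp; constructor <;> nlinarith
  have k0 := hinv _ i0
  have k1 := hinv _ i1
  have hr := hκ1 (-2 * cB b * (a4 + c4)) (-u - 2 * cB b * (a3 + c3)) (x + 2 * cB b * (a3 - a4))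
  have := h.ha0; have := h.ha2; have := h.ha4; have := h.hc4; have := h.hb3; have := h.hb4
  have := h.e2; have := h.e4
  have hr := hr (by rw [cB_strip_im_zero, abs_lt]; constructor <;> nlinarith)
    (by rw [cB_strip_im, abs_lt]; constructor <;> nlinarith)
    (by rw [cB_strip_im_zero]; nlinarith)
    (by rw [cB_freq_im]; nlinarith) (by rw [cB_freq_im, cB_strip_im, cB_strip_im_zero]; nlinarith)
  rw [ramInt] at hr
  rw [hr, ramProd]
  obtain ⟨e1, e2, e3, e4, e5⟩ : _ ∧ _ ∧ _ ∧ _ ∧ _ := ⟨h.e1, h.e2, h.e3, h.e4, h.e5⟩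
  have s1 : -2 * cB b * (a4 + c4) - (-u - 2 * cB b * (a3 + c3)) - cB b =
      -(cB b * (1 - 2 * a1) - (u : ℂ)) := by rw [e1, e2, e4]; push_cast; ring
  have s2 : cB b - (x + 2 * cB b * (a3 - a4)) = cB b * (1 - 2 * a2) - x := by
    rw [e2]; push_cast; ring
  have s3 : -(cB b * (1 - 2 * a1) - (u : ℂ)) - (x + 2 * cB b * (a3 - a4)) =
      -(cB b * (1 - 2 * a0) - ((u - x : ℝ) : ℂ)) := by rw [e1, e2]; push_cast; ring
  rw [s1, s2, s3]
  have hne := PhiS_ne_zero b (-(cB b * (1 - 2 * a0) - ((u - x : ℝ) : ℂ)))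
  have key : ∀ {X0 X0' X1 X1' X2 ε0 ε1 p2 p3 p4 p5 p6 p7 p8 : ℂ}, X0' ≠ 0 →
      X0 * X0' = ζ * Complex.exp ε0 → X1 * X1' = ζ * Complex.exp ε1 →
      p2 + p3 + p4 + ε0 = p5 + p6 + p7 + p8 + ε1 →
      Complex.exp p2 * (κ * (X2 * Complex.exp p3)) * (κ * (X0 * Complex.exp p4)) =
      Complex.exp p5 * (κ * (X1 * Complex.exp p6)) * (Complex.exp p7 *
        (κ * X1' * (Complex.exp p8 * (X2 * X0'⁻¹)))) := by
    intro X0 X0' X1 X1' X2 ε0 ε1 p2 p3 p4 p5 p6 p7 p8 hX h0 h1 hp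
    have hp := congrArg Complex.exp hp
    simp only [Complex.exp_add] at hp
    rw [eq_div_of_mul_eq hX h0]
    field_simp
    linear_combination (κ ^ 2 * X2 * ζ) * hp -
      κ ^ 2 * X2 * Complex.exp p5 * Complex.exp p6 * Complex.exp p7 * Complex.exp p8 * h1
  refine key hne k0 k1 ?_
  rw [psiExponent, psiExponent, psiExponent, ratioExponent, e5, e4, e3, e2, e1]
  push_cast
  ring

/-- The integrated form of the five-term relation. -/
lemma integral_psiT_mul (h : PentagonAngles a0 a1 a2 a3 a4 c0 c1 c2 c3 c4)
    (hb : 0 < b) (hle : b ≤ 1) (u v : ℝ) :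
    ∫ x : ℝ, psiT b a4 c4 (v - x) *
        (Complex.exp (-π * I * x ^ 2) * psiT b a2 c2 x * psiT b a0 c0 (u - x)) =
      Complex.exp (π * I * cB b ^ 2 * (2 * (c0 + a2 + c4) - 1 / 2) / 3) * psiT b a1 c1 u *
        (Complex.exp (-2 * π * I * u * v) * psiT b a3 c3 v) := by
  simp_rw [h.exp_mul_psiT_mul_psiT hb hle, mul_left_comm (psiT b a4 c4 _)]
  rw [integral_const_mul]
  congr 1
  have hρ : Integrable fun q : ℝ => psiF b a3 c3 (q - u : ℝ) * (psiF b a4 c4 q)⁻¹ := by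
    simpa using h.integrable_ratio_mul_exp hb hle u 0
  have := integral_fourier_mul_fourier_sub hρ (continuous_psiF hb hle h.ha4 h.hc4 h.hb4)
    (integrable_psiF hb hle h.ha4 h.hc4 h.hb4) (integrable_psiT hb hle h.ha4 h.hc4 h.hb4) v
  refine this.trans ?_
  rw [psiT, ← integral_const_mul, ← integral_add_right_eq_self _ u]
  refine integral_congr_ae (ae_of_all _ fun q => ?_)
  have hne := psiF_ne_zero hb h.ha4 h.hc4 h.hb4 (q + u)
  dsimp only
  rw [inv_mul_cancel_right₀ hne, add_sub_cancel_right, mul_left_comm, ← Complex.exp_add]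
  congr 2
  push_cast; ring

/-- The five-term relation for the functions `ψ̃'`. -/
lemma integral_psiT' (h : PentagonAngles a0 a1 a2 a3 a4 c0 c1 c2 c3 c4)
    (hb : 0 < b) (hle : b ≤ 1) (u v : ℝ) :
    ∫ x : ℝ, psiT' b a4 c4 (v - x) * psiT' b a2 c2 x * psiT' b a0 c0 (u - x) *
        Complex.exp (2 * π * I * (u - x) * (v - x)) =
      Complex.exp (π * I * cB b ^ 2 * (2 * (c0 + a2 + c4) - 1 / 2) / 3) * psiT' b a1 c1 u *
        psiT' b a3 c3 v := by
  have e : ∀ x : ℝ, psiT' b a4 c4 (v - x) * psiT' b a2 c2 x * psiT' b a0 c0 (u - x) *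
      Complex.exp (2 * π * I * (u - x) * (v - x)) = Complex.exp (-π * I * (u - v) ^ 2) *
        (psiT b a4 c4 (v - x) *
          (Complex.exp (-π * I * x ^ 2) * psiT b a2 c2 x * psiT b a0 c0 (u - x))) := fun x => by
    rw [psiT', psiT', psiT']
    have : Complex.exp (-π * I * ((v - x : ℝ) : ℂ) ^ 2) * Complex.exp (-π * I * x ^ 2) *
        Complex.exp (-π * I * ((u - x : ℝ) : ℂ) ^ 2) *
        Complex.exp (2 * π * I * (u - x) * (v - x)) =
        Complex.exp (-π * I * (u - v) ^ 2) * Complex.exp (-π * I * x ^ 2) := by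
      simp only [← Complex.exp_add]; congr 1; push_cast; ring
    linear_combination psiT b a4 c4 (v - x) * psiT b a2 c2 x * psiT b a0 c0 (u - x) * this
  simp_rw [e]
  rw [integral_const_mul, h.integral_psiT_mul hb hle, psiT', psiT']
  have : Complex.exp (-π * I * (u - v) ^ 2) * Complex.exp (-2 * π * I * u * v) =
      Complex.exp (-π * I * u ^ 2) * Complex.exp (-π * I * v ^ 2) := by
    simp only [← Complex.exp_add]; congr 1; ring
  linear_combination Complex.exp (π * I * cB b ^ 2 * (2 * (c0 + a2 + c4) - 1 / 2) / 3) *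
    psiT b a1 c1 u * psiT b a3 c3 v * this

end PentagonAngles

end PentagonIntegral

section LatticeSums

open Complex (I)
open Set Filter Topology

variable {b a c a0 a1 a2 a3 a4 c0 c1 c2 c3 c4 : ℝ}

/-- The `m`-th term of the series defining `g_{a,c}(s,t)`. -/
def gTerm (b a c s t : ℝ) (m : ℤ) : ℂ :=
  psiT' b a c (s + m) * Complex.exp (I * π * t * (s + 2 * m))

lemma norm_psiT' (b a c s : ℝ) : ‖psiT' b a c s‖ = ‖psiT b a c s‖ := by
  rw [psiT', norm_mul, show -π * I * (s : ℂ) ^ 2 = ((-π * s ^ 2 : ℝ) : ℂ) * I by push_cast; ring,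
    Complex.norm_exp_ofReal_mul_I, one_mul]

lemma norm_gTerm (b a c s t : ℝ) (m : ℤ) : ‖gTerm b a c s t m‖ = ‖psiT b a c (s + m)‖ := by
  rw [gTerm, norm_mul, norm_psiT',
    show I * π * t * (s + 2 * m) = ((π * t * (s + 2 * m) : ℝ) : ℂ) * I by push_cast; ring,
    Complex.norm_exp_ofReal_mul_I, mul_one]

lemma continuous_psiT' (hb : 0 < b) (hb1 : b ≤ 1) (ha : 0 < a) (hc : 0 < c)
    (hac : 0 < 1 / 2 - a - c) : Continuous (psiT' b a c) := by
  have := continuous_psiT hb hb1 ha hc hac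
  unfold psiT'
  fun_prop

lemma summable_exp_neg_mul_abs_int {m : ℝ} (hm : 0 < m) :
    Summable fun n : ℤ => Real.exp (-(m * |(n : ℝ)|)) := by
  have h : Summable fun n : ℕ => Real.exp (-(m * (n : ℝ))) := by
    have := Real.summable_exp_nat_mul_iff.2 (neg_neg_of_pos hm)
    exact this.congr fun n => by congr 1; ring
  exact Summable.of_nat_of_neg (by simpa using h) (by simpa using h)

lemma exists_summable_norm_psiT_add_le (hb : 0 < b) (hb1 : b ≤ 1) (ha : 0 < a) (hc : 0 < c)
    (hac : 0 < 1 / 2 - a - c) (R : ℝ) :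
    ∃ A : ℤ → ℝ, Summable A ∧ (∀ n, 0 ≤ A n) ∧
      ∀ s, |s| ≤ R → ∀ n : ℤ, ‖psiT b a c (s + n)‖ ≤ A n := by
  obtain ⟨C, m, hC, hm, h⟩ := exists_norm_psiT_le hb hb1 ha hc hac
  refine ⟨fun n => C * Real.exp (m * R) * Real.exp (-(m * |(n : ℝ)|)),
    (summable_exp_neg_mul_abs_int hm).mul_left _, fun n => by positivity, fun s hs n => ?_⟩
  refine (h _).trans ?_
  dsimp only
  rw [mul_assoc, ← Real.exp_add]
  have h1 : |(n : ℝ)| ≤ |s + n| + |s| := by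
    have := abs_sub (s + n : ℝ) s
    rwa [add_sub_cancel_left] at this
  gcongr
  nlinarith

lemma summable_norm_gTerm (hb : 0 < b) (hb1 : b ≤ 1) (ha : 0 < a) (hc : 0 < c)
    (hac : 0 < 1 / 2 - a - c) (s t : ℝ) : Summable fun m => ‖gTerm b a c s t m‖ := by
  obtain ⟨A, hA, -, h⟩ := exists_summable_norm_psiT_add_le hb hb1 ha hc hac |s|
  refine hA.of_nonneg_of_le (fun _ => norm_nonneg _) fun m => ?_
  rw [norm_gTerm]
  exact h s le_rfl m

lemma hasSum_gTerm (hb : 0 < b) (hb1 : b ≤ 1) (ha : 0 < a) (hc : 0 < c)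
    (hac : 0 < 1 / 2 - a - c) (s t : ℝ) : HasSum (gTerm b a c s t) (gW b a c s t) :=
  (summable_norm_gTerm hb hb1 ha hc hac s t).of_norm.hasSum

lemma continuous_gTerm (hb : 0 < b) (hb1 : b ≤ 1) (ha : 0 < a) (hc : 0 < c)
    (hac : 0 < 1 / 2 - a - c) {s t : ℝ → ℝ} (hs : Continuous s) (ht : Continuous t) (m : ℤ) :
    Continuous fun x => gTerm b a c (s x) (t x) m := by
  have := continuous_psiT' hb hb1 ha hc hac
  unfold gTerm
  fun_prop

lemma hasSum_mul_mul {R : Type*} [NormedRing R] [CompleteSpace R] {f g k : ℤ → R}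
    (hf : Summable fun m => ‖f m‖) (hg : Summable fun m => ‖g m‖) (hk : Summable fun m => ‖k m‖) :
    HasSum (fun p : ℤ × ℤ × ℤ => f p.1 * (g p.2.1 * k p.2.2))
      ((∑' m, f m) * ((∑' m, g m) * ∑' m, k m)) := by
  have h1 : HasSum (fun q : ℤ × ℤ => g q.1 * k q.2) ((∑' m, g m) * ∑' m, k m) :=
    hg.of_norm.hasSum.mul hk.of_norm.hasSum (summable_mul_of_summable_norm hg hk)
  have h2 : Summable fun p : ℤ × ℤ × ℤ => f p.1 * (g p.2.1 * k p.2.2) :=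
    summable_mul_of_summable_norm (g := fun q : ℤ × ℤ => g q.1 * k q.2) hf (hg.mul_norm hk)
  exact HasSum.mul (f := f) (g := fun q : ℤ × ℤ => g q.1 * k q.2) hf.of_norm.hasSum h1 h2

namespace PentagonAngles

/-- The integrand on the real line whose lattice translates make up the product of the three
weights on the left-hand side of the pentagon identity. -/
def lineIntegrand (b a0 a2 a4 c0 c2 c4 α β γ δ : ℝ) (k n : ℤ) (x : ℝ) : ℂ :=
  Complex.exp (I * π * (δ * (γ + 2 * k))) * Complex.exp (I * π * (β * (α + 2 * n))) *
    (psiT' b a4 c4 (γ + k - x) * psiT' b a2 c2 x * psiT' b a0 c0 (α + n - x) *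
      Complex.exp (2 * π * I * ((α + n : ℝ) - x) * ((γ + k : ℝ) - x)))

lemma gTerm_mul_gTerm_mul_gTerm (α β γ δ σ : ℝ) (m k n : ℤ) :
    gTerm b a2 c2 σ (β + δ) m * (gTerm b a4 c4 (γ - σ) (α + δ - σ) (k - m) *
      gTerm b a0 c0 (α - σ) (β + γ - σ) (n - m)) =
      lineIntegrand b a0 a2 a4 c0 c2 c4 α β γ δ k n (σ + m) := by
  rw [gTerm, gTerm, gTerm, lineIntegrand,
    show γ - σ + ((k - m : ℤ) : ℝ) = γ + k - (σ + m) by push_cast; ring,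
    show α - σ + ((n - m : ℤ) : ℝ) = α + n - (σ + m) by push_cast; ring]
  have : Complex.exp (I * π * (β + δ : ℝ) * (σ + 2 * m)) *
      (Complex.exp (I * π * (α + δ - σ : ℝ) * ((γ - σ : ℝ) + 2 * (k - m : ℤ))) *
      Complex.exp (I * π * (β + γ - σ : ℝ) * ((α - σ : ℝ) + 2 * (n - m : ℤ)))) =
      Complex.exp (I * π * (δ * (γ + 2 * k))) * Complex.exp (I * π * (β * (α + 2 * n))) *
      Complex.exp (2 * π * I * ((α + n : ℝ) - (σ + m : ℝ)) * ((γ + k : ℝ) - (σ + m : ℝ))) := by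
    simp only [← Complex.exp_add]
    refine Complex.exp_eq_exp_iff_exists_int.2 ⟨-((n - m) * (k - m)), ?_⟩
    push_cast
    ring
  linear_combination psiT' b a4 c4 (γ + k - (σ + m)) * psiT' b a2 c2 (σ + m) *
    psiT' b a0 c0 (α + n - (σ + m)) * this

lemma integrable_lineIntegrand (h : PentagonAngles a0 a1 a2 a3 a4 c0 c1 c2 c3 c4)
    (hb : 0 < b) (hle : b ≤ 1) (α β γ δ : ℝ) (k n : ℤ) :
    Integrable (lineIntegrand b a0 a2 a4 c0 c2 c4 α β γ δ k n) := by
  obtain ⟨C, m, hC, hm, h2⟩ := exists_norm_psiT_le hb hle h.ha2 h.hc2 h.hb2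
  obtain ⟨C4, m4, hC4, hm4, h4⟩ := exists_norm_psiT_le hb hle h.ha4 h.hc4 h.hb4
  obtain ⟨C0, m0, hC0, hm0, h0⟩ := exists_norm_psiT_le hb hle h.ha0 h.hc0 h.hb0
  have k4 := continuous_psiT' hb hle h.ha4 h.hc4 h.hb4
  have k2 := continuous_psiT' hb hle h.ha2 h.hc2 h.hb2
  have k0 := continuous_psiT' hb hle h.ha0 h.hc0 h.hb0
  refine integrable_of_norm_le_exp (C := C4 * C0 * C) (by unfold lineIntegrand; fun_prop) hm
    fun x => ?_
  have n1 : ∀ r : ℝ, ‖Complex.exp (r * I)‖ = 1 := Complex.norm_exp_ofReal_mul_I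
  rw [lineIntegrand,
    show I * π * (δ * (γ + 2 * k)) = ((π * (δ * (γ + 2 * k)) : ℝ) : ℂ) * I by push_cast; ring,
    show I * π * (β * (α + 2 * n)) = ((π * (β * (α + 2 * n)) : ℝ) : ℂ) * I by push_cast; ring,
    show 2 * π * I * ((α + n : ℝ) - (x : ℂ)) * ((γ + k : ℝ) - x) =
      ((2 * π * (α + n - x) * (γ + k - x) : ℝ) : ℂ) * I by push_cast; ring]
  simp only [norm_mul, n1, norm_psiT', one_mul, mul_one]
  have q4 : ‖psiT b a4 c4 (γ + k - x)‖ ≤ C4 :=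
    (h4 _).trans (mul_le_of_le_one_right hC4.le (Real.exp_le_one_iff.2 (by simp; positivity)))
  have q0 : ‖psiT b a0 c0 (α + n - x)‖ ≤ C0 :=
    (h0 _).trans (mul_le_of_le_one_right hC0.le (Real.exp_le_one_iff.2 (by simp; positivity)))
  calc _ ≤ C4 * (C * Real.exp (-(m * |x|))) * C0 := by gcongr; exact h2 x
    _ = _ := by ring

lemma integral_lineIntegrand (h : PentagonAngles a0 a1 a2 a3 a4 c0 c1 c2 c3 c4)
    (hb : 0 < b) (hle : b ≤ 1) (α β γ δ : ℝ) (k n : ℤ) :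
    ∫ x, lineIntegrand b a0 a2 a4 c0 c2 c4 α β γ δ k n x =
      Complex.exp (π * I * cB b ^ 2 * (2 * (c0 + a2 + c4) - 1 / 2) / 3) *
        (gTerm b a3 c3 γ δ k * gTerm b a1 c1 α β n) := by
  simp_rw [lineIntegrand]
  rw [integral_const_mul, h.integral_psiT' hb hle, gTerm, gTerm]
  simp only [mul_assoc]
  ring

lemma hasSum_integral_gTerm (h : PentagonAngles a0 a1 a2 a3 a4 c0 c1 c2 c3 c4)
    (hb : 0 < b) (hle : b ≤ 1) (α β γ δ : ℝ) :
    HasSum (fun p : ℤ × ℤ × ℤ => ∫ σ in (0 : ℝ)..1, gTerm b a2 c2 σ (β + δ) p.1 *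
        (gTerm b a4 c4 (γ - σ) (α + δ - σ) p.2.1 * gTerm b a0 c0 (α - σ) (β + γ - σ) p.2.2))
      (∫ σ in (0 : ℝ)..1, gW b a4 c4 (γ - σ) (α + δ - σ) * gW b a2 c2 σ (β + δ) *
        gW b a0 c0 (α - σ) (β + γ - σ)) := by
  obtain ⟨A2, s2, p2, h2⟩ := exists_summable_norm_psiT_add_le hb hle h.ha2 h.hc2 h.hb2 1
  obtain ⟨A4, s4, p4, h4⟩ := exists_summable_norm_psiT_add_le hb hle h.ha4 h.hc4 h.hb4 (|γ| + 1)
  obtain ⟨A0, s0, p0, h0⟩ := exists_summable_norm_psiT_add_le hb hle h.ha0 h.hc0 h.hb0 (|α| + 1)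
  have hs : Summable fun p : ℤ × ℤ × ℤ => A2 p.1 * (A4 p.2.1 * A0 p.2.2) :=
    s2.mul_of_nonneg (s4.mul_of_nonneg s0 p4 p0) p2 fun q => mul_nonneg (p4 _) (p0 _)
  refine intervalIntegral.hasSum_integral_of_dominated_convergence
    (fun p _ => A2 p.1 * (A4 p.2.1 * A0 p.2.2)) (fun p => ?_) (fun p => ?_) ?_ ?_ ?_
  · refine Continuous.aestronglyMeasurable ?_
    exact (continuous_gTerm hb hle h.ha2 h.hc2 h.hb2 (by fun_prop) (by fun_prop) _).mul
      ((continuous_gTerm hb hle h.ha4 h.hc4 h.hb4 (by fun_prop) (by fun_prop) _).mul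
      (continuous_gTerm hb hle h.ha0 h.hc0 h.hb0 (by fun_prop) (by fun_prop) _))
  · refine ae_of_all _ fun σ hσ => ?_
    rw [uIoc_of_le zero_le_one] at hσ
    have hσ1 : |σ| ≤ 1 := abs_le.2 ⟨by linarith [hσ.1], hσ.2⟩
    simp only [norm_mul, norm_gTerm]
    have := p2 p.1
    have := p4 p.2.1
    have := p0 p.2.2
    gcongr
    · exact h2 σ hσ1 _
    · exact h4 _ ((abs_sub _ _).trans (by linarith)) _
    · exact h0 _ ((abs_sub _ _).trans (by linarith)) _
  · exact ae_of_all _ fun _ _ => hs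
  · exact intervalIntegrable_const
  · refine ae_of_all _ fun σ _ => ?_
    have t2 := summable_norm_gTerm hb hle h.ha2 h.hc2 h.hb2 σ (β + δ)
    have t4 := summable_norm_gTerm hb hle h.ha4 h.hc4 h.hb4 (γ - σ) (α + δ - σ)
    have t0 := summable_norm_gTerm hb hle h.ha0 h.hc0 h.hb0 (α - σ) (β + γ - σ)
    rw [mul_comm (gW b a4 c4 _ _), mul_assoc]
    exact hasSum_mul_mul t2 t4 t0

/-- The left-hand side of the pentagon identity as a lattice sum of integrals over the line. -/
lemma hasSum_integral_lineIntegrand (h : PentagonAngles a0 a1 a2 a3 a4 c0 c1 c2 c3 c4)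
    (hb : 0 < b) (hle : b ≤ 1) (α β γ δ : ℝ) :
    HasSum (fun q : ℤ × ℤ => ∫ x, lineIntegrand b a0 a2 a4 c0 c2 c4 α β γ δ q.1 q.2 x)
      (∫ σ in (0 : ℝ)..1, gW b a4 c4 (γ - σ) (α + δ - σ) * gW b a2 c2 σ (β + δ) *
        gW b a0 c0 (α - σ) (β + γ - σ)) := by
  let e : (ℤ × ℤ) × ℤ ≃ ℤ × ℤ × ℤ :=
    { toFun := fun p => (p.2, p.1.1 - p.2, p.1.2 - p.2)
      invFun := fun p => ((p.2.1 + p.1, p.2.2 + p.1), p.1)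
      left_inv := fun p => by simp
      right_inv := fun p => by simp }
  have h1 := e.hasSum_iff.2 (h.hasSum_integral_gTerm hb hle α β γ δ)
  refine h1.prod_fiberwise fun q => ?_
  have h2 := h.integrable_lineIntegrand hb hle α β γ δ q.1 q.2
  have h2 := h2.hasSum_intervalIntegral_comp_add_int
  simp only [Function.comp, e, Equiv.coe_fn_mk, gTerm_mul_gTerm_mul_gTerm]
  exact h2

theorem pentagon_of_le_one (h : PentagonAngles a0 a1 a2 a3 a4 c0 c1 c2 c3 c4)
    (hb : 0 < b) (hle : b ≤ 1) (α β γ δ : ℝ) :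
    (∫ σ in (0 : ℝ)..1, gW b a4 c4 (γ - σ) (α + δ - σ) * gW b a2 c2 σ (β + δ) *
        gW b a0 c0 (α - σ) (β + γ - σ)) =
      Complex.exp (π * I * cB b ^ 2 * (2 * (c0 + a2 + c4) - 1 / 2) / 3) *
        (gW b a3 c3 γ δ * gW b a1 c1 α β) := by
  refine (h.hasSum_integral_lineIntegrand hb hle α β γ δ).unique ?_
  simp_rw [h.integral_lineIntegrand hb hle]
  refine HasSum.mul_left _ ?_
  exact (hasSum_gTerm hb hle h.ha3 h.hc3 h.hb3 γ δ).mul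
    (hasSum_gTerm hb hle h.ha1 h.hc1 h.hb1 α β)
    (summable_mul_of_summable_norm (summable_norm_gTerm hb hle h.ha3 h.hc3 h.hb3 γ δ)
      (summable_norm_gTerm hb hle h.ha1 h.hc1 h.hb1 α β))

end PentagonAngles

end LatticeSums

section InverseSymmetry

variable {b a c : ℝ}

lemma cB_inv (b : ℝ) : cB b⁻¹ = cB b := by
  simp only [cB, inv_inv, Complex.ofReal_inv]
  rw [add_comm]

lemma phiKer_inv (b : ℝ) (z w : ℂ) : phiKer b⁻¹ z w = phiKer b z w := by
  simp only [phiKer, Complex.ofReal_inv, div_inv_eq_mul, ← div_eq_mul_inv]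
  rw [mul_assoc 4, mul_comm (Complex.sinh (w / b)), ← mul_assoc]

lemma PhiS_inv (b : ℝ) (z : ℂ) : PhiS b⁻¹ z = PhiS b z := by
  simp only [PhiS, phiKer_inv, inv_inv, min_comm]

lemma psiF_inv (hb : 0 < b) (ha : 0 < a) (hc : 0 < c) (hac : 0 < 1 / 2 - a - c) (t : ℝ) :
    psiF b⁻¹ a c t = psiF b a c t := by
  rw [psiF_ofReal (inv_pos.2 hb) ha hc hac, psiF_ofReal hb ha hc hac, cB_inv, PhiS_inv]

lemma gW_inv (hb : 0 < b) (ha : 0 < a) (hc : 0 < c) (hac : 0 < 1 / 2 - a - c) :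
    gW b⁻¹ a c = gW b a c := by
  funext s t
  simp only [gW, psiT', psiT, psiF_inv hb ha hc hac]

end InverseSymmetry

/-- Pentagon identity for the tetrahedral weights (eq. (9) of the paper). -/
theorem pentagon_identity
    (bb : ℝ) (hbb : 0 < bb)
    (a0 a1 a2 a3 a4 c0 c1 c2 c3 c4 : ℝ)
    (ha0 : 0 < a0) (ha1 : 0 < a1) (ha2 : 0 < a2) (ha3 : 0 < a3) (ha4 : 0 < a4)
    (hc0 : 0 < c0) (hc1 : 0 < c1) (hc2 : 0 < c2) (hc3 : 0 < c3) (hc4 : 0 < c4)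
    (hb0 : 0 < 1 / 2 - a0 - c0) (hb1 : 0 < 1 / 2 - a1 - c1) (hb2 : 0 < 1 / 2 - a2 - c2)
    (hb3 : 0 < 1 / 2 - a3 - c3) (hb4 : 0 < 1 / 2 - a4 - c4)
    (e1 : a1 = a0 + a2) (e2 : a3 = a2 + a4) (e3 : c1 = c0 + a4)
    (e4 : c3 = a0 + c4) (e5 : c2 = c1 + c3)
    (α β γ δ : ℝ) :
    (∫ σ in (0:ℝ)..1,
        gW bb a4 c4 (γ - σ) (α + δ - σ) * gW bb a2 c2 σ (β + δ) *
          gW bb a0 c0 (α - σ) (β + γ - σ)) =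
      Complex.exp (-π * Complex.I * (2 * (c0 + a2 + c4) - 1 / 2) /
          (12 * ((((bb + bb⁻¹) ^ 2)⁻¹ : ℝ) : ℂ))) *
        gW bb a1 c1 α β * gW bb a3 c3 γ δ := by
  have h : PentagonAngles a0 a1 a2 a3 a4 c0 c1 c2 c3 c4 :=
    ⟨ha0, ha2, ha4, hc0, hc4, hb0, hb1, hb2, hb3, hb4, e1, e2, e3, e4, e5⟩
  have hconst : -π * Complex.I * (2 * (c0 + a2 + c4) - 1 / 2) /
      (12 * ((((bb + bb⁻¹) ^ 2)⁻¹ : ℝ) : ℂ)) =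
      π * Complex.I * cB bb ^ 2 * (2 * (c0 + a2 + c4) - 1 / 2) / 3 := by
    rw [cB]
    push_cast
    rw [div_mul_eq_div_div, div_inv_eq_mul, div_pow, mul_pow, Complex.I_sq]
    ring
  rw [hconst, mul_assoc, mul_comm (gW bb a1 c1 α β)]
  rcases le_total bb 1 with hle | hle
  · exact h.pentagon_of_le_one hbb hle α β γ δ
  · have := h.pentagon_of_le_one (inv_pos.2 hbb) (inv_le_one_of_one_le₀ hle) α β γ δ
    rwa [gW_inv hbb ha0 hc0 hb0, gW_inv hbb ha1 hc1 hb1, gW_inv hbb ha2 hc2 hb2,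
      gW_inv hbb ha3 hc3 hb3, gW_inv hbb ha4 hc4 hb4, cB_inv] at this
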